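/- arXiv:2510.24326 — 3 statements merged into one kernel-verified Lean document; each statement's English description precedes it below -/
import Mathlib

section
/- Let A be a C*-algebra and let E ⊆ F ⊆ A be selfadjoint subspaces of A. Then the following are equivalent: (1) for every n ∈ ℕ, every contractive positive functional on Mₙ(E) extends to a contractive positive functional on Mₙ(F); (2) for every k ∈ ℕ, every CCP map φ : E → Mₖ(ℂ) extends to a CCP map F → Mₖ(ℂ); (3) for every complex Hilbert space K, every CCP map φ : E → B(K) extends to a CCP map F → B(K); (4) for every n ∈ ℕ and every selfadjoint X ∈ Mₙ(E), Metric.infDist X Mₙ(E)₊ = Metric.infDist X Mₙ(F)₊ (i.e., the inclusion E ⊆ F is a gauge maximal isometry). -/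
open scoped ComplexOrder

noncomputable section

universe u v

/-- The `n`-th matrix level `Mₙ(E)` of a subspace `E` of a C*-algebra `A`, realized inside a
C*-algebra `M` given together with a ⋆-algebra isomorphism `e : Mₙ(A) ≃⋆ₐ[ℂ] M` (the C*-norm
on `Mₙ(A)` is unique, so this fully determines the norm and order structure of `Mₙ(E)`). -/
def matrixLevel {A M : Type*} [NonUnitalCStarAlgebra A] [NonUnitalCStarAlgebra M] {n : ℕ}
    (E : Submodule ℂ A) (e : Matrix (Fin n) (Fin n) A ≃⋆ₐ[ℂ] M) : Submodule ℂ M where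
  carrier := {X : M | ∀ i j, e.symm X i j ∈ E}
  add_mem' := by
    intro a b ha hb i j
    rw [map_add, Matrix.add_apply]
    exact E.add_mem (ha i j) (hb i j)
  zero_mem' := by
    intro i j
    rw [map_zero]
    exact E.zero_mem
  smul_mem' := by
    intro c a ha i j
    rw [map_smul, Matrix.smul_apply]
    exact E.smul_mem c (ha i j)

/-- `φ` is a (selfadjoint) positive functional on the subspace `S` of a C*-algebra:
it is star-preserving and takes nonnegative (real) values on the positive elements of `S`. -/
def IsPositiveFunctional {B : Type*} [NonUnitalCStarAlgebra B] [PartialOrder B]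
    (S : Submodule ℂ B) (φ : S →L[ℂ] ℂ) : Prop :=
  (∀ (x : B) (hx : x ∈ S) (hsx : star x ∈ S), φ ⟨star x, hsx⟩ = starRingEnd ℂ (φ ⟨x, hx⟩)) ∧
    ∀ (x : B) (hx : x ∈ S), 0 ≤ x → 0 ≤ φ ⟨x, hx⟩

/-- `φ : S → B` is completely contractive and completely positive (CCP): it is star-preserving,
and each entrywise amplification `φ⁽ⁿ⁾ : Mₙ(S) → Mₙ(B)` is contractive and positive.  The matrix
C*-algebras `Mₙ(A)` and `Mₙ(B)` are realized via families of ⋆-algebra isomorphisms onto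
C*-algebras `M n` and `N n`. -/
def IsCCP {A : Type*} [NonUnitalCStarAlgebra A]
    {B : Type*} [NonUnitalRing B] [Module ℂ B] [StarRing B]
    (S : Submodule ℂ A)
    (M : ℕ → Type*) [∀ n, NonUnitalCStarAlgebra (M n)]
    (e : ∀ n, Matrix (Fin n) (Fin n) A ≃⋆ₐ[ℂ] M n)
    (N : ℕ → Type*) [∀ n, NonUnitalCStarAlgebra (N n)] [∀ n, PartialOrder (N n)]
    [∀ n, StarOrderedRing (N n)] [∀ n, PartialOrder (M n)] [∀ n, StarOrderedRing (M n)]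
    (f : ∀ n, Matrix (Fin n) (Fin n) B ≃⋆ₐ[ℂ] N n)
    (φ : S →ₗ[ℂ] B) : Prop :=
  (∀ (x : A) (hx : x ∈ S) (hsx : star x ∈ S), φ ⟨star x, hsx⟩ = star (φ ⟨x, hx⟩)) ∧
    ∀ (n : ℕ) (X : M n) (hX : ∀ i j, (e n).symm X i j ∈ S),
      ‖(f n) (Matrix.of fun i j => φ ⟨(e n).symm X i j, hX i j⟩)‖ ≤ ‖X‖ ∧
        (0 ≤ X → 0 ≤ (f n) (Matrix.of fun i j => φ ⟨(e n).symm X i j, hX i j⟩))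


section InjectiveStarHom

variable {A B F : Type*} [NonUnitalCStarAlgebra A] [NonUnitalCStarAlgebra B]
  [FunLike F A B] [StarHomClass F A B]

theorem IsSelfAdjoint.of_map_injective (π : F) (hπ : Function.Injective π) {a : A}
    (ha : IsSelfAdjoint (π a)) : IsSelfAdjoint a :=
  hπ (by rw [map_star]; exact ha)

theorem nonneg_map_iff_of_injective [NonUnitalAlgHomClass F ℂ A B] [PartialOrder A]
    [StarOrderedRing A] [PartialOrder B]
    [StarOrderedRing B] (π : F) (hπ : Function.Injective π) {a : A} : 0 ≤ π a ↔ 0 ≤ a := by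
  have key (ha : IsSelfAdjoint a) : 0 ≤ π a ↔ 0 ≤ a := by
    rw [← Unitization.inr_nonneg_iff, ← Unitization.inr_nonneg_iff (a := a)]
    have ha' : IsSelfAdjoint (a : Unitization ℂ A) := ha.inr ℂ
    have hb' : IsSelfAdjoint (π a : Unitization ℂ B) := (ha.map π).inr ℂ
    have h := ha'.map_spectrum_real (Unitization.starMap (π : A →⋆ₙₐ[ℂ] B))
      (Unitization.starMap_injective hπ)
    have h2 : Unitization.starMap (π : A →⋆ₙₐ[ℂ] B) (a : Unitization ℂ A) = (π a : B) := by
      simp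
    rw [h2] at h
    rw [StarOrderedRing.nonneg_iff_spectrum_nonneg (R := ℝ) _ hb',
      StarOrderedRing.nonneg_iff_spectrum_nonneg (R := ℝ) _ ha', h]
  exact ⟨fun h => (key (.of_map_injective π hπ (.of_nonneg h))).1 h,
    fun h => (key (.of_nonneg h)).2 h⟩

end InjectiveStarHom

theorem CStarAlgebra.norm_le_iff_algebraMap_bounds {A : Type*} [CStarAlgebra A] [PartialOrder A]
    [StarOrderedRing A] {a : A} (ha : IsSelfAdjoint a) {t : ℝ} (ht : 0 ≤ t) :
    ‖a‖ ≤ t ↔ 0 ≤ algebraMap ℝ A t + a ∧ 0 ≤ algebraMap ℝ A t - a := by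
  constructor
  · intro h
    have h1 : algebraMap ℝ A ‖a‖ ≤ algebraMap ℝ A t := algebraMap_mono A h
    have h2 := ha.neg_algebraMap_norm_le_self
    have h3 := ha.le_algebraMap_norm_self
    constructor
    · rw [← neg_le_iff_add_nonneg']
      exact (neg_le_neg h1).trans h2
    · exact sub_nonneg.2 (h3.trans h1)
  · rintro ⟨h1, h2⟩
    rcases subsingleton_or_nontrivial A with hA | hA
    · rwa [Subsingleton.elim a 0, norm_zero]
    rcases CStarAlgebra.norm_or_neg_norm_mem_spectrum (a := a) ha with h | h
    · have := (le_algebraMap_iff_spectrum_le (r := t) ha).1 (sub_nonneg.1 h2) _ h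
      exact this
    · have := (algebraMap_le_iff_le_spectrum (r := -t) ha).1
        (by rw [map_neg]; exact neg_le_iff_add_nonneg'.2 h1) _ h
      linarith

theorem CStarAlgebra.exists_eq_star_mul_self {A : Type*} [NonUnitalCStarAlgebra A] [PartialOrder A]
    [StarOrderedRing A] {a : A} (ha : 0 ≤ a) : ∃ b, a = star b * b :=
  CStarAlgebra.nonneg_iff_eq_star_mul_self.1 ha

/-- Positivity of a square matrix over a unital C*-algebra, in the C*-algebra of matrices. -/
def MNonneg {R ι : Type*} [CStarAlgebra R] [PartialOrder R] [StarOrderedRing R] [Fintype ι]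
    (X : Matrix ι ι R) : Prop := 0 ≤ CStarMatrix.ofMatrixStarAlgEquiv X

/-- The congruence `Y ↦ B Y Bᴴ` by a scalar matrix `B`. -/
def mcongr {V ι κ : Type*} [AddCommGroup V] [Module ℂ V] [Fintype ι] (B : Matrix κ ι ℂ)
    (Y : Matrix ι ι V) : Matrix κ κ V :=
  Matrix.of fun a b => ∑ i, ∑ j, (B a i * star (B b j)) • Y i j

section mcongr

variable {V W ι κ μ : Type*} [AddCommGroup V] [Module ℂ V] [AddCommGroup W] [Module ℂ W]
  [Fintype ι]

theorem mcongr_add (B : Matrix κ ι ℂ) (X Y : Matrix ι ι V) :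
    mcongr B (X + Y) = mcongr B X + mcongr B Y := by
  ext a b
  simp [mcongr, Finset.sum_add_distrib]

theorem mcongr_sub (B : Matrix κ ι ℂ) (X Y : Matrix ι ι V) :
    mcongr B (X - Y) = mcongr B X - mcongr B Y := by
  ext a b
  simp [mcongr, Finset.sum_sub_distrib, smul_sub]

theorem mcongr_map (B : Matrix κ ι ℂ) (X : Matrix ι ι V) (f : V →ₗ[ℂ] W) :
    (mcongr B X).map f = mcongr B (X.map f) := by
  ext a b
  simp [mcongr]

theorem mcongr_complex (B : Matrix κ ι ℂ) (X : Matrix ι ι ℂ) :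
    mcongr B X = B * X * B.conjTranspose := by
  ext a b
  simp only [mcongr, Matrix.of_apply, Matrix.mul_apply, Matrix.conjTranspose_apply, Finset.sum_mul,
    smul_eq_mul]
  rw [Finset.sum_comm]
  refine Finset.sum_congr rfl fun i _ => Finset.sum_congr rfl fun j _ => ?_
  ring

theorem mcongr_mcongr [Fintype κ] (C : Matrix μ κ ℂ) (B : Matrix κ ι ℂ) (X : Matrix ι ι V) :
    mcongr C (mcongr B X) = mcongr (C * B) X := by
  ext a b
  simp only [mcongr, Matrix.of_apply, Matrix.mul_apply, Finset.smul_sum, smul_smul, star_sum,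
    Finset.sum_mul, Finset.mul_sum, Finset.sum_smul, star_mul']
  simp only [← Finset.sum_product']
  refine Finset.sum_bij' (fun x _ => (x.2.2.1, x.2.2.2, x.2.1, x.1))
    (fun x _ => (x.2.2.2, x.2.2.1, x.1, x.2.1)) ?_ ?_ ?_ ?_ ?_ <;> try simp
  intros
  congr 1
  ring

theorem mcongr_one [DecidableEq ι] (X : Matrix ι ι V) : mcongr (1 : Matrix ι ι ℂ) X = X := by
  ext a b
  simp [mcongr, Matrix.one_apply, ite_smul]

theorem mcongr_conjTranspose [StarAddMonoid V] [StarModule ℂ V] (B : Matrix κ ι ℂ)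
    (X : Matrix ι ι V) : (mcongr B X).conjTranspose = mcongr B X.conjTranspose := by
  ext a b
  simp only [mcongr, Matrix.conjTranspose_apply, Matrix.of_apply, star_sum, star_smul, star_mul',
    star_star]
  rw [Finset.sum_comm]
  refine Finset.sum_congr rfl fun i _ => Finset.sum_congr rfl fun j _ => ?_
  rw [mul_comm]

end mcongr

namespace MNonneg

variable {R ι κ : Type*} [CStarAlgebra R] [PartialOrder R] [StarOrderedRing R] [Fintype ι]
  [Fintype κ]

theorem add {X Y : Matrix ι ι R} (hX : MNonneg X) (hY : MNonneg Y) : MNonneg (X + Y) := by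
  unfold MNonneg at *
  rw [map_add]
  exact add_nonneg hX hY

theorem zero : MNonneg (0 : Matrix ι ι R) := by
  unfold MNonneg
  rw [map_zero]

theorem sum {σ : Type*} (s : Finset σ) {X : σ → Matrix ι ι R} (h : ∀ i ∈ s, MNonneg (X i)) :
    MNonneg (∑ i ∈ s, X i) :=
  Finset.sum_induction _ MNonneg (fun _ _ => add) zero h

theorem smul {X : Matrix ι ι R} (hX : MNonneg X) {t : ℝ} (ht : 0 ≤ t) :
    MNonneg ((t : ℂ) • X) := by
  unfold MNonneg at *
  rw [map_smul]
  exact smul_nonneg (by exact_mod_cast ht) hX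

/-- Gram matrices are positive. -/
theorem gram (W : Matrix κ ι R) : MNonneg (W.conjTranspose * W) := by
  rcases isEmpty_or_nonempty ι with h | ⟨⟨i₀⟩⟩
  · rw [Subsingleton.elim (W.conjTranspose * W) 0]
    exact zero
  classical
  have : W.conjTranspose * W = ∑ k, (Matrix.of fun i j => if i = i₀ then W k j else 0 :
      Matrix ι ι R).conjTranspose * (Matrix.of fun i j => if i = i₀ then W k j else 0) := by
    ext i j
    simp [Matrix.sum_apply, Matrix.mul_apply, Matrix.conjTranspose_apply]
  rw [this]
  refine sum _ fun k _ => ?_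
  unfold MNonneg
  rw [map_mul, ← Matrix.star_eq_conjTranspose, map_star]
  exact star_mul_self_nonneg _

theorem exists_gram [DecidableEq ι] {X : Matrix ι ι R} (hX : MNonneg X) :
    ∃ W : Matrix ι ι R, X = W.conjTranspose * W := by
  have hX' : 0 ≤ CStarMatrix.ofMatrixStarAlgEquiv X := hX
  obtain ⟨b, hb⟩ := CStarAlgebra.exists_eq_star_mul_self hX'
  refine ⟨CStarMatrix.ofMatrixStarAlgEquiv.symm b, ?_⟩
  rw [← CStarMatrix.ofMatrixStarAlgEquiv.symm_apply_apply X, hb, map_mul, map_star,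
    Matrix.star_eq_conjTranspose]

theorem mcongr [DecidableEq ι] {X : Matrix ι ι R} (hX : MNonneg X) (B : Matrix κ ι ℂ) :
    MNonneg (mcongr B X) := by
  obtain ⟨W, rfl⟩ := hX.exists_gram
  convert gram (Matrix.of fun k a => ∑ j, star (B a j) • W k j) using 1
  ext a b
  simp only [_root_.mcongr, Matrix.of_apply, Matrix.mul_apply, Matrix.conjTranspose_apply, star_sum,
    star_smul, star_star, Finset.sum_mul, Finset.mul_sum, Finset.smul_sum, smul_mul_smul_comm]
  calc _ = ∑ i, ∑ k, ∑ j, (B a i * star (B b j)) • (star (W k i) * W k j) :=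
        Finset.sum_congr rfl fun i _ => Finset.sum_comm
    _ = ∑ k, ∑ i, ∑ j, (B a i * star (B b j)) • (star (W k i) * W k j) := Finset.sum_comm
    _ = _ := Finset.sum_congr rfl fun k _ => Finset.sum_comm

end MNonneg

section Matrix

open scoped MatrixOrder

theorem Matrix.PosSemidef.exists_gram {ι : Type*} [Fintype ι] {T : Matrix ι ι ℂ}
    (hT : T.PosSemidef) : ∃ B : Matrix ι ι ℂ, T = B.conjTranspose * B := by
  classical
  exact CStarAlgebra.nonneg_iff_eq_star_mul_self.mp hT.nonneg

theorem Matrix.PosDef.exists_gram {ι : Type*} [Fintype ι] [DecidableEq ι] {T : Matrix ι ι ℂ}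
    (hT : T.PosDef) : ∃ B : Matrix ι ι ℂ, IsUnit B ∧ T = B.conjTranspose * B :=
  CStarAlgebra.isStrictlyPositive_iff_eq_star_mul_self.mp hT.isStrictlyPositive

end Matrix

section Cone

variable {A : Type*} [NonUnitalCStarAlgebra A]

/-- The inclusion of a subspace of `A` into the unitization of `A`. -/
def inclU (S : Submodule ℂ A) : S →ₗ[ℂ] Unitization ℂ A :=
  ((Unitization.inrNonUnitalStarAlgHom ℂ A : A →⋆ₙₐ[ℂ] Unitization ℂ A) :
    A →ₗ[ℂ] Unitization ℂ A).comp S.subtype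

theorem inclU_apply (S : Submodule ℂ A) (x : S) : inclU S x = ((x : A) : Unitization ℂ A) := rfl

/-- The scalars in the unitization of `A`. -/
def scalU (A : Type*) [NonUnitalCStarAlgebra A] : ℂ →ₗ[ℂ] Unitization ℂ A :=
  Algebra.linearMap ℂ (Unitization ℂ A)

theorem map_scalU_gram {ι κ : Type*} [Fintype κ] (B : Matrix κ ι ℂ) :
    (B.conjTranspose * B).map (scalU A) =
      (B.map (algebraMap ℂ (Unitization ℂ A))).conjTranspose *
        B.map (algebraMap ℂ (Unitization ℂ A)) := by
  ext1 i j
  simp only [Matrix.map_apply, Matrix.mul_apply, map_sum, scalU, Algebra.linearMap_apply, map_mul,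
    Matrix.conjTranspose_apply]
  refine Finset.sum_congr rfl fun k _ => ?_
  rw [← algebraMap_star_comm]

theorem MNonneg.scal {ι : Type*} [Fintype ι] {T : Matrix ι ι ℂ} (hT : T.PosSemidef) :
    MNonneg (T.map (scalU A)) := by
  classical
  obtain ⟨B, rfl⟩ := hT.exists_gram
  rw [map_scalU_gram]
  exact MNonneg.gram _

theorem scalU_smul_one {ι : Type*} [Fintype ι] [DecidableEq ι] (t : ℝ) :
    CStarMatrix.ofMatrixStarAlgEquiv (((t : ℂ) • (1 : Matrix ι ι ℂ)).map (scalU A)) =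
      algebraMap ℝ (CStarMatrix ι ι (Unitization ℂ A)) t := by
  rw [Algebra.algebraMap_eq_smul_one]
  have : ((t : ℂ) • (1 : Matrix ι ι ℂ)).map (scalU A) = (t : ℂ) • 1 := by
    ext1 i j
    by_cases hij : i = j <;> simp [hij, scalU, Algebra.algebraMap_eq_smul_one]
  rw [this, map_smul, map_one]
  exact Complex.coe_smul _ _

/-- `(X, T)` is positive in the `ι`-th matrix level of the (partial) unitization of `S`:
up to a positive matrix over `S`, the hermitian part of `X` lies between `-T` and `T`. -/
def InCone (S : Submodule ℂ A) {ι : Type*} [Fintype ι] (X : Matrix ι ι S) (T : Matrix ι ι ℂ) :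
    Prop :=
  (T + T.conjTranspose).PosSemidef ∧ ∃ P : Matrix ι ι S, MNonneg (P.map (inclU S)) ∧
    MNonneg ((T + T.conjTranspose).map (scalU A) +
      (X.map (inclU S) + (X.map (inclU S)).conjTranspose - P.map (inclU S))) ∧
    MNonneg ((T + T.conjTranspose).map (scalU A) -
      (X.map (inclU S) + (X.map (inclU S)).conjTranspose - P.map (inclU S)))

theorem MNonneg.isHermitian {R ι : Type*} [CStarAlgebra R] [PartialOrder R] [StarOrderedRing R]
    [Fintype ι] {X : Matrix ι ι R} (h : MNonneg X) : X.conjTranspose = X := by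
  classical
  obtain ⟨W, rfl⟩ := h.exists_gram
  simp

namespace InCone

variable {S : Submodule ℂ A} {ι κ : Type*} [Fintype ι] [Fintype κ]

theorem add {X Y : Matrix ι ι S} {T U : Matrix ι ι ℂ} (h : InCone S X T) (h' : InCone S Y U) :
    InCone S (X + Y) (T + U) := by
  obtain ⟨h1, P, h2, h3, h4⟩ := h
  obtain ⟨h1', P', h2', h3', h4'⟩ := h'
  refine ⟨?_, P + P', ?_, ?_, ?_⟩
  · convert h1.add h1' using 1
    rw [Matrix.conjTranspose_add]
    abel
  · convert h2.add h2' using 1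
    rw [Matrix.map_add _ (map_add _)]
  · convert h3.add h3' using 1
    simp only [Matrix.map_add _ (map_add _), Matrix.conjTranspose_add]
    abel
  · convert h4.add h4' using 1
    simp only [Matrix.map_add _ (map_add _), Matrix.conjTranspose_add]
    abel

theorem zero : InCone S (0 : Matrix ι ι S) (0 : Matrix ι ι ℂ) := by
  refine ⟨?_, 0, ?_, ?_, ?_⟩
  · simpa using Matrix.PosSemidef.zero
  all_goals
    convert MNonneg.zero (R := Unitization ℂ A) (ι := ι) using 1
    simp [Matrix.map_zero _ (map_zero _)]

theorem smul {X : Matrix ι ι S} {T : Matrix ι ι ℂ} (h : InCone S X T) {r : ℝ} (hr : 0 ≤ r) :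
    InCone S ((r : ℂ) • X) ((r : ℂ) • T) := by
  obtain ⟨h1, P, h2, h3, h4⟩ := h
  have hr' : (0 : ℂ) ≤ r := by exact_mod_cast hr
  have hs (Y : Matrix ι ι (Unitization ℂ A)) :
      ((r : ℂ) • Y).conjTranspose = (r : ℂ) • Y.conjTranspose := by
    rw [Matrix.conjTranspose_smul]; simp
  have hs' (Y : Matrix ι ι ℂ) :
      ((r : ℂ) • Y).conjTranspose = (r : ℂ) • Y.conjTranspose := by
    rw [Matrix.conjTranspose_smul]; simp
  have hm (Y : Matrix ι ι S) : ((r : ℂ) • Y).map (inclU S) = (r : ℂ) • Y.map (inclU S) := by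
    ext1; simp
  have hm' (Y : Matrix ι ι ℂ) : ((r : ℂ) • Y).map (scalU A) = (r : ℂ) • Y.map (scalU A) := by
    ext1 i j
    exact (scalU A).map_smul (r : ℂ) (Y i j)
  refine ⟨?_, (r : ℂ) • P, ?_, ?_, ?_⟩
  · rw [hs', ← smul_add]
    exact h1.smul hr'
  · rw [hm]
    exact h2.smul hr
  · rw [hs', hm, hm, hs, ← smul_add, ← smul_add, ← smul_sub, hm', ← smul_add]
    exact h3.smul hr
  · rw [hs', hm, hm, hs, ← smul_add, ← smul_add, ← smul_sub, hm', ← smul_sub]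
    exact h4.smul hr

theorem mcongr [DecidableEq ι] {X : Matrix ι ι S} {T : Matrix ι ι ℂ} (h : InCone S X T)
    (B : Matrix κ ι ℂ) : InCone S (mcongr B X) (mcongr B T) := by
  obtain ⟨h1, P, h2, h3, h4⟩ := h
  refine ⟨?_, _root_.mcongr B P, ?_, ?_, ?_⟩
  · rw [mcongr_conjTranspose, ← mcongr_add, mcongr_complex]
    exact h1.mul_mul_conjTranspose_same B
  · rw [mcongr_map]
    exact h2.mcongr B
  · rw [mcongr_conjTranspose, ← mcongr_add, mcongr_map, mcongr_map, mcongr_map,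
      mcongr_conjTranspose, ← mcongr_add, ← mcongr_sub, ← mcongr_add]
    exact h3.mcongr B
  · rw [mcongr_conjTranspose, ← mcongr_add, mcongr_map, mcongr_map, mcongr_map,
      mcongr_conjTranspose, ← mcongr_add, ← mcongr_sub, ← mcongr_sub]
    exact h4.mcongr B

theorem of_posSemidef {T : Matrix ι ι ℂ} (hT : (T + T.conjTranspose).PosSemidef) :
    InCone S (0 : Matrix ι ι S) T := by
  refine ⟨hT, 0, ?_, ?_, ?_⟩
  · convert MNonneg.zero (R := Unitization ℂ A) (ι := ι) using 1
    simp [Matrix.map_zero _ (map_zero _)]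
  all_goals
    convert MNonneg.scal (A := A) hT using 1
    simp [Matrix.map_zero _ (map_zero _)]

theorem of_nonneg {P : Matrix ι ι S} (hP : MNonneg (P.map (inclU S))) :
    InCone S P (0 : Matrix ι ι ℂ) := by
  have h : P.map (inclU S) + (P.map (inclU S)).conjTranspose - (P + P).map (inclU S) = 0 := by
    rw [hP.isHermitian, Matrix.map_add _ (map_add _), sub_self]
  refine ⟨?_, P + P, ?_, ?_, ?_⟩
  · simpa using Matrix.PosSemidef.zero
  · rw [Matrix.map_add _ (map_add _)]
    exact hP.add hP
  all_goals
    rw [h]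
    convert MNonneg.zero (R := Unitization ℂ A) (ι := ι) using 1
    simp [Matrix.map_zero _ (map_zero _)]

theorem congr {X Y : Matrix ι ι S} {T U : Matrix ι ι ℂ} (h : InCone S X T)
    (hX : X.map (inclU S) + (X.map (inclU S)).conjTranspose =
      Y.map (inclU S) + (Y.map (inclU S)).conjTranspose)
    (hT : T + T.conjTranspose = U + U.conjTranspose) : InCone S Y U := by
  unfold InCone at *
  rwa [← hX, ← hT]

theorem exists_of_large [DecidableEq ι] (X : Matrix ι ι S) :
    ∃ t : ℝ, 0 ≤ t ∧ InCone S X ((t : ℂ) • 1) := by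
  set Y : CStarMatrix ι ι (Unitization ℂ A) := CStarMatrix.ofMatrixStarAlgEquiv
    (X.map (inclU S) + (X.map (inclU S)).conjTranspose) with hY
  have hsa : IsSelfAdjoint Y := by
    rw [hY, isSelfAdjoint_iff, ← map_star, Matrix.star_eq_conjTranspose,
      Matrix.conjTranspose_add, Matrix.conjTranspose_conjTranspose, add_comm]
  obtain ⟨h1, h2⟩ := (CStarAlgebra.norm_le_iff_algebraMap_bounds hsa (norm_nonneg Y)).1 le_rfl
  have hT : (((‖Y‖ / 2 : ℝ) : ℂ) • (1 : Matrix ι ι ℂ)) +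
      (((‖Y‖ / 2 : ℝ) : ℂ) • (1 : Matrix ι ι ℂ)).conjTranspose = (‖Y‖ : ℂ) • 1 := by
    rw [Matrix.conjTranspose_smul, Matrix.conjTranspose_one, ← add_smul]
    congr 1
    simp
  refine ⟨‖Y‖ / 2, by positivity, ?_, 0, ?_, ?_, ?_⟩
  · rw [hT]
    exact Matrix.PosSemidef.one.smul (by exact_mod_cast norm_nonneg Y)
  · convert MNonneg.zero (R := Unitization ℂ A) (ι := ι) using 1
    simp [Matrix.map_zero _ (map_zero _)]
  · rw [hT, Matrix.map_zero _ (map_zero _), sub_zero]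
    unfold MNonneg
    rw [map_add, scalU_smul_one]
    exact h1
  · rw [hT, Matrix.map_zero _ (map_zero _), sub_zero]
    unfold MNonneg
    rw [map_sub, scalU_smul_one]
    exact h2

end InCone

/-- The positive cone of the `ι`-th matrix level of the (partial) unitization of `S`. -/
def levelCone (S : Submodule ℂ A) (ι : Type*) [Fintype ι] :
    PointedCone ℝ (Matrix ι ι S × Matrix ι ι ℂ) where
  carrier := {p | InCone S p.1 p.2}
  add_mem' := InCone.add
  zero_mem' := InCone.zero
  smul_mem' := fun r _ h => InCone.smul h r.2

theorem mem_levelCone {S : Submodule ℂ A} {ι : Type*} [Fintype ι]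
    {p : Matrix ι ι S × Matrix ι ι ℂ} : p ∈ levelCone S ι ↔ InCone S p.1 p.2 := Iff.rfl

end Cone

theorem exists_extension_nonneg_of_pointedCone {V W : Type*} [AddCommGroup V] [Module ℝ V]
    [AddCommGroup W] [Module ℝ W] (s : PointedCone ℝ W) (j : V →ₗ[ℝ] W) (f : V →ₗ[ℝ] ℝ)
    (hf : ∀ v, j v ∈ s → 0 ≤ f v) (hd : ∀ y, ∃ v, j v + y ∈ s) :
    ∃ g : W →ₗ[ℝ] ℝ, (∀ v, g (j v) = f v) ∧ ∀ x ∈ s, 0 ≤ g x := by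
  have hker (v : V) (hv : j v = 0) : f v = 0 := by
    refine le_antisymm ?_ (hf v (hv ▸ s.zero_mem))
    have := hf (-v) (by rw [map_neg, hv, neg_zero]; exact s.zero_mem)
    rw [map_neg] at this
    linarith
  obtain ⟨r, hr⟩ := j.rangeRestrict.exists_rightInverse_of_surjective j.range_rangeRestrict
  have hr' (x : LinearMap.range j) : j (r x) = x :=
    congrArg Subtype.val (LinearMap.congr_fun hr x)
  have hfr (v : V) : f (r ⟨j v, v, rfl⟩) = f v := by
    rw [← sub_eq_zero, ← map_sub]
    exact hker _ (by rw [map_sub, hr', sub_self])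
  obtain ⟨g, hg, hgs⟩ := riesz_extension s ⟨LinearMap.range j, f.comp r⟩
    (fun x hx => hf _ (by rw [hr']; exact hx))
    (fun y => (hd y).elim fun v hv => ⟨⟨j v, v, rfl⟩, hv⟩)
  exact ⟨g, fun v => (hg ⟨j v, v, rfl⟩).trans (hfr v), hgs⟩

theorem exists_complex_extension_nonneg_of_pointedCone {V W : Type*} [AddCommGroup V] [Module ℝ V]
    [AddCommGroup W] [Module ℂ W] (s : PointedCone ℝ W) (j : V →ₗ[ℝ] W) (f : V →ₗ[ℝ] ℝ)
    (hf : ∀ v, j v ∈ s → 0 ≤ f v) (hd : ∀ y, ∃ v, j v + y ∈ s) :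
    ∃ g : W →ₗ[ℂ] ℂ, (∀ v, (g (j v)).re = f v) ∧ ∀ x ∈ s, 0 ≤ (g x).re := by
  obtain ⟨g, hg, hgs⟩ := exists_extension_nonneg_of_pointedCone s j f hf hd
  have hre (x : W) : (Module.Dual.extendRCLike (𝕜 := ℂ) g x).re = g x :=
    Module.Dual.re_extendRCLike_apply (𝕜 := ℂ) g x
  exact ⟨Module.Dual.extendRCLike (𝕜 := ℂ) g, fun v => (hre _).trans (hg v),
    fun x hx => (hgs x hx).trans_eq (hre x).symm⟩

section Operator

variable {A : Type*} [NonUnitalCStarAlgebra A] {K : Type*} [NormedAddCommGroup K]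
  [InnerProductSpace ℂ K]

/-- The form of complete positivity and complete contractivity of `φ : S → B(K)` that is stated
on vectors of `K`. -/
def IsVectorCCP (S : Submodule ℂ A) (φ : S →ₗ[ℂ] (K →L[ℂ] K)) : Prop :=
  ∀ (n : ℕ) (Y : Matrix (Fin n) (Fin n) S) (t : ℝ), 0 ≤ t → InCone S Y ((t : ℂ) • 1) →
    ∀ w : Fin n → K,
      0 ≤ (∑ a, ∑ b, inner ℂ (w a) (φ (Y a b) (w b))).re + t * ∑ a, ‖w a‖ ^ 2

variable {S : Submodule ℂ A} {ι κ : Type*} [Fintype ι] [Fintype κ] [DecidableEq ι]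

/-- The operator-valued map with coefficients given by a functional on a matrix level. -/
def opOfFunctional (g : (Matrix ι ι S × Matrix ι ι ℂ) →ₗ[ℂ] ℂ) (u : ι → K) :
    S →ₗ[ℂ] (K →L[ℂ] K) :=
  ∑ i, ∑ j, ((g ∘ₗ LinearMap.inl ℂ _ _) ∘ₗ Matrix.singleLinearMap ℂ i j).smulRight
    (InnerProductSpace.rankOne ℂ (u i) (u j))

theorem inner_opOfFunctional (g : (Matrix ι ι S × Matrix ι ι ℂ) →ₗ[ℂ] ℂ) (u : ι → K) (x : S)
    (z w : K) : inner ℂ z (opOfFunctional g u x w) =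
      ∑ i, ∑ j, g (Matrix.single i j x, 0) * (inner ℂ z (u i) * inner ℂ (u j) w) := by
  simp only [opOfFunctional, LinearMap.sum_apply, sum_apply, inner_sum,
    LinearMap.smulRight_apply, LinearMap.comp_apply, LinearMap.inl_apply,
    Matrix.singleLinearMap_apply, smul_apply,
    InnerProductSpace.rankOne_apply, inner_smul_right]
  refine Finset.sum_congr rfl fun i _ => Finset.sum_congr rfl fun j _ => ?_
  ring

theorem inner_opOfFunctional_dual (g : (Matrix ι ι S × Matrix ι ι ℂ) →ₗ[ℂ] ℂ) (u : ι → K) (x : S)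
    {ζ : ι → K} (h : ∀ i j, inner ℂ (u i) (ζ j) = if i = j then 1 else 0) (a b : ι) :
    inner ℂ (ζ a) (opOfFunctional g u x (ζ b)) = g (Matrix.single a b x, 0) := by
  have h' (i j : ι) : inner ℂ (ζ j) (u i) = if i = j then 1 else 0 := by
    rw [← inner_conj_symm, h]; split_ifs <;> simp
  rw [inner_opOfFunctional]
  simp [h, h']

theorem map_mk_zero_eq_sum (g : (Matrix ι ι S × Matrix ι ι ℂ) →ₗ[ℂ] ℂ) (X : Matrix ι ι S) :
    g (X, 0) = ∑ i, ∑ j, g (Matrix.single i j (X i j), 0) := by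
  have h (Y : Matrix ι ι S) : g (Y, 0) = (g ∘ₗ LinearMap.inl ℂ _ _) Y := rfl
  simp only [h, ← map_sum]
  rw [← Matrix.matrix_eq_sum_single]

theorem map_zero_mk_eq_sum (g : (Matrix ι ι S × Matrix ι ι ℂ) →ₗ[ℂ] ℂ) (T : Matrix ι ι ℂ) :
    g (0, T) = ∑ i, ∑ j, g (0, Matrix.single i j 1) * T i j := by
  have h (Y : Matrix ι ι ℂ) : g (0, Y) = (g ∘ₗ LinearMap.inr ℂ _ _) Y := rfl
  have h' (i j : ι) : g (0, Matrix.single i j 1) * T i j = g (0, Matrix.single i j (T i j)) := by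
    rw [h, h, mul_comm, ← smul_eq_mul, ← map_smul, Matrix.smul_single, smul_eq_mul, mul_one]
  simp_rw [h']
  simp only [h, ← map_sum]
  rw [← Matrix.matrix_eq_sum_single]

theorem sum_inner_opOfFunctional (g : (Matrix ι ι S × Matrix ι ι ℂ) →ₗ[ℂ] ℂ) (u : ι → K)
    (Y : Matrix κ κ S) (w : κ → K) :
    ∑ a, ∑ b, inner ℂ (w a) (opOfFunctional g u (Y a b) (w b)) =
      g (mcongr (Matrix.of fun i a => inner ℂ (w a) (u i)) Y, 0) := by
  have h (i j : ι) (y : S) : g (Matrix.single i j y, 0) =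
      ((g ∘ₗ LinearMap.inl ℂ _ _) ∘ₗ Matrix.singleLinearMap ℂ i j) y := rfl
  rw [map_mk_zero_eq_sum]
  simp only [inner_opOfFunctional, mcongr, Matrix.of_apply]
  simp_rw [h, map_sum, map_smul]
  simp_rw [Finset.sum_comm (s := (Finset.univ : Finset κ)) (t := (Finset.univ : Finset ι))]
  refine Finset.sum_congr rfl fun i _ => Finset.sum_congr rfl fun j _ =>
    Finset.sum_congr rfl fun a _ => Finset.sum_congr rfl fun b _ => ?_
  rw [mul_comm]
  simp

theorem isVectorCCP_opOfFunctional {g : (Matrix ι ι S × Matrix ι ι ℂ) →ₗ[ℂ] ℂ}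
    (hg : ∀ x ∈ levelCone S ι, 0 ≤ (g x).re) {u : ι → K}
    (hu : ∀ w : K, (∑ i, ∑ j, g (0, Matrix.single i j 1) *
      (inner ℂ w (u i) * inner ℂ (u j) w)).re ≤ ‖w‖ ^ 2) :
    IsVectorCCP S (opOfFunctional g u) := by
  intro n Y t ht hY w
  set B : Matrix ι (Fin n) ℂ := Matrix.of fun i a => inner ℂ (w a) (u i) with hB
  have h1 := hg (mcongr B Y, mcongr B ((t : ℂ) • 1)) (hY.mcongr B)
  rw [sum_inner_opOfFunctional]
  have h2 : g (mcongr B Y, mcongr B ((t : ℂ) • 1)) = g (mcongr B Y, 0) +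
      t * ∑ a, ∑ i, ∑ j, g (0, Matrix.single i j 1) *
        (inner ℂ (w a) (u i) * inner ℂ (u j) (w a)) := by
    have : (mcongr B Y, mcongr B ((t : ℂ) • 1)) = (mcongr B Y, 0) + (t : ℂ) •
        ((0 : Matrix ι ι S), B * B.conjTranspose) := by
      simp [mcongr_complex]
    rw [this, map_add, map_smul, map_zero_mk_eq_sum, smul_eq_mul]
    congr 2
    simp only [Matrix.mul_apply, Finset.mul_sum]
    simp_rw [Finset.sum_comm (s := (Finset.univ : Finset (Fin n)))
      (t := (Finset.univ : Finset ι))]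
    simp [hB]
  rw [h2, Complex.add_re, Complex.re_ofReal_mul, Complex.re_sum] at h1
  refine h1.trans (add_le_add_right (mul_le_mul_of_nonneg_left ?_ ht) _)
  exact Finset.sum_le_sum fun a _ => hu (w a)

end Operator

section Extension

variable {A : Type*} [NonUnitalCStarAlgebra A] {K : Type*} [NormedAddCommGroup K]
  [InnerProductSpace ℂ K] {E F : Submodule ℂ A}

/-- Matrix-level form of the statement that the inclusion `E ⊆ F` is a gauge maximal isometry. -/
def IsGaugeMaximal (hEF : E ≤ F) : Prop :=
  ∀ (n : ℕ) (X : Matrix (Fin n) (Fin n) E) (t : ℝ), 0 ≤ t →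
    InCone F (X.map (Submodule.inclusion hEF)) ((t : ℂ) • 1) →
    ∀ δ : ℝ, 0 < δ → InCone E X (((t + δ : ℝ) : ℂ) • 1)

theorem sum_inner_map_sum_smul {ι κ : Type*} [Fintype ι] [Fintype κ] (φ : E →ₗ[ℂ] (K →L[ℂ] K))
    (Y : Matrix κ κ E) (c : Matrix κ ι ℂ) (u : ι → K) :
    ∑ a, ∑ b, inner ℂ (∑ l, c a l • u l) (φ (Y a b) (∑ m, c b m • u m)) =
      ∑ l, ∑ m, inner ℂ (u l) (φ (mcongr c.conjTranspose Y l m) (u m)) := by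
  simp only [mcongr, Matrix.of_apply, map_sum, map_smul, sum_apply, smul_apply, sum_inner,
    inner_sum, inner_smul_left, inner_smul_right, Matrix.conjTranspose_apply, star_star,
      Finset.mul_sum]
  simp_rw [Finset.sum_comm (s := (Finset.univ : Finset κ)) (t := (Finset.univ : Finset ι))]
  rw [Finset.sum_comm]
  refine Finset.sum_congr rfl fun l _ => Finset.sum_congr rfl fun m _ =>
    Finset.sum_congr rfl fun a _ => Finset.sum_congr rfl fun b _ => ?_
  simp only [RCLike.star_def]
  ring

theorem InCone.exists_mcongr_one {ι : Type*} [Fintype ι] [DecidableEq ι] {X : Matrix ι ι F}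
    {T : Matrix ι ι ℂ} (h : InCone F X T) {ε : ℝ} (hε : 0 < ε) :
    ∃ D B : Matrix ι ι ℂ, D.conjTranspose * B = 1 ∧
      (D.conjTranspose * D).trace.re = T.trace.re + ε * Fintype.card ι ∧
      InCone F (_root_.mcongr B X) 1 := by
  set H : Matrix ι ι ℂ := ((2⁻¹ : ℝ) : ℂ) • (T + T.conjTranspose) with hH
  have hHp : H.PosSemidef := h.1.smul (by exact_mod_cast (by norm_num : (0 : ℝ) ≤ 2⁻¹))
  have hpd : (H + (ε : ℂ) • 1).PosDef :=
    Matrix.PosDef.posSemidef_add hHp (Matrix.PosDef.one.smul (by exact_mod_cast hε))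
  obtain ⟨D, hD, hDe⟩ := hpd.exists_gram
  have hDu : IsUnit D.conjTranspose := (Matrix.isUnit_conjTranspose _).2 hD
  have h1 : InCone F X (H + (ε : ℂ) • 1) := by
    have := (h.congr (U := H) rfl ?_).add (InCone.of_posSemidef (S := F)
      (T := (ε : ℂ) • (1 : Matrix ι ι ℂ)) ?_)
    · simpa using this
    · rw [hHp.isHermitian.eq, hH, ← add_smul]
      norm_num
    · have hp : ((ε : ℂ) • (1 : Matrix ι ι ℂ)).PosSemidef :=
        Matrix.PosSemidef.one.smul (by exact_mod_cast hε.le)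
      rw [hp.isHermitian.eq]
      exact hp.add hp
  refine ⟨D, (D.conjTranspose)⁻¹, ?_, ?_, ?_⟩
  · exact Matrix.mul_nonsing_inv _ ((Matrix.isUnit_iff_isUnit_det _).1 hDu)
  · rw [← hDe, hH]
    simp [Matrix.trace_add, Matrix.trace_smul, Matrix.trace_conjTranspose]
    ring
  · convert h1.mcongr (D.conjTranspose)⁻¹ using 1
    rw [mcongr_complex, hDe, ← mul_assoc,
      Matrix.nonsing_inv_mul _ ((Matrix.isUnit_iff_isUnit_det _).1 hDu), one_mul,
      Matrix.conjTranspose_nonsing_inv, Matrix.conjTranspose_conjTranspose,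
      Matrix.mul_nonsing_inv _ ((Matrix.isUnit_iff_isUnit_det _).1 hD)]

theorem IsVectorCCP.nonneg_of_inCone_map {hEF : E ≤ F} (hG : IsGaugeMaximal hEF)
    {φ : E →ₗ[ℂ] (K →L[ℂ] K)} (hφ : IsVectorCCP E φ) {k : ℕ} {u : Fin k → K}
    (hu : Orthonormal ℂ u) {X : Matrix (Fin k) (Fin k) E} {T : Matrix (Fin k) (Fin k) ℂ}
    (h : InCone F (X.map (Submodule.inclusion hEF)) T) :
    0 ≤ (∑ i, ∑ j, inner ℂ (u i) (φ (X i j) (u j)) + T.trace).re := by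
  set a : ℝ := (∑ i, ∑ j, inner ℂ (u i) (φ (X i j) (u j))).re with ha
  have key (ε : ℝ) (hε : 0 < ε) : 0 ≤ a + (1 + ε) * (T.trace.re + ε * k) := by
    obtain ⟨D, B, hDB, htr, h1⟩ := h.exists_mcongr_one hε
    have h2 : InCone F ((mcongr B X).map (Submodule.inclusion hEF)) (((1 : ℝ) : ℂ) • 1) := by
      rw [mcongr_map]
      simpa using h1
    have h3 := hφ k _ (1 + ε) (by positivity) (hG k _ 1 zero_le_one h2 ε hε)
      (fun a => ∑ l, D a l • u l)
    rw [sum_inner_map_sum_smul, mcongr_mcongr, hDB, mcongr_one] at h3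
    have h4 (a : Fin k) : ((‖∑ l, D a l • u l‖ ^ 2 : ℝ) : ℂ) = ∑ l, D a l * star (D a l) := by
      rw [Complex.ofReal_pow]
      refine (inner_self_eq_norm_sq_to_K (𝕜 := ℂ) (∑ l, D a l • u l)).symm.trans ?_
      rw [hu.inner_sum]
      simp [mul_comm]
    have h5 : ∑ a, ‖∑ l, D a l • u l‖ ^ 2 = (D.conjTranspose * D).trace.re := by
      rw [← Complex.ofReal_re (∑ a, ‖∑ l, D a l • u l‖ ^ 2), Complex.ofReal_sum]
      simp_rw [h4]
      rw [Matrix.trace_mul_comm]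
      simp [Matrix.trace, Matrix.mul_apply]
    rw [h5, htr, Fintype.card_fin] at h3
    exact h3
  have hc : Filter.Tendsto (fun ε : ℝ => a + (1 + ε) * (T.trace.re + ε * k))
      (nhdsWithin 0 (Set.Ioi 0)) (nhds (a + (1 + 0) * (T.trace.re + 0 * k))) :=
    (Continuous.tendsto (by fun_prop) 0).mono_left nhdsWithin_le_nhds
  rw [Complex.add_re, ← ha]
  simpa using ge_of_tendsto hc (eventually_nhdsWithin_of_forall key)

theorem LinearMap.eq_of_re_eq {V : Type*} [AddCommGroup V] [Module ℂ V] {f g : V →ₗ[ℂ] ℂ}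
    (h : ∀ v, (f v).re = (g v).re) : f = g := by
  ext v
  apply Complex.ext (h v)
  simpa using h (Complex.I • v)

theorem IsVectorCCP.exists_extension_orthonormal {hEF : E ≤ F} (hG : IsGaugeMaximal hEF)
    {φ : E →ₗ[ℂ] (K →L[ℂ] K)} (hφ : IsVectorCCP E φ) {k : ℕ} {u : Fin k → K}
    (hu : Orthonormal ℂ u) :
    ∃ ψ : F →ₗ[ℂ] (K →L[ℂ] K), IsVectorCCP F ψ ∧ ∀ (x : E) (i j : Fin k),
      inner ℂ (u i) (ψ (Submodule.inclusion hEF x) (u j)) = inner ℂ (u i) (φ x (u j)) := by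
  let s : (Matrix (Fin k) (Fin k) E × Matrix (Fin k) (Fin k) ℂ) →ₗ[ℂ] ℂ :=
    { toFun := fun p => ∑ i, ∑ j, inner ℂ (u i) (φ (p.1 i j) (u j)) + p.2.trace
      map_add' := fun p q => by
        simp [Finset.sum_add_distrib, Matrix.trace_add]
        ring
      map_smul' := fun c p => by
        simp [Finset.mul_sum, mul_add, Matrix.trace_smul] }
  let j : (Matrix (Fin k) (Fin k) E × Matrix (Fin k) (Fin k) ℂ) →ₗ[ℂ]
      (Matrix (Fin k) (Fin k) F × Matrix (Fin k) (Fin k) ℂ) :=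
    LinearMap.prodMap (Submodule.inclusion hEF).mapMatrix LinearMap.id
  obtain ⟨g, hgj, hg⟩ := exists_complex_extension_nonneg_of_pointedCone (levelCone F (Fin k))
    (j.restrictScalars ℝ) (Complex.reLm ∘ₗ s.restrictScalars ℝ)
    (fun v hv => hφ.nonneg_of_inCone_map hG hu hv)
    (fun y => by
      obtain ⟨t, -, ht⟩ := InCone.exists_of_large y.1
      refine ⟨(0, (t : ℂ) • 1 - y.2), ?_⟩
      rw [mem_levelCone]
      convert ht using 1
      · simp [j]
      · simp [j])
  have hgs : g ∘ₗ j = s := LinearMap.eq_of_re_eq hgj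
  have hgT (T : Matrix (Fin k) (Fin k) ℂ) : g (0, T) = T.trace := by
    have := LinearMap.congr_fun hgs (0, T)
    simpa [s, j] using this
  have hgX (x : E) (a b : Fin k) : g (Matrix.single a b (Submodule.inclusion hEF x), 0) =
      inner ℂ (u a) (φ x (u b)) := by
    have := LinearMap.congr_fun hgs (Matrix.single a b x, 0)
    have h1 : (Matrix.single a b x).map (Submodule.inclusion hEF) =
      Matrix.single a b (Submodule.inclusion hEF x) := Matrix.map_single _ _ _ _
    simp only [s, j, LinearMap.comp_apply, LinearMap.prodMap_apply, LinearMap.mapMatrix_apply, h1,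
      LinearMap.coe_mk, AddHom.coe_mk, LinearMap.id_apply, Matrix.trace_zero, add_zero] at this
    rw [this, Finset.sum_eq_single a, Finset.sum_eq_single b]
    · simp
    · intro c _ hc
      simp [hc.symm]
    · simp
    · intro c _ hc
      simp [hc.symm]
    · simp
  refine ⟨opOfFunctional g u, isVectorCCP_opOfFunctional hg fun w => ?_, fun x a b => ?_⟩
  · refine le_trans (le_of_eq ?_) (hu.sum_inner_products_le (s := Finset.univ) w)
    rw [Complex.re_sum]
    refine Finset.sum_congr rfl fun i _ => ?_
    rw [Finset.sum_eq_single i, hgT, Matrix.trace_single_eq_same, one_mul,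
      ← inner_conj_symm, ← Complex.normSq_eq_conj_mul_self, Complex.ofReal_re,
        Complex.normSq_eq_norm_sq]
    · intro c _ hc
      rw [hgT, Matrix.trace_single_eq_of_ne _ _ _ hc.symm, zero_mul]
    · simp
  · rw [inner_opOfFunctional_dual g u _ (orthonormal_iff_ite.1 hu), hgX]

end Extension

section Limit

variable {A : Type*} [NonUnitalCStarAlgebra A] {K : Type*} [NormedAddCommGroup K]
  [InnerProductSpace ℂ K] {E F : Submodule ℂ A}

theorem IsVectorCCP.exists_extension_finset {hEF : E ≤ F} (hG : IsGaugeMaximal hEF)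
    {φ : E →ₗ[ℂ] (K →L[ℂ] K)} (hφ : IsVectorCCP E φ) (s : Finset K) :
    ∃ ψ : F →ₗ[ℂ] (K →L[ℂ] K), IsVectorCCP F ψ ∧ ∀ (x : E), ∀ z ∈ s, ∀ w ∈ s,
      inner ℂ (ψ (Submodule.inclusion hEF x) w) z = inner ℂ (φ x w) z := by
  let b := stdOrthonormalBasis ℂ (Submodule.span ℂ (s : Set K))
  have hb : Orthonormal ℂ (fun i => (b i : K)) :=
    b.orthonormal.comp_linearIsometry (Submodule.span ℂ (s : Set K)).subtypeₗᵢ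
  obtain ⟨ψ, hψ, h⟩ := hφ.exists_extension_orthonormal hG hb
  have hs (z : K) (hz : z ∈ s) : ∃ c : _ → ℂ, z = ∑ i, c i • (b i : K) := by
    refine ⟨fun i => b.repr ⟨z, Submodule.subset_span hz⟩ i, ?_⟩
    have := congrArg (Subtype.val) (b.sum_repr ⟨z, Submodule.subset_span hz⟩)
    simpa using this.symm
  refine ⟨ψ, hψ, fun x z hz w hw => ?_⟩
  obtain ⟨c, rfl⟩ := hs z hz
  obtain ⟨d, rfl⟩ := hs w hw
  have h' (i j) : inner ℂ (ψ (Submodule.inclusion hEF x) (b i : K)) (b j : K) =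
      inner ℂ (φ x (b i : K)) (b j : K) := by
    rw [← inner_conj_symm, h, inner_conj_symm]
  simp only [map_sum, map_smul, sum_inner, inner_sum, inner_smul_left, inner_smul_right, h']

theorem IsVectorCCP.exists_bound (x : F) : ∃ C : ℝ, 0 ≤ C ∧
    ∀ ψ : F →ₗ[ℂ] (K →L[ℂ] K), IsVectorCCP F ψ → ‖ψ x‖ ≤ C := by
  obtain ⟨t, ht, hX⟩ := InCone.exists_of_large (Matrix.single (0 : Fin 2) 1 (-x))
  refine ⟨2 * t, by positivity, fun ψ hψ => ?_⟩
  refine ContinuousLinearMap.opNorm_le_of_unit_norm (𝕜 := ℂ) (by positivity) fun w hw => ?_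
  by_cases hv : ψ x w = 0
  · rw [hv, norm_zero]
    positivity
  have hv' : ‖ψ x w‖ ≠ 0 := norm_ne_zero_iff.2 hv
  obtain ⟨v, hv1, hv2⟩ : ∃ v : K, ‖v‖ = 1 ∧ inner ℂ v (ψ x w) = (‖ψ x w‖ : ℂ) := by
    refine ⟨((‖ψ x w‖⁻¹ : ℝ) : ℂ) • ψ x w, ?_, ?_⟩
    · rw [norm_smul, Complex.norm_real, norm_inv, norm_norm, inv_mul_cancel₀ hv']
    · rw [inner_smul_left, inner_self_eq_norm_sq_to_K, Complex.conj_ofReal]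
      change ((‖ψ x w‖⁻¹ : ℝ) : ℂ) * (‖ψ x w‖ : ℂ) ^ 2 = _
      push_cast
      field_simp
  have h := hψ 2 _ t ht hX ![v, w]
  simp [Fin.sum_univ_two, hv1, hw, hv2] at h
  linarith

theorem IsVectorCCP.exists_extension [CompleteSpace K] {hEF : E ≤ F} (hG : IsGaugeMaximal hEF)
    {φ : E →ₗ[ℂ] (K →L[ℂ] K)} (hφ : IsVectorCCP E φ) :
    ∃ ψ : F →ₗ[ℂ] (K →L[ℂ] K), IsVectorCCP F ψ ∧
      ∀ x : E, ψ (Submodule.inclusion hEF x) = φ x := by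
  choose ψ hψ hψφ using hφ.exists_extension_finset hG
  choose C hC hψC using IsVectorCCP.exists_bound (F := F) (K := K)
  let U : Ultrafilter (Finset K) := Ultrafilter.of Filter.atTop
  have hU : (U : Filter (Finset K)) ≤ Filter.atTop := Ultrafilter.of_le _
  have hbd (x : F) (w z : K) (s : Finset K) : ‖inner ℂ (ψ s x w) z‖ ≤ C x * ‖w‖ * ‖z‖ :=
    (norm_inner_le_norm _ _).trans (mul_le_mul_of_nonneg_right
      (((ψ s x).le_opNorm w).trans (mul_le_mul_of_nonneg_right (hψC x _ (hψ s)) (norm_nonneg _)))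
      (norm_nonneg _))
  have hlim (x : F) (w z : K) : ∃ l : ℂ,
      Filter.Tendsto (fun s => inner ℂ (ψ s x w) z) U (nhds l) ∧ ‖l‖ ≤ C x * ‖w‖ * ‖z‖ := by
    obtain ⟨l, hl, hl'⟩ := (isCompact_closedBall (0 : ℂ) (C x * ‖w‖ * ‖z‖)).ultrafilter_le_nhds
      (U.map fun s => inner ℂ (ψ s x w) z)
      (Filter.le_principal_iff.2 (Filter.mem_map.2
        (Filter.Eventually.of_forall fun s => by simpa using hbd x w z s)))
    exact ⟨l, hl', by simpa using hl⟩
  choose L hL hLC using hlim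
  let T (x : F) : K →L⋆[ℂ] K →L[ℂ] ℂ := LinearMap.mkContinuous₂
    (LinearMap.mk₂'ₛₗ (starRingEnd ℂ) (RingHom.id ℂ) (fun w z => L x w z)
      (fun w w' z => tendsto_nhds_unique (hL x (w + w') z) (by
        simpa [inner_add_left] using (hL x w z).add (hL x w' z)))
      (fun c w z => tendsto_nhds_unique (hL x (c • w) z) (by
        simpa [inner_smul_left, mul_comm] using (hL x w z).const_mul (starRingEnd ℂ c)))
      (fun w z z' => tendsto_nhds_unique (hL x w (z + z')) (by
        simpa [inner_add_right] using (hL x w z).add (hL x w z')))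
      (fun c w z => tendsto_nhds_unique (hL x w (c • z)) (by
        simpa [inner_smul_right] using (hL x w z).const_mul c)))
    (C x) (fun w z => hLC x w z)
  have hT (x : F) (w z : K) :
      inner ℂ (InnerProductSpace.continuousLinearMapOfBilin (T x) w) z = L x w z := by
    rw [InnerProductSpace.continuousLinearMapOfBilin_apply]
    rfl
  let Ψ : F →ₗ[ℂ] (K →L[ℂ] K) :=
    { toFun := fun x => InnerProductSpace.continuousLinearMapOfBilin (T x)
      map_add' := fun x y => by
        ext w
        refine ext_inner_right ℂ fun z => ?_
        rw [add_apply, inner_add_left, hT, hT, hT]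
        exact tendsto_nhds_unique (hL (x + y) w z) (by
          simpa [inner_add_left] using (hL x w z).add (hL y w z))
      map_smul' := fun c x => by
        ext w
        refine ext_inner_right ℂ fun z => ?_
        rw [RingHom.id_apply, smul_apply, inner_smul_left, hT, hT]
        exact tendsto_nhds_unique (hL (c • x) w z) (by
          simpa [inner_smul_left, mul_comm] using (hL x w z).const_mul (starRingEnd ℂ c)) }
  have hΨ (x : F) (w z : K) :
      Filter.Tendsto (fun s => inner ℂ (ψ s x w) z) U (nhds (inner ℂ (Ψ x w) z)) := by
    have := hL x w z
    rwa [← hT] at this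
  have hΨ' (x : F) (w z : K) :
      Filter.Tendsto (fun s => inner ℂ z (ψ s x w)) U (nhds (inner ℂ z (Ψ x w))) := by
    simpa using (hΨ x w z).star
  refine ⟨Ψ, fun n Y t ht hY w => ?_, fun x => ?_⟩
  · have h1 : Filter.Tendsto (fun s => (∑ a, ∑ b, inner ℂ (w a) (ψ s (Y a b) (w b))).re +
        t * ∑ a, ‖w a‖ ^ 2) U
        (nhds ((∑ a, ∑ b, inner ℂ (w a) (Ψ (Y a b) (w b))).re + t * ∑ a, ‖w a‖ ^ 2)) :=
      ((Complex.continuous_re.tendsto _).comp (tendsto_finsetSum _ fun a _ =>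
        tendsto_finsetSum _ fun b _ => hΨ' _ _ _)).add_const _
    exact ge_of_tendsto' h1 fun s => hψ s n Y t ht hY w
  · ext w
    refine ext_inner_right ℂ fun z => ?_
    refine tendsto_nhds_unique (hΨ _ w z) ?_
    refine Filter.Tendsto.congr' (f₁ := fun _ => inner ℂ (φ x w) z) ?_ tendsto_const_nhds
    classical
    filter_upwards [hU (Filter.eventually_ge_atTop ({w, z} : Finset K))] with s hs
    exact (hψφ s x z (hs (by simp)) w (hs (by simp))).symm

end Limit

section Level

variable {A M : Type*} [NonUnitalCStarAlgebra A] [NonUnitalCStarAlgebra M] {n : ℕ}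
  (e : Matrix (Fin n) (Fin n) A ≃⋆ₐ[ℂ] M)

/-- The embedding of `Mₙ(A)` into the matrices over the unitization of `A`. -/
def levelEmb : M →⋆ₙₐ[ℂ] CStarMatrix (Fin n) (Fin n) (Unitization ℂ A) where
  toFun X := CStarMatrix.ofMatrixStarAlgEquiv
    ((e.symm X).map (Unitization.inrNonUnitalStarAlgHom ℂ A))
  map_smul' c X := by
    have h : (e.symm (c • X)).map (Unitization.inrNonUnitalStarAlgHom ℂ A) =
        c • (e.symm X).map (Unitization.inrNonUnitalStarAlgHom ℂ A) := by
      rw [map_smul]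
      exact Matrix.map_smul _ _ (fun x => map_smul _ c x) _
    rw [h]
    exact map_smul _ c _
  map_zero' := by
    rw [map_zero, Matrix.map_zero _ (map_zero _), map_zero]
  map_add' X Y := by
    rw [map_add, Matrix.map_add _ (map_add _), map_add]
  map_mul' X Y := by
    rw [map_mul, Matrix.map_mul, map_mul]
  map_star' X := by
    have h : (e.symm (star X)).map (Unitization.inrNonUnitalStarAlgHom ℂ A) =
        star ((e.symm X).map (Unitization.inrNonUnitalStarAlgHom ℂ A)) := by
      rw [map_star, Matrix.star_eq_conjTranspose, Matrix.star_eq_conjTranspose,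
        Matrix.conjTranspose_map]
      intro a
      exact map_star (Unitization.inrNonUnitalStarAlgHom ℂ A) a
    rw [h, map_star]

theorem levelEmb_apply (X : M) : levelEmb e X = CStarMatrix.ofMatrixStarAlgEquiv
    ((e.symm X).map (Unitization.inrNonUnitalStarAlgHom ℂ A)) := rfl

theorem levelEmb_injective : Function.Injective (levelEmb e) := by
  intro X Y h
  apply e.symm.injective
  ext i j
  have h' := congrFun (congrFun (CStarMatrix.ofMatrixStarAlgEquiv.injective h) i) j
  exact Unitization.inr_injective h'

/-- The element of `Mₙ(A)` given by a matrix over a subspace. -/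
def ofLevel {S : Submodule ℂ A} (X : Matrix (Fin n) (Fin n) S) : M := e (X.map Subtype.val)

variable {e} {S : Submodule ℂ A}

theorem levelEmb_ofLevel (X : Matrix (Fin n) (Fin n) S) :
    levelEmb e (ofLevel e X) = CStarMatrix.ofMatrixStarAlgEquiv (X.map (inclU S)) := by
  rw [levelEmb_apply, ofLevel]
  congr 1
  ext1 i j
  rw [StarAlgEquiv.symm_apply_apply]
  rfl

theorem ofLevel_mem (X : Matrix (Fin n) (Fin n) S) : ofLevel e X ∈ matrixLevel S e := by
  intro i j
  rw [ofLevel, StarAlgEquiv.symm_apply_apply]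
  exact (X i j).2

theorem exists_ofLevel_eq {X : M} (hX : X ∈ matrixLevel S e) :
    ∃ Y : Matrix (Fin n) (Fin n) S, ofLevel e Y = X := by
  refine ⟨Matrix.of fun i j => ⟨e.symm X i j, hX i j⟩, ?_⟩
  exact e.apply_symm_apply X

theorem ofLevel_sub (X Y : Matrix (Fin n) (Fin n) S) :
    ofLevel e (X - Y) = ofLevel e X - ofLevel e Y := by
  rw [ofLevel, Matrix.map_sub _ (fun _ _ => rfl), map_sub]
  rfl

theorem isSelfAdjoint_ofLevel_iff {X : Matrix (Fin n) (Fin n) S} :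
    IsSelfAdjoint (ofLevel e X) ↔ (X.map (inclU S)).conjTranspose = X.map (inclU S) := by
  rw [← Matrix.star_eq_conjTranspose, isSelfAdjoint_iff, ← (levelEmb_injective e).eq_iff, map_star,
    levelEmb_ofLevel, ← map_star]
  exact CStarMatrix.ofMatrixStarAlgEquiv.injective.eq_iff

theorem norm_le_iff_of_map_levelEmb {X : M} {Y : Matrix (Fin n) (Fin n) (Unitization ℂ A)}
    (hXY : levelEmb e X = CStarMatrix.ofMatrixStarAlgEquiv Y) (hY : Y.conjTranspose = Y) {t : ℝ}
    (ht : 0 ≤ t) : ‖X‖ ≤ t ↔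
      MNonneg (((t : ℂ) • (1 : Matrix (Fin n) (Fin n) ℂ)).map (scalU A) + Y) ∧
      MNonneg (((t : ℂ) • (1 : Matrix (Fin n) (Fin n) ℂ)).map (scalU A) - Y) := by
  have hsa : IsSelfAdjoint (CStarMatrix.ofMatrixStarAlgEquiv Y) := by
    rw [isSelfAdjoint_iff, ← map_star, Matrix.star_eq_conjTranspose, hY]
  have h1 : ‖X‖ = ‖CStarMatrix.ofMatrixStarAlgEquiv Y‖ := by
    rw [← hXY]
    exact (NonUnitalStarAlgHom.norm_map (levelEmb e) (levelEmb_injective e) X).symm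
  rw [h1]
  unfold MNonneg
  rw [map_add, map_sub, scalU_smul_one]
  exact CStarAlgebra.norm_le_iff_algebraMap_bounds hsa ht

variable [PartialOrder M] [StarOrderedRing M]

theorem nonneg_ofLevel_iff {X : Matrix (Fin n) (Fin n) S} :
    0 ≤ ofLevel e X ↔ MNonneg (X.map (inclU S)) := by
  rw [MNonneg, ← levelEmb_ofLevel (e := e)]
  exact (nonneg_map_iff_of_injective (levelEmb e) (levelEmb_injective e)).symm

theorem infDist_le_of_inCone {X : Matrix (Fin n) (Fin n) S} (hX : IsSelfAdjoint (ofLevel e X))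
    {t : ℝ} (ht : 0 ≤ t) (h : InCone S X ((t : ℂ) • 1)) :
    Metric.infDist (ofLevel e X) {Y : M | Y ∈ matrixLevel S e ∧ 0 ≤ Y} ≤ t := by
  obtain ⟨h1, P, h2, h3, h4⟩ := h
  have hhalf : (0 : ℝ) ≤ 2⁻¹ := by norm_num
  have hX' := isSelfAdjoint_ofLevel_iff.1 hX
  set P' : Matrix (Fin n) (Fin n) S := ((2⁻¹ : ℝ) : ℂ) • P with hP'
  have hP'm : P'.map (inclU S) = ((2⁻¹ : ℝ) : ℂ) • P.map (inclU S) :=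
    Matrix.map_smul _ _ (fun x => map_smul (inclU S) _ x) _
  have hP'n : MNonneg (P'.map (inclU S)) := by
    rw [hP'm]
    exact h2.smul hhalf
  have hT : ((t : ℂ) • (1 : Matrix (Fin n) (Fin n) ℂ)).map (scalU A) = ((2⁻¹ : ℝ) : ℂ) •
      (((t : ℂ) • (1 : Matrix (Fin n) (Fin n) ℂ)) +
        ((t : ℂ) • (1 : Matrix (Fin n) (Fin n) ℂ)).conjTranspose).map (scalU A) := by
    rw [← Matrix.map_smul _ _ (fun x => map_smul (scalU A) _ x)]
    congr 1
    rw [Matrix.conjTranspose_smul, Matrix.conjTranspose_one, ← add_smul, smul_smul]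
    congr 1
    simp
    ring
  have hd : (X - P').map (inclU S) = ((2⁻¹ : ℝ) : ℂ) •
      (X.map (inclU S) + (X.map (inclU S)).conjTranspose - P.map (inclU S)) := by
    rw [Matrix.map_sub _ (map_sub _), hP'm, hX', smul_sub, ← two_smul ℂ, smul_smul]
    norm_num
  have hmem : ofLevel e P' ∈ {Y : M | Y ∈ matrixLevel S e ∧ 0 ≤ Y} :=
    ⟨ofLevel_mem P', nonneg_ofLevel_iff.2 hP'n⟩
  refine (Metric.infDist_le_dist_of_mem hmem).trans ?_
  rw [dist_eq_norm, ← ofLevel_sub]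
  refine (norm_le_iff_of_map_levelEmb (levelEmb_ofLevel _) ?_ ht).2 ⟨?_, ?_⟩
  · rw [Matrix.map_sub _ (map_sub _), Matrix.conjTranspose_sub, hX', hP'n.isHermitian]
  · rw [hT, hd, ← smul_add]
    exact h3.smul hhalf
  · rw [hT, hd, ← smul_sub]
    exact h4.smul hhalf

theorem inCone_of_infDist_lt {X : Matrix (Fin n) (Fin n) S} (hX : IsSelfAdjoint (ofLevel e X))
    {t : ℝ} (h : Metric.infDist (ofLevel e X) {Y : M | Y ∈ matrixLevel S e ∧ 0 ≤ Y} < t) :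
    InCone S X ((t : ℂ) • 1) := by
  have ht : 0 ≤ t := Metric.infDist_nonneg.trans h.le
  have hX' := isSelfAdjoint_ofLevel_iff.1 hX
  obtain ⟨P', ⟨hP', hP0⟩, hd⟩ := (Metric.infDist_lt_iff
    (⟨0, (matrixLevel S e).zero_mem, le_rfl⟩ : {Y : M | Y ∈ matrixLevel S e ∧ 0 ≤ Y}.Nonempty)).1 h
  obtain ⟨P, rfl⟩ := exists_ofLevel_eq hP'
  have hPn : MNonneg (P.map (inclU S)) := nonneg_ofLevel_iff.1 hP0
  rw [dist_eq_norm, ← ofLevel_sub] at hd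
  have hsa : ((X - P).map (inclU S)).conjTranspose = (X - P).map (inclU S) := by
    rw [Matrix.map_sub _ (map_sub _), Matrix.conjTranspose_sub, hX', hPn.isHermitian]
  obtain ⟨h1, h2⟩ := (norm_le_iff_of_map_levelEmb (levelEmb_ofLevel _) hsa ht).1 hd.le
  have hp : ((t : ℂ) • (1 : Matrix (Fin n) (Fin n) ℂ)).PosSemidef :=
    Matrix.PosSemidef.one.smul (by exact_mod_cast ht)
  have hd' : X.map (inclU S) + (X.map (inclU S)).conjTranspose - (P + P).map (inclU S) =
      (X - P).map (inclU S) + (X - P).map (inclU S) := by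
    rw [hX', Matrix.map_sub _ (map_sub _), Matrix.map_add _ (map_add _)]
    abel
  refine ⟨?_, P + P, ?_, ?_, ?_⟩
  · rw [hp.isHermitian.eq]
    exact hp.add hp
  · rw [Matrix.map_add _ (map_add _)]
    exact hPn.add hPn
  · rw [hp.isHermitian.eq, hd', Matrix.map_add _ (map_add _), add_add_add_comm]
    exact h1.add h1
  · rw [hp.isHermitian.eq, hd', Matrix.map_add _ (map_add _), add_sub_add_comm]
    exact h2.add h2

end Level

section Gauge

variable {A : Type*} [NonUnitalCStarAlgebra A] {E F : Submodule ℂ A}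

/-- The hermitian part of a matrix over a selfadjoint subspace. -/
theorem exists_hermitian_part (hE : ∀ x ∈ E, star x ∈ E) {ι : Type*} (X : Matrix ι ι E) :
    ∃ Y : Matrix ι ι E, (Y.map (inclU E)).conjTranspose = Y.map (inclU E) ∧
      Y.map (inclU E) + (Y.map (inclU E)).conjTranspose =
        X.map (inclU E) + (X.map (inclU E)).conjTranspose := by
  let Z : Matrix ι ι E := Matrix.of fun i j => ⟨star (X j i : A), hE _ (X j i).2⟩
  have hZ : Z.map (inclU E) = (X.map (inclU E)).conjTranspose := by
    ext1 i j
    simp [Z, inclU_apply]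
  have h : ((2⁻¹ : ℂ) • (X + Z)).map (inclU E) =
      (2⁻¹ : ℂ) • (X.map (inclU E) + (X.map (inclU E)).conjTranspose) := by
    rw [Matrix.map_smul _ _ (fun x => map_smul (inclU E) _ x), Matrix.map_add _ (map_add _), hZ]
  have h' : (((2⁻¹ : ℂ) • (X + Z)).map (inclU E)).conjTranspose =
      ((2⁻¹ : ℂ) • (X + Z)).map (inclU E) := by
    rw [h, Matrix.conjTranspose_smul, Matrix.conjTranspose_add, Matrix.conjTranspose_conjTranspose,
      add_comm]
    simp
  refine ⟨(2⁻¹ : ℂ) • (X + Z), h', ?_⟩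
  rw [h', h, ← two_smul ℂ, smul_smul]
  norm_num

theorem ofLevel_map_inclusion {M : Type*} [NonUnitalCStarAlgebra M] {n : ℕ}
    (e : Matrix (Fin n) (Fin n) A ≃⋆ₐ[ℂ] M) (hEF : E ≤ F) (X : Matrix (Fin n) (Fin n) E) :
    ofLevel e (X.map (Submodule.inclusion hEF)) = ofLevel e X := rfl

theorem map_inclusion_map_inclU (hEF : E ≤ F) {ι : Type*} (X : Matrix ι ι E) :
    (X.map (Submodule.inclusion hEF)).map (inclU F) = X.map (inclU E) := rfl

theorem isGaugeMaximal_iff (hEF : E ≤ F) (hE : ∀ x ∈ E, star x ∈ E)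
    (M : ℕ → Type*) [∀ n, NonUnitalCStarAlgebra (M n)] [∀ n, PartialOrder (M n)]
    [∀ n, StarOrderedRing (M n)] (e : ∀ n, Matrix (Fin n) (Fin n) A ≃⋆ₐ[ℂ] M n) :
    IsGaugeMaximal hEF ↔
      ∀ (n : ℕ) (X : M n), X ∈ matrixLevel E (e n) → IsSelfAdjoint X →
        Metric.infDist X {Y : M n | Y ∈ matrixLevel E (e n) ∧ 0 ≤ Y} =
          Metric.infDist X {Y : M n | Y ∈ matrixLevel F (e n) ∧ 0 ≤ Y} := by
  constructor
  · intro h n X hX hsa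
    obtain ⟨X, rfl⟩ := exists_ofLevel_eq hX
    refine le_antisymm (le_of_forall_pos_le_add fun δ hδ => ?_)
      (Metric.infDist_le_infDist_of_subset (fun Y hY => ⟨fun i j => hEF (hY.1 i j), hY.2⟩)
        ⟨0, (matrixLevel E (e n)).zero_mem, le_rfl⟩)
    set d := Metric.infDist (ofLevel (e n) X) {Y : M n | Y ∈ matrixLevel F (e n) ∧ 0 ≤ Y} with hd
    have hd0 : 0 ≤ d := Metric.infDist_nonneg
    have h1 : InCone F (X.map (Submodule.inclusion hEF)) (((d + δ / 2 : ℝ) : ℂ) • 1) := by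
      apply inCone_of_infDist_lt (e := e n)
      · exact hsa
      · rw [ofLevel_map_inclusion]
        linarith
    have h2 := infDist_le_of_inCone hsa (by positivity)
      (h n X (d + δ / 2) (by positivity) h1 (δ / 2) (by positivity))
    linarith
  · intro h n X t ht hX δ hδ
    obtain ⟨Y, hY, hYX⟩ := exists_hermitian_part hE X
    refine InCone.congr ?_ hYX rfl
    have hYsa : IsSelfAdjoint (ofLevel (e n) Y) := isSelfAdjoint_ofLevel_iff.2 hY
    apply inCone_of_infDist_lt hYsa
    rw [h n _ (ofLevel_mem Y) hYsa]
    refine lt_of_le_of_lt (infDist_le_of_inCone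
      (X := Y.map (Submodule.inclusion hEF)) hYsa ht ?_) (lt_add_of_pos_right t hδ)
    refine hX.congr ?_ rfl
    rw [map_inclusion_map_inclU, map_inclusion_map_inclU, hYX]

end Gauge

section MatrixBound

open scoped MatrixOrder Matrix.Norms.L2Operator

theorem Matrix.IsHermitian.exists_smul_one_add_posSemidef {ι : Type*} [Fintype ι] [DecidableEq ι]
    {T : Matrix ι ι ℂ} (hT : T.IsHermitian) :
    ∃ r : ℝ, 0 ≤ r ∧ ((r : ℂ) • (1 : Matrix ι ι ℂ) + T).PosSemidef := by
  refine ⟨‖T‖, norm_nonneg T, ?_⟩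
  have h := ((CStarAlgebra.norm_le_iff_algebraMap_bounds (a := T) hT (norm_nonneg T)).1 le_rfl).1
  rw [Matrix.nonneg_iff_posSemidef, Algebra.algebraMap_eq_smul_one] at h
  rwa [Complex.coe_smul]

end MatrixBound

section Separation

variable {A : Type*} [NonUnitalCStarAlgebra A] {E F : Submodule ℂ A}

theorem exists_functional_of_not_inCone {n : ℕ} [NeZero n] {X : Matrix (Fin n) (Fin n) E} {d : ℝ}
    (hd : 0 ≤ d) (h : ¬ InCone E X ((d : ℂ) • 1)) :
    ∃ g : (Matrix (Fin n) (Fin n) E × Matrix (Fin n) (Fin n) ℂ) →ₗ[ℂ] ℂ,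
      (∀ x ∈ levelCone E (Fin n), 0 ≤ (g x).re) ∧ (g (X, 0)).re = -d ∧ (g (0, 1)).re = 1 := by
  let j : (ℝ × ℝ) →ₗ[ℝ] (Matrix (Fin n) (Fin n) E × Matrix (Fin n) (Fin n) ℂ) :=
    LinearMap.prodMap (LinearMap.toSpanSingleton ℝ _ X) (LinearMap.toSpanSingleton ℝ _ 1)
  have hj (v : ℝ × ℝ) : j v = ((v.1 : ℂ) • X, (v.2 : ℂ) • 1) := by
    simp only [j, LinearMap.prodMap_apply, LinearMap.toSpanSingleton_apply]
    congr 1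
  let f : (ℝ × ℝ) →ₗ[ℝ] ℝ := LinearMap.snd ℝ ℝ ℝ - d • LinearMap.fst ℝ ℝ ℝ
  have hf (v : ℝ × ℝ) : f v = v.2 - d * v.1 := by simp [f]
  have hone {r : ℝ} (hr : 0 ≤ r) :
      InCone E (0 : Matrix (Fin n) (Fin n) E) ((r : ℂ) • (1 : Matrix (Fin n) (Fin n) ℂ)) := by
    have hp : ((r : ℂ) • (1 : Matrix (Fin n) (Fin n) ℂ)).PosSemidef :=
      Matrix.PosSemidef.one.smul (by exact_mod_cast hr)
    refine InCone.of_posSemidef ?_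
    rw [hp.isHermitian.eq]
    exact hp.add hp
  obtain ⟨g, hgj, hg⟩ := exists_complex_extension_nonneg_of_pointedCone (levelCone E (Fin n)) j f
    (fun v hv => by
      rw [hj, mem_levelCone] at hv
      rw [hf]
      have hr : 0 ≤ v.2 := by
        have h1 := hv.1.diag_nonneg (i := (0 : Fin n))
        have h2 := (Complex.le_def.1 h1).1
        simp at h2
        linarith
      rcases le_or_gt v.1 0 with hs | hs
      · nlinarith
      by_contra! hlt
      apply h
      have h1 := hv.smul (inv_nonneg.2 hs.le)
      have h2 : 0 ≤ d - v.1⁻¹ * v.2 := by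
        rw [sub_nonneg, inv_mul_le_iff₀ hs]
        linarith
      convert h1.add (hone h2) using 1
      · rw [smul_smul, add_zero, ← Complex.ofReal_mul, inv_mul_cancel₀ hs.ne', Complex.ofReal_one,
          one_smul]
      · rw [smul_smul, ← add_smul]
        push_cast
        congr 1
        ring)
    (fun y => by
      obtain ⟨t, -, ht⟩ := InCone.exists_of_large y.1
      obtain ⟨r, -, hr⟩ := (Matrix.isHermitian_add_transpose_self y.2)
        |>.exists_smul_one_add_posSemidef
      refine ⟨(0, t + r / 2), ?_⟩
      rw [hj, mem_levelCone]
      have h1 : InCone E (0 : Matrix (Fin n) (Fin n) E) (((r / 2 : ℝ) : ℂ) • 1 + y.2) := by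
        refine InCone.of_posSemidef ?_
        convert hr using 1
        rw [Matrix.conjTranspose_add, Matrix.conjTranspose_smul, add_add_add_comm,
          Matrix.conjTranspose_one, ← add_smul]
        congr 2
        simp
      convert ht.add h1 using 1
      · simp
      · simp only [Prod.snd_add, Complex.ofReal_add, add_smul, add_assoc])
  refine ⟨g, hg, ?_, ?_⟩
  · have := hgj (1, 0)
    rw [hj, hf] at this
    simpa using this
  · have := hgj (0, 1)
    rw [hj, hf] at this
    simpa using this

theorem isGaugeMaximal_of_forall_isVectorCCP {hEF : E ≤ F}
    (h : ∀ n : ℕ, ∃ (K : Type v) (_ : NormedAddCommGroup K) (_ : InnerProductSpace ℂ K),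
      (∃ b : Fin n → K, Orthonormal ℂ b) ∧
      ∀ φ : E →ₗ[ℂ] (K →L[ℂ] K), IsVectorCCP E φ → ∃ ψ : F →ₗ[ℂ] (K →L[ℂ] K),
        IsVectorCCP F ψ ∧ ∀ x : E, ψ (Submodule.inclusion hEF x) = φ x) :
    IsGaugeMaximal hEF := by
  intro n X t ht hX δ hδ
  rcases Nat.eq_zero_or_pos n with rfl | hn
  · convert InCone.zero (S := E) (ι := Fin 0) using 1
    · exact Subsingleton.elim _ _
    · exact Subsingleton.elim _ _
  have : NeZero n := ⟨hn.ne'⟩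
  obtain ⟨K, _, _, ⟨b, hb⟩, hext⟩ := h n
  by_contra hcon
  have hd : 0 < t + δ := by linarith
  obtain ⟨g, hg, hgX, hg1⟩ := exists_functional_of_not_inCone hd.le hcon
  set ε : ℝ := δ / (2 * (t + δ)) with hε
  have hε0 : 0 < ε := by positivity
  have hε1 : ε ≤ 1 := by
    rw [hε, div_le_one (by positivity)]
    linarith
  have hnpos : (0 : ℝ) < n := by exact_mod_cast hn
  let τ : (Matrix (Fin n) (Fin n) E × Matrix (Fin n) (Fin n) ℂ) →ₗ[ℂ] ℂ :=
    (n : ℂ)⁻¹ • (Matrix.traceLinearMap (Fin n) ℂ ℂ ∘ₗ LinearMap.snd ℂ _ _)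
  have hτ (x : Matrix (Fin n) (Fin n) E × Matrix (Fin n) (Fin n) ℂ) :
      (τ x).re = (n : ℝ)⁻¹ * x.2.trace.re := by
    change ((n : ℂ)⁻¹ * x.2.trace).re = _
    rw [← Complex.ofReal_natCast, ← Complex.ofReal_inv, Complex.re_ofReal_mul]
  have hτ0 (x : Matrix (Fin n) (Fin n) E × Matrix (Fin n) (Fin n) ℂ)
      (hx : x ∈ levelCone E (Fin n)) : 0 ≤ (τ x).re := by
    rw [hτ]
    have h1 := (Complex.le_def.1 hx.1.trace_nonneg).1
    rw [Matrix.trace_add, Matrix.trace_conjTranspose] at h1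
    have h2 : 0 ≤ x.2.trace.re := by
      simp at h1
      linarith
    positivity
  set G : (Matrix (Fin n) (Fin n) E × Matrix (Fin n) (Fin n) ℂ) →ₗ[ℂ] ℂ :=
    ((1 - ε : ℝ) : ℂ) • g + (ε : ℂ) • τ with hGdef
  have hGre (x) : (G x).re = (1 - ε) * (g x).re + ε * (τ x).re := by
    simp only [hGdef, LinearMap.add_apply, LinearMap.smul_apply, smul_eq_mul, Complex.add_re,
      Complex.re_ofReal_mul]
  have hG0 (x : Matrix (Fin n) (Fin n) E × Matrix (Fin n) (Fin n) ℂ)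
      (hx : x ∈ levelCone E (Fin n)) : ε * (τ x).re ≤ (G x).re := by
    rw [hGre]
    exact le_add_of_nonneg_left (mul_nonneg (by linarith) (hg x hx))
  have hGX : (G (X, 0)).re = -(t + δ / 2) := by
    rw [hGre, hgX, hτ, Matrix.trace_zero, hε]
    simp
    field_simp
    ring
  have hG1 : (G (0, 1)).re = 1 := by
    rw [hGre, hg1, hτ, Matrix.trace_one]
    simp [hnpos.ne']
  set R : Matrix (Fin n) (Fin n) ℂ := Matrix.of fun i j => G (0, Matrix.single i j 1) with hR
  have hGT (T : Matrix (Fin n) (Fin n) ℂ) : G (0, T) = ∑ i, ∑ j, R i j * T i j :=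
    map_zero_mk_eq_sum G T
  set H : Matrix (Fin n) (Fin n) ℂ := ((2⁻¹ : ℝ) : ℂ) • (R + R.conjTranspose) with hH
  have hHh : H.IsHermitian := by
    rw [hH, Matrix.IsHermitian, Matrix.conjTranspose_smul, Matrix.conjTranspose_add,
      Matrix.conjTranspose_conjTranspose, add_comm]
    simp
  have hHR (p : Fin n → ℂ) : (star p ⬝ᵥ H.mulVec p).re =
      (∑ i, ∑ j, R i j * (star (p i) * p j)).re := by
    have h1 : star p ⬝ᵥ R.mulVec p = ∑ i, ∑ j, R i j * (star (p i) * p j) := by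
      simp only [dotProduct, Matrix.mulVec, Finset.mul_sum, Pi.star_apply]
      refine Finset.sum_congr rfl fun i _ => Finset.sum_congr rfl fun j _ => ?_
      ring
    have h2 : star p ⬝ᵥ R.conjTranspose.mulVec p = star (star p ⬝ᵥ R.mulVec p) := by
      rw [Matrix.star_dotProduct, Matrix.star_mulVec, Matrix.conjTranspose_conjTranspose,
        ← Matrix.dotProduct_mulVec]
    rw [hH, Matrix.smul_mulVec, Matrix.add_mulVec, dotProduct_smul, dotProduct_add, h2, ← h1,
      smul_eq_mul, Complex.re_ofReal_mul, Complex.add_re]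
    simp
    ring
  have hHpd : H.PosDef := by
    refine Matrix.PosDef.of_dotProduct_mulVec_pos hHh fun p hp => ?_
    rw [Complex.lt_def]
    refine ⟨?_, (hHh.im_star_dotProduct_mulVec_self p).symm⟩
    rw [hHR]
    have h1 : (Matrix.vecMulVec (star p) p).PosSemidef := Matrix.posSemidef_vecMulVec_star_self p
    have h2 : ((0 : Matrix (Fin n) (Fin n) E), Matrix.vecMulVec (star p) p) ∈
        levelCone E (Fin n) :=
      InCone.of_posSemidef (by rw [h1.isHermitian.eq]; exact h1.add h1)
    have h3 := hG0 _ h2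
    rw [hGT, hτ] at h3
    refine lt_of_lt_of_le ?_ h3
    have h4 : 0 < (Matrix.vecMulVec (star p) p).trace := by
      rw [Matrix.trace_vecMulVec]
      exact Matrix.dotProduct_star_self_pos_iff.2 hp
    have h5 := (Complex.lt_def.1 h4).1
    rw [Complex.zero_re] at h5
    positivity
  obtain ⟨D, hD, hHD⟩ := hHpd.exists_gram
  have hDdet := (Matrix.isUnit_iff_isUnit_det _).1 hD
  set u : Fin n → K := fun j => ∑ c, star (D⁻¹ j c) • b c with hu
  set ζ : Fin n → K := fun a => ∑ c, D c a • b c with hζ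
  have hin (j : Fin n) (w : K) : inner ℂ (u j) w = D⁻¹.mulVec (fun c => inner ℂ (b c) w) j := by
    simp [hu, Matrix.mulVec, dotProduct, mul_comm]
  have huζ (i j : Fin n) : inner ℂ (u i) (ζ j) = if i = j then 1 else 0 := by
    rw [hin]
    have h1 (c : Fin n) : inner ℂ (b c) (ζ j) = D c j := by
      rw [hζ, hb.inner_right_fintype]
    simp only [h1]
    have := congrFun (congrFun (Matrix.nonsing_inv_mul D hDdet) i) j
    rw [Matrix.one_apply] at this
    rw [← this, Matrix.mul_apply]
    rfl
  have hζn : ∑ a, ‖ζ a‖ ^ 2 = 1 := by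
    have h4 (a : Fin n) : ((‖ζ a‖ ^ 2 : ℝ) : ℂ) = ∑ c, star (D c a) * D c a := by
      rw [Complex.ofReal_pow]
      refine (inner_self_eq_norm_sq_to_K (𝕜 := ℂ) (ζ a)).symm.trans ?_
      rw [hζ, hb.inner_sum]
      simp
    have h5 : ((∑ a, ‖ζ a‖ ^ 2 : ℝ) : ℂ) = H.trace := by
      rw [Complex.ofReal_sum, hHD]
      simp only [h4, Matrix.trace, Matrix.diag, Matrix.mul_apply, Matrix.conjTranspose_apply]
    rw [← Complex.ofReal_re (∑ a, ‖ζ a‖ ^ 2), h5, hH, Matrix.trace_smul, Matrix.trace_add,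
      Matrix.trace_conjTranspose, ← hG1, hGT]
    have : ∑ i, ∑ j, R i j * (1 : Matrix (Fin n) (Fin n) ℂ) i j = R.trace := by
      simp [Matrix.one_apply, Matrix.trace]
    rw [this]
    simp
    ring
  have hΦ : IsVectorCCP E (opOfFunctional G u) := by
    refine isVectorCCP_opOfFunctional (fun x hx => le_trans ?_ (hG0 x hx)) fun w => ?_
    · exact mul_nonneg hε0.le (hτ0 x hx)
    · have h1 := hHR (fun i => inner ℂ (u i) w)
      have h2 : ∑ i, ∑ j, G (0, Matrix.single i j 1) * (inner ℂ w (u i) * inner ℂ (u j) w) =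
          ∑ i, ∑ j, R i j * (star (inner ℂ (u i) w) * inner ℂ (u j) w) := by
        simp [hR]
      rw [h2, ← h1, hHD]
      have h3 : D.mulVec (fun i => inner ℂ (u i) w) = fun c => inner ℂ (b c) w := by
        have : (fun i => inner ℂ (u i) w) = D⁻¹.mulVec (fun c => inner ℂ (b c) w) :=
          funext fun i => hin i w
        rw [this, Matrix.mulVec_mulVec, Matrix.mul_nonsing_inv _ hDdet, Matrix.one_mulVec]
      rw [← Matrix.mulVec_mulVec, h3, Matrix.dotProduct_mulVec, ← Matrix.star_mulVec, h3]
      refine le_trans (le_of_eq ?_) (hb.sum_inner_products_le (s := Finset.univ) w)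
      rw [dotProduct, Complex.re_sum]
      refine Finset.sum_congr rfl fun i _ => ?_
      rw [Pi.star_apply, RCLike.star_def, ← Complex.normSq_eq_conj_mul_self, Complex.ofReal_re,
        Complex.normSq_eq_norm_sq]
  obtain ⟨ψ, hψ, hψφ⟩ := hext _ hΦ
  have h1 := hψ n _ t ht hX ζ
  simp only [Matrix.map_apply, hψφ, inner_opOfFunctional_dual G u _ huζ] at h1
  rw [← map_mk_zero_eq_sum, hGX, hζn] at h1
  linarith

end Separation

section MatrixOperator

variable {K : Type*} [NormedAddCommGroup K] [InnerProductSpace ℂ K] {ι : Type*} [Fintype ι]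

/-- The operator on the Hilbert sum of copies of `K` given by a matrix of operators on `K`. -/
def matrixOp (T : Matrix ι ι (K →L[ℂ] K)) :
    PiLp 2 (fun _ : ι => K) →L[ℂ] PiLp 2 (fun _ : ι => K) :=
  ((PiLp.continuousLinearEquiv 2 ℂ (fun _ : ι => K)).symm :
      (ι → K) →L[ℂ] PiLp 2 (fun _ : ι => K)) ∘L
    ContinuousLinearMap.pi fun i => ∑ j, T i j ∘L PiLp.proj 2 (fun _ : ι => K) j

theorem matrixOp_apply (T : Matrix ι ι (K →L[ℂ] K)) (w : PiLp 2 (fun _ : ι => K)) (i : ι) :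
    matrixOp T w i = ∑ j, T i j (w j) := by
  simp [matrixOp]

theorem inner_matrixOp (T : Matrix ι ι (K →L[ℂ] K)) (v w : PiLp 2 (fun _ : ι => K)) :
    inner ℂ v (matrixOp T w) = ∑ i, ∑ j, inner ℂ (v i) (T i j (w j)) := by
  rw [PiLp.inner_apply]
  simp only [matrixOp_apply, inner_sum]

theorem matrixOp_add (T U : Matrix ι ι (K →L[ℂ] K)) :
    matrixOp (T + U) = matrixOp T + matrixOp U := by
  ext w i
  simp [matrixOp_apply, Finset.sum_add_distrib]

theorem matrixOp_smul (c : ℂ) (T : Matrix ι ι (K →L[ℂ] K)) :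
    matrixOp (c • T) = c • matrixOp T := by
  ext w i
  simp [matrixOp_apply, Finset.smul_sum]

theorem matrixOp_mul (T U : Matrix ι ι (K →L[ℂ] K)) :
    matrixOp (T * U) = matrixOp T * matrixOp U := by
  ext w i
  simp only [matrixOp_apply, mul_apply_eq_comp, Matrix.mul_apply,
    sum_apply, map_sum]
  rw [Finset.sum_comm]

theorem matrixOp_conjTranspose [CompleteSpace K] (T : Matrix ι ι (K →L[ℂ] K)) :
    matrixOp T.conjTranspose = star (matrixOp T) := by
  rw [ContinuousLinearMap.star_eq_adjoint, ContinuousLinearMap.eq_adjoint_iff]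
  intro v w
  rw [inner_matrixOp, ← inner_conj_symm, inner_matrixOp, map_sum, Finset.sum_comm]
  refine Finset.sum_congr rfl fun i _ => ?_
  rw [map_sum]
  refine Finset.sum_congr rfl fun j _ => ?_
  rw [Matrix.conjTranspose_apply, inner_conj_symm, ContinuousLinearMap.star_eq_adjoint,
    ContinuousLinearMap.adjoint_inner_left]

theorem matrixOp_injective [DecidableEq ι] :
    Function.Injective (matrixOp : Matrix ι ι (K →L[ℂ] K) → _) := by
  intro T U h
  ext i j x
  have h1 := congrArg (fun z => z i) (DFunLike.congr_fun h (WithLp.toLp 2 (Pi.single j x)))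
  simp only [matrixOp_apply] at h1
  have h2 (V : Matrix ι ι (K →L[ℂ] K)) : ∑ l, V i l ((Pi.single j x : ι → K) l) = V i j x := by
    rw [Finset.sum_eq_single j]
    · rw [Pi.single_eq_same]
    · intro l _ hl
      rw [Pi.single_eq_of_ne hl, map_zero]
    · simp
  rwa [h2, h2] at h1

variable [CompleteSpace K] {B N : Type*} [NonUnitalRing B] [Module ℂ B] [StarRing B]
  [NonUnitalCStarAlgebra N] {n : ℕ}

/-- The faithful representation of `Mₙ(B)` induced by an isomorphism `B ≃ B(K)`. -/
def levelRep (σ : B ≃⋆ₐ[ℂ] (K →L[ℂ] K)) (f : Matrix (Fin n) (Fin n) B ≃⋆ₐ[ℂ] N) :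
    N →⋆ₙₐ[ℂ] (PiLp 2 (fun _ : Fin n => K) →L[ℂ] PiLp 2 (fun _ : Fin n => K)) where
  toFun X := matrixOp ((f.symm X).map σ)
  map_smul' c X := by
    rw [map_smul, Matrix.map_smul _ _ (fun x => map_smul σ c x), matrixOp_smul]
    rfl
  map_zero' := by
    rw [map_zero, Matrix.map_zero _ (map_zero _)]
    ext w i
    simp [matrixOp_apply]
  map_add' X Y := by
    rw [map_add, Matrix.map_add _ (map_add _), matrixOp_add]
  map_mul' X Y := by
    rw [map_mul, ← matrixOp_mul]
    congr 1
    ext1 i j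
    simp only [Matrix.map_apply, Matrix.mul_apply, map_sum, map_mul]
  map_star' X := by
    rw [← matrixOp_conjTranspose, map_star]
    congr 1
    ext1 i j
    exact map_star σ _

theorem levelRep_apply (σ : B ≃⋆ₐ[ℂ] (K →L[ℂ] K)) (f : Matrix (Fin n) (Fin n) B ≃⋆ₐ[ℂ] N)
    (T : Matrix (Fin n) (Fin n) B) : levelRep σ f (f T) = matrixOp (T.map σ) := by
  change matrixOp ((f.symm (f T)).map σ) = _
  rw [StarAlgEquiv.symm_apply_apply]

theorem levelRep_injective (σ : B ≃⋆ₐ[ℂ] (K →L[ℂ] K)) (f : Matrix (Fin n) (Fin n) B ≃⋆ₐ[ℂ] N) :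
    Function.Injective (levelRep σ f) := by
  intro X Y h
  apply f.symm.injective
  have h1 := matrixOp_injective h
  ext i j
  exact σ.injective (congrFun (congrFun h1 i) j)

theorem norm_level_eq (σ : B ≃⋆ₐ[ℂ] (K →L[ℂ] K)) (f : Matrix (Fin n) (Fin n) B ≃⋆ₐ[ℂ] N)
    (T : Matrix (Fin n) (Fin n) B) : ‖f T‖ = ‖matrixOp (T.map σ)‖ := by
  rw [← levelRep_apply σ f]
  exact (NonUnitalStarAlgHom.norm_map (levelRep σ f) (levelRep_injective σ f) _).symm

theorem level_nonneg_iff [PartialOrder N] [StarOrderedRing N] (σ : B ≃⋆ₐ[ℂ] (K →L[ℂ] K))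
    (f : Matrix (Fin n) (Fin n) B ≃⋆ₐ[ℂ] N) (T : Matrix (Fin n) (Fin n) B) :
    0 ≤ f T ↔ (matrixOp (T.map σ)).IsPositive := by
  rw [← ContinuousLinearMap.nonneg_iff_isPositive, ← levelRep_apply σ f]
  exact (nonneg_map_iff_of_injective (levelRep σ f) (levelRep_injective σ f)).symm

end MatrixOperator

section Blocks

variable {R ι κ : Type*} [CStarAlgebra R] [PartialOrder R] [StarOrderedRing R] [Fintype ι]
  [Fintype κ]

theorem MNonneg.submatrix [DecidableEq ι] {X : Matrix ι ι R} (hX : MNonneg X) (g : κ → ι) :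
    MNonneg (X.submatrix g g) := by
  obtain ⟨W, rfl⟩ := hX.exists_gram
  exact MNonneg.gram (W.submatrix id g)

theorem MNonneg.fromBlocks [DecidableEq ι] {X : Matrix ι ι R} {t : ℝ} (ht : 0 < t)
    (h : MNonneg (((t ^ 2 : ℝ) : ℂ) • (1 : Matrix ι ι R) - X.conjTranspose * X)) :
    MNonneg (Matrix.fromBlocks ((t : ℂ) • (1 : Matrix ι ι R)) X X.conjTranspose
      ((t : ℂ) • (1 : Matrix ι ι R))) := by
  obtain ⟨L, hL⟩ := h.exists_gram
  have h1 := (MNonneg.gram (Matrix.fromBlocks ((t : ℂ) • (1 : Matrix ι ι R)) X 0 L)).smul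
    (inv_nonneg.2 ht.le)
  convert h1 using 1
  rw [Matrix.fromBlocks_conjTranspose, Matrix.fromBlocks_multiply, Matrix.fromBlocks_smul,
    ← hL]
  have ht' : (t : ℂ) ≠ 0 := by exact_mod_cast ht.ne'
  have hs : star (t : ℂ) = t := Complex.conj_ofReal t
  rw [Matrix.conjTranspose_smul, hs, Matrix.conjTranspose_one]
  congr 1 <;>
    simp only [Complex.ofReal_inv, Matrix.conjTranspose_zero, Matrix.zero_mul, Matrix.mul_zero,
      add_zero,
      Matrix.smul_mul, Matrix.mul_smul, Matrix.one_mul, Matrix.mul_one, smul_smul,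
      inv_mul_cancel₀ ht', inv_mul_cancel_left₀ ht', one_smul, add_sub_cancel,
      Complex.ofReal_mul, pow_two]

end Blocks

section CCP

variable {A : Type*} [NonUnitalCStarAlgebra A] {S : Submodule ℂ A}

theorem InCone.submatrix {ι κ : Type*} [Fintype ι] [Fintype κ] [DecidableEq ι]
    {X : Matrix ι ι S} {T : Matrix ι ι ℂ} (h : InCone S X T) (g : κ → ι) :
    InCone S (X.submatrix g g) (T.submatrix g g) := by
  obtain ⟨h1, P, h2, h3, h4⟩ := h
  exact ⟨h1.submatrix g, P.submatrix g g, h2.submatrix g, h3.submatrix g, h4.submatrix g⟩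

/-- The off-diagonal block matrix with a single nonzero block `X` lies in the cone at level
`t / 2` as soon as `‖X‖ ≤ t`. -/
theorem InCone.fromBlocks_of_norm_le {M : Type*} [NonUnitalCStarAlgebra M] {n : ℕ}
    (e : Matrix (Fin n) (Fin n) A ≃⋆ₐ[ℂ] M) {X : Matrix (Fin n) (Fin n) S} {t : ℝ} (ht : 0 < t)
    (h : ‖ofLevel e X‖ ≤ t) :
    InCone S (Matrix.fromBlocks 0 X 0 0) (((t / 2 : ℝ) : ℂ) • 1) := by
  have hT : (((t / 2 : ℝ) : ℂ) • (1 : Matrix (Fin n ⊕ Fin n) (Fin n ⊕ Fin n) ℂ)) +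
      (((t / 2 : ℝ) : ℂ) • (1 : Matrix (Fin n ⊕ Fin n) (Fin n ⊕ Fin n) ℂ)).conjTranspose =
      (t : ℂ) • 1 := by
    rw [Matrix.conjTranspose_smul, Matrix.conjTranspose_one, ← add_smul]
    congr 1
    simp
  have key (Y : Matrix (Fin n) (Fin n) (Unitization ℂ A))
      (hY : ‖CStarMatrix.ofMatrixStarAlgEquiv Y‖ ≤ t) :
      MNonneg (((t : ℂ) • (1 : Matrix (Fin n ⊕ Fin n) (Fin n ⊕ Fin n) ℂ)).map (scalU A) +
        Matrix.fromBlocks 0 Y Y.conjTranspose 0) := by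
    have h1 : MNonneg (((t ^ 2 : ℝ) : ℂ) • (1 : Matrix (Fin n) (Fin n) (Unitization ℂ A)) -
        Y.conjTranspose * Y) := by
      rw [MNonneg, map_sub, map_mul, ← Matrix.star_eq_conjTranspose, map_star, map_smul, map_one,
        sub_nonneg]
      refine (CStarAlgebra.star_mul_le_algebraMap_norm_sq
        (a := CStarMatrix.ofMatrixStarAlgEquiv Y)).trans ?_
      have hle : ‖CStarMatrix.ofMatrixStarAlgEquiv Y‖ ^ 2 ≤ t ^ 2 := by gcongr
      have h0 : algebraMap ℝ (CStarMatrix (Fin n) (Fin n) (Unitization ℂ A))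
          (‖CStarMatrix.ofMatrixStarAlgEquiv Y‖ ^ 2) ≤ algebraMap ℝ _ (t ^ 2) := by
        rw [← sub_nonneg, ← map_sub, ← scalU_smul_one]
        exact MNonneg.scal (Matrix.PosSemidef.one.smul (by exact_mod_cast sub_nonneg.2 hle))
      refine h0.trans_eq ?_
      exact (Algebra.algebraMap_eq_smul_one _).trans (Complex.coe_smul _ _).symm
    convert MNonneg.fromBlocks ht h1 using 1
    ext1 i j
    rcases i with i | i <;> rcases j with j | j <;>
      by_cases hij : i = j <;>
      simp [scalU, Algebra.algebraMap_eq_smul_one, hij]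
  have hn : ‖CStarMatrix.ofMatrixStarAlgEquiv (X.map (inclU S))‖ ≤ t := by
    rw [← levelEmb_ofLevel (e := e)]
    exact (NonUnitalStarAlgHom.norm_map (levelEmb e) (levelEmb_injective e) _).trans_le h
  have hX : (Matrix.fromBlocks 0 X 0 0).map (inclU S) +
      ((Matrix.fromBlocks 0 X 0 0).map (inclU S)).conjTranspose =
      Matrix.fromBlocks 0 (X.map (inclU S)) (X.map (inclU S)).conjTranspose 0 := by
    ext1 i j
    rcases i with i | i <;> rcases j with j | j <;> simp
  refine ⟨?_, 0, ?_, ?_, ?_⟩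
  · rw [hT]
    exact Matrix.PosSemidef.one.smul (by exact_mod_cast ht.le)
  · rw [Matrix.map_zero _ (map_zero _)]
    exact MNonneg.zero
  · rw [hT, hX, Matrix.map_zero _ (map_zero _), sub_zero]
    exact key _ hn
  · rw [hT, hX, Matrix.map_zero _ (map_zero _), sub_zero]
    convert key (-X.map (inclU S)) (by rwa [map_neg, norm_neg]) using 1
    rw [sub_eq_add_neg, Matrix.fromBlocks_neg, Matrix.conjTranspose_neg, neg_zero]

variable {K : Type*} [NormedAddCommGroup K] [InnerProductSpace ℂ K]

theorem IsVectorCCP.nonneg_of_inCone {φ : S →ₗ[ℂ] (K →L[ℂ] K)} (hφ : IsVectorCCP S φ) {ι : Type*}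
    [Fintype ι] [DecidableEq ι] {Y : Matrix ι ι S} {t : ℝ} (ht : 0 ≤ t)
    (h : InCone S Y ((t : ℂ) • 1)) (w : ι → K) :
    0 ≤ (∑ a, ∑ b, inner ℂ (w a) (φ (Y a b) (w b))).re + t * ∑ a, ‖w a‖ ^ 2 := by
  have σ := (Fintype.equivFin ι).symm
  have h1 := h.submatrix σ
  rw [show ((t : ℂ) • (1 : Matrix ι ι ℂ)).submatrix σ σ = (t : ℂ) • 1 by
    rw [← Matrix.submatrix_one_equiv σ]; rfl] at h1
  have h2 := hφ _ _ t ht h1 (w ∘ σ)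
  simp only [Matrix.submatrix_apply, Function.comp_apply] at h2
  rw [σ.sum_comp (fun a => ‖w a‖ ^ 2),
    σ.sum_comp (fun a => ∑ b, inner ℂ (w a) (φ (Y a (σ b)) (w (σ b))))] at h2
  convert h2 using 5 with a
  exact (σ.sum_comp (fun b => inner ℂ (w a) (φ (Y a b) (w b)))).symm

variable [CompleteSpace K]

theorem IsVectorCCP.apply_star {φ : S →ₗ[ℂ] (K →L[ℂ] K)} (hφ : IsVectorCCP S φ) {x : A} (hx : x ∈ S)
    (hsx : star x ∈ S) : φ ⟨star x, hsx⟩ = star (φ ⟨x, hx⟩) := by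
  set T := star (φ ⟨x, hx⟩) - φ ⟨star x, hsx⟩ with hT
  have hin : InCone S !![0, ⟨star x, hsx⟩; -⟨x, hx⟩, 0] (((0 : ℝ) : ℂ) • 1) := by
    rw [Complex.ofReal_zero, zero_smul]
    refine InCone.zero.congr ?_ rfl
    ext1 i j
    fin_cases i <;> fin_cases j <;> simp [inclU_apply]
  suffices h : T = 0 by
    exact (sub_eq_zero.1 h).symm
  ext w
  have h1 := hφ.nonneg_of_inCone le_rfl hin ![T w, w]
  simp only [Fin.sum_univ_two, zero_mul, add_zero, Matrix.of_apply, Matrix.cons_val',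
    Matrix.cons_val_zero, Matrix.cons_val_one, Matrix.cons_val_fin_one, map_zero, map_neg,
    zero_apply, inner_zero_right, zero_add, neg_apply, inner_neg_right] at h1
  have h2 : (inner ℂ w (φ ⟨x, hx⟩ (T w))).re = (inner ℂ (T w) (star (φ ⟨x, hx⟩) w)).re := by
    rw [ContinuousLinearMap.star_eq_adjoint, ContinuousLinearMap.adjoint_inner_right]
    exact inner_re_symm (𝕜 := ℂ) _ _
  have h3 : (inner ℂ (T w) (T w)).re = ‖T w‖ ^ 2 := by
    exact inner_self_eq_norm_sq (𝕜 := ℂ) _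
  rw [Complex.add_re, Complex.neg_re, h2, ← sub_eq_add_neg, ← Complex.sub_re, ← inner_sub_right,
    ← sub_apply, ← neg_sub (star (φ ⟨x, hx⟩)), ← hT, neg_apply, inner_neg_right, Complex.neg_re,
      h3] at h1
  have h4 : ‖T w‖ = 0 := by nlinarith [norm_nonneg (T w)]
  simpa using h4

variable {B : Type*} [NonUnitalRing B] [Module ℂ B] [StarRing B]
  {M : ℕ → Type*} [∀ n, NonUnitalCStarAlgebra (M n)] [∀ n, PartialOrder (M n)]
  [∀ n, StarOrderedRing (M n)] {e : ∀ n, Matrix (Fin n) (Fin n) A ≃⋆ₐ[ℂ] M n}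
  {N : ℕ → Type*} [∀ n, NonUnitalCStarAlgebra (N n)] [∀ n, PartialOrder (N n)]
  [∀ n, StarOrderedRing (N n)] {f : ∀ n, Matrix (Fin n) (Fin n) B ≃⋆ₐ[ℂ] N n}

theorem isCCP_iff_forall_matrix {φ : S →ₗ[ℂ] B} : IsCCP S M e N f φ ↔
    (∀ (x : A) (hx : x ∈ S) (hsx : star x ∈ S), φ ⟨star x, hsx⟩ = star (φ ⟨x, hx⟩)) ∧
      ∀ (n : ℕ) (Y : Matrix (Fin n) (Fin n) S), ‖f n (Y.map φ)‖ ≤ ‖ofLevel (e n) Y‖ ∧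
        (0 ≤ ofLevel (e n) Y → 0 ≤ f n (Y.map φ)) := by
  refine and_congr_right fun _ => forall_congr' fun n => ⟨fun h Y => ?_, fun h X hX => ?_⟩
  · have h1 : Y.map φ = Matrix.of fun i j =>
        φ ⟨(e n).symm (ofLevel (e n) Y) i j, ofLevel_mem Y i j⟩ := by
      ext1 i j
      rw [Matrix.map_apply, Matrix.of_apply]
      congr 1
      refine Subtype.ext ?_
      change _ = (e n).symm (ofLevel (e n) Y) i j
      rw [ofLevel, StarAlgEquiv.symm_apply_apply, Matrix.map_apply]
    rw [h1]
    exact h _ (ofLevel_mem Y)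
  · have h1 := h (Matrix.of fun i j => ⟨(e n).symm X i j, hX i j⟩)
    rwa [show ofLevel (e n) (Matrix.of fun i j => ⟨(e n).symm X i j, hX i j⟩) = X from
      (e n).apply_symm_apply X] at h1

theorem IsCCP.isVectorCCP (hS : ∀ x ∈ S, star x ∈ S) (σ : B ≃⋆ₐ[ℂ] (K →L[ℂ] K)) {φ : S →ₗ[ℂ] B}
    {φ' : S →ₗ[ℂ] (K →L[ℂ] K)} (hσ : ∀ x, φ' x = σ (φ x)) (h : IsCCP S M e N f φ) :
    IsVectorCCP S φ' := by
  obtain ⟨hstar, h⟩ := isCCP_iff_forall_matrix.1 h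
  have hstar' (x y : S) (hxy : (y : A) = star (x : A)) : φ' y = star (φ' x) := by
    rw [hσ, hσ, ← StarHomClass.map_star, ← hstar x x.2 (hS x x.2)]
    congr 2
    exact Subtype.ext hxy
  intro n Y t ht hY w
  obtain ⟨Z, hZ, hZY⟩ := exists_hermitian_part hS Y
  have hre : (∑ a, ∑ b, inner ℂ (w a) (φ' (Y a b) (w b))).re =
      (∑ a, ∑ b, inner ℂ (w a) (φ' (Z a b) (w b))).re := by
    have h1 (a b : Fin n) : φ' (Y a b - Z a b) = -star (φ' (Y b a - Z b a)) := by
      rw [← hstar' _ ⟨star ((Y b a - Z b a : S) : A), hS _ (Y b a - Z b a).2⟩ rfl, ← map_neg]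
      congr 1
      refine Subtype.ext (Unitization.inr_injective (R := ℂ) ?_)
      have h2 := congrFun (congrFun hZY a) b
      simp only [Matrix.add_apply, Matrix.map_apply, Matrix.conjTranspose_apply, inclU_apply] at h2
      simp only [Submodule.coe_sub, Submodule.coe_neg, Unitization.inr_sub, Unitization.inr_neg,
        Unitization.inr_star, star_sub]
      rw [sub_eq_iff_eq_add, ← sub_eq_zero, ← sub_eq_zero.2 h2.symm]
      abel
    have h2 : ∑ a, ∑ b, inner ℂ (w a) (φ' (Y a b - Z a b) (w b)) =
        -star (∑ a, ∑ b, inner ℂ (w a) (φ' (Y a b - Z a b) (w b))) := by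
      rw [star_sum, Finset.sum_congr rfl fun a _ => star_sum _ _, Finset.sum_comm,
        ← Finset.sum_neg_distrib]
      refine Finset.sum_congr rfl fun a _ => ?_
      rw [← Finset.sum_neg_distrib]
      refine Finset.sum_congr rfl fun b _ => ?_
      rw [h1 b a, neg_apply, inner_neg_right, ContinuousLinearMap.star_eq_adjoint,
        ContinuousLinearMap.adjoint_inner_right]
      congr 1
      exact (inner_conj_symm _ _).symm
    have h3 := congrArg Complex.re h2
    simp only [map_sub, sub_apply, inner_sub_right, Finset.sum_sub_distrib, Complex.sub_re,
      Complex.neg_re, RCLike.star_def, Complex.conj_re] at h3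
    linarith
  rw [hre]
  have hZsa : IsSelfAdjoint (ofLevel (e n) Z) := isSelfAdjoint_ofLevel_iff.2 hZ
  have hd := infDist_le_of_inCone hZsa ht (hY.congr hZY.symm rfl)
  set v : PiLp 2 (fun _ : Fin n => K) := WithLp.toLp 2 w with hv
  have hvn : ‖v‖ ^ 2 = ∑ a, ‖w a‖ ^ 2 := PiLp.norm_sq_eq_of_L2 _ v
  have hmap (Y : Matrix (Fin n) (Fin n) S) : (Y.map φ).map σ = Y.map φ' := by
    ext1 a b
    exact (hσ _).symm
  rw [← hvn]
  refine le_of_forall_pos_le_add fun ε hε => ?_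
  set δ := ε / (‖v‖ ^ 2 + 1) with hδ
  have hδ0 : 0 < δ := by positivity
  obtain ⟨P', ⟨hP', hP0⟩, hPd⟩ := (Metric.infDist_lt_iff
    (⟨0, (matrixLevel S (e n)).zero_mem, le_rfl⟩ :
      {Y : M n | Y ∈ matrixLevel S (e n) ∧ 0 ≤ Y}.Nonempty)).1
    (hd.trans_lt (lt_add_of_pos_right t hδ0))
  obtain ⟨P, rfl⟩ := exists_ofLevel_eq hP'
  rw [dist_eq_norm, ← ofLevel_sub] at hPd
  have h1 := ((h n P).2 hP0)
  rw [level_nonneg_iff σ, hmap] at h1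
  have h2 := h1.re_inner_nonneg_right v
  have h3 := (h n (Z - P)).1.trans hPd.le
  rw [norm_level_eq σ, hmap] at h3
  have h4 : |(inner ℂ v (matrixOp ((Z - P).map φ') v)).re| ≤ (t + δ) * ‖v‖ ^ 2 := by
    refine (Complex.abs_re_le_norm _).trans ((norm_inner_le_norm _ _).trans ?_)
    have := (matrixOp ((Z - P).map φ')).le_of_opNorm_le h3 v
    nlinarith [norm_nonneg v]
  have h5 : (inner ℂ v (matrixOp (P.map φ') v)).re + (inner ℂ v (matrixOp ((Z - P).map φ') v)).re =
      (∑ a, ∑ b, inner ℂ (w a) (φ' (Z a b) (w b))).re := by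
    rw [← Complex.add_re, ← inner_add_right, ← add_apply, ← matrixOp_add,
      ← Matrix.map_add _ (map_add φ'), add_sub_cancel, inner_matrixOp]
    rfl
  have h6 : δ * ‖v‖ ^ 2 ≤ ε := by
    rw [hδ, div_mul_eq_mul_div, div_le_iff₀ (by positivity)]
    nlinarith
  have h7 := neg_le_of_abs_le h4
  change 0 ≤ (inner ℂ v (matrixOp (P.map φ') v)).re at h2
  linarith

theorem IsVectorCCP.isCCP (hS : ∀ x ∈ S, star x ∈ S) (σ : B ≃⋆ₐ[ℂ] (K →L[ℂ] K)) {φ : S →ₗ[ℂ] B}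
    {φ' : S →ₗ[ℂ] (K →L[ℂ] K)} (hσ : ∀ x, φ' x = σ (φ x)) (h : IsVectorCCP S φ') :
    IsCCP S M e N f φ := by
  have hmap {n : ℕ} (Y : Matrix (Fin n) (Fin n) S) : (Y.map φ).map σ = Y.map φ' := by
    ext1 a b
    exact (hσ _).symm
  refine isCCP_iff_forall_matrix.2 ⟨fun x hx hsx => ?_, fun n Y => ⟨?_, fun hY => ?_⟩⟩
  · apply σ.injective
    change σ _ = σ _
    rw [StarHomClass.map_star, ← hσ, ← hσ]
    exact h.apply_star hx hsx
  · refine le_of_forall_gt_imp_ge_of_dense fun t ht => ?_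
    have ht0 : 0 < t := (norm_nonneg _).trans_lt ht
    rw [norm_level_eq σ, hmap]
    refine ContinuousLinearMap.opNorm_le_bound _ ht0.le fun v => ?_
    set z := matrixOp (Y.map φ') v with hz
    set u := ((-t⁻¹ : ℝ) : ℂ) • z with hu
    have h1 := h.nonneg_of_inCone (by positivity) (InCone.fromBlocks_of_norm_le (e n) ht0 ht.le)
      (Sum.elim u v)
    have h2 : ∑ i, ∑ j, inner ℂ (u i) (φ' (Y i j) (v j)) =
        ((-t⁻¹ : ℝ) : ℂ) * ((‖z‖ ^ 2 : ℝ) : ℂ) := by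
      have h3 := inner_matrixOp (Y.map φ') u v
      rw [← hz, hu, inner_smul_left, inner_self_eq_norm_sq_to_K, Complex.conj_ofReal] at h3
      rw [Complex.ofReal_pow]
      exact h3.symm
    have h4 : ∑ i, ‖u i‖ ^ 2 = t⁻¹ ^ 2 * ‖z‖ ^ 2 := by
      rw [← PiLp.norm_sq_eq_of_L2, hu, norm_smul, mul_pow]
      simp
    simp only [Fintype.sum_sum_type, Matrix.fromBlocks_apply₁₁, Matrix.fromBlocks_apply₁₂,
      Matrix.fromBlocks_apply₂₁, Matrix.fromBlocks_apply₂₂, Sum.elim_inl, Sum.elim_inr,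
      Matrix.zero_apply, map_zero, zero_apply, inner_zero_right, Finset.sum_const_zero, zero_add,
      add_zero, h2, h4, ← PiLp.norm_sq_eq_of_L2 _ v] at h1
    rw [← Complex.ofReal_mul, Complex.ofReal_re] at h1
    have h5 : ‖z‖ ^ 2 ≤ (t * ‖v‖) ^ 2 := by
      have h6 : t * (-t⁻¹ * ‖z‖ ^ 2 + t / 2 * (t⁻¹ ^ 2 * ‖z‖ ^ 2 + ‖v‖ ^ 2)) =
          ((t * ‖v‖) ^ 2 - ‖z‖ ^ 2) / 2 := by
        field_simp
        ring
      nlinarith [mul_nonneg ht0.le h1]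
    exact le_of_sq_le_sq h5 (by positivity)
  · rw [level_nonneg_iff σ, hmap, ContinuousLinearMap.isPositive_def']
    have hYn := nonneg_ofLevel_iff.1 hY
    refine ⟨?_, fun v => ?_⟩
    · rw [isSelfAdjoint_iff, ← matrixOp_conjTranspose]
      congr 1
      ext1 i j
      have h1 := congrFun (congrFun hYn.isHermitian i) j
      have h2 : star (Y j i : A) = Y i j :=
        Unitization.inr_injective (R := ℂ) ((Unitization.inr_star _).trans h1)
      rw [Matrix.conjTranspose_apply, Matrix.map_apply, Matrix.map_apply,
        ← h.apply_star (Y j i).2 (hS _ (Y j i).2)]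
      congr 1
      exact Subtype.ext h2
    · have h1 := h n Y 0 le_rfl (by
        rw [Complex.ofReal_zero, zero_smul]
        exact InCone.of_nonneg hYn) v
      rw [zero_mul, add_zero] at h1
      rw [ContinuousLinearMap.reApplyInnerSelf_apply, inner_re_symm, inner_matrixOp]
      exact h1

end CCP

section Model

variable {B : Type*} [NonUnitalRing B] [Module ℂ B] [StarRing B] {k : ℕ}

/-- Matrices over a full matrix algebra are matrices over a product index type. -/
def compMatrixEquiv (β : B ≃⋆ₐ[ℂ] Matrix (Fin k) (Fin k) ℂ) (n : ℕ) :
    Matrix (Fin n) (Fin n) B ≃⋆ₐ[ℂ]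
      Matrix (ULift.{v} (Fin n × Fin k)) (ULift.{v} (Fin n × Fin k)) ℂ where
  toFun X := Matrix.of fun p q => β (X p.down.1 q.down.1) p.down.2 q.down.2
  invFun Y := Matrix.of fun i j => β.symm (Matrix.of fun a b => Y ⟨(i, a)⟩ ⟨(j, b)⟩)
  left_inv X := by
    ext1 i j
    exact β.symm_apply_apply (X i j)
  right_inv Y := by
    ext1 p q
    exact congrFun (congrFun (β.apply_symm_apply _) _) _
  map_add' X Y := by
    ext1 p q
    simp
  map_mul' X Y := by
    ext1 p q
    simp only [Matrix.of_apply, Matrix.mul_apply, map_sum, map_mul, Matrix.sum_apply]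
    rw [← Equiv.ulift.symm.sum_comp, Fintype.sum_prod_type]
    rfl
  map_star' X := by
    ext1 p q
    simp [Matrix.star_apply, StarHomClass.map_star]
  map_smul' c X := by
    ext1 p q
    simp

/-- A concrete C*-algebra structure on the matrix levels of a full matrix algebra. -/
def modelEquiv (β : B ≃⋆ₐ[ℂ] Matrix (Fin k) (Fin k) ℂ) (n : ℕ) :
    Matrix (Fin n) (Fin n) B ≃⋆ₐ[ℂ] (EuclideanSpace ℂ (ULift.{v} (Fin n × Fin k)) →L[ℂ]
      EuclideanSpace ℂ (ULift.{v} (Fin n × Fin k))) :=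
  (compMatrixEquiv β n).trans Matrix.toEuclideanCLM

end Model

section Extension

variable {A : Type*} [NonUnitalCStarAlgebra A] {E F : Submodule ℂ A} {hEF : E ≤ F}
  {B : Type*} [NonUnitalRing B] [Module ℂ B] [StarRing B]
  {M : ℕ → Type*} [∀ n, NonUnitalCStarAlgebra (M n)] [∀ n, PartialOrder (M n)]
  [∀ n, StarOrderedRing (M n)] {e : ∀ n, Matrix (Fin n) (Fin n) A ≃⋆ₐ[ℂ] M n}
  {K : Type*} [NormedAddCommGroup K] [InnerProductSpace ℂ K] [CompleteSpace K]

/-- The star isomorphism `σ`, as a linear equivalence. -/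
def StarAlgEquiv.toLinearEquivComplex {C : Type*} [NonUnitalRing C] [Module ℂ C] [Star C]
    (σ : B ≃⋆ₐ[ℂ] C) : B ≃ₗ[ℂ] C where
  toFun := σ
  invFun := σ.symm
  left_inv := σ.symm_apply_apply
  right_inv := σ.apply_symm_apply
  map_add' := map_add σ
  map_smul' := map_smul σ

theorem IsCCP.exists_extension (hG : IsGaugeMaximal hEF) (hE : ∀ x ∈ E, star x ∈ E)
    (hF : ∀ x ∈ F, star x ∈ F) (σ : B ≃⋆ₐ[ℂ] (K →L[ℂ] K))
    {N : ℕ → Type*} [∀ n, NonUnitalCStarAlgebra (N n)] [∀ n, PartialOrder (N n)]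
    [∀ n, StarOrderedRing (N n)] {f : ∀ n, Matrix (Fin n) (Fin n) B ≃⋆ₐ[ℂ] N n}
    {φ : E →ₗ[ℂ] B} (hφ : IsCCP E M e N f φ) :
    ∃ ψ : F →ₗ[ℂ] B, IsCCP F M e N f ψ ∧ ∀ x : E, ψ (Submodule.inclusion hEF x) = φ x := by
  have h1 : IsVectorCCP E (σ.toLinearEquivComplex ∘ₗ φ) :=
    hφ.isVectorCCP hE σ fun x => rfl
  obtain ⟨ψ, hψ, hψφ⟩ := h1.exists_extension hG
  refine ⟨σ.toLinearEquivComplex.symm ∘ₗ ψ, hψ.isCCP hF σ fun x => ?_, fun x => ?_⟩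
  · exact (σ.apply_symm_apply _).symm
  · change σ.symm (ψ _) = _
    rw [hψφ]
    exact σ.symm_apply_apply _

theorem IsVectorCCP.exists_extension_of_isCCP (hE : ∀ x ∈ E, star x ∈ E)
    (hF : ∀ x ∈ F, star x ∈ F) (σ : B ≃⋆ₐ[ℂ] (K →L[ℂ] K))
    {N : ℕ → Type*} [∀ n, NonUnitalCStarAlgebra (N n)] [∀ n, PartialOrder (N n)]
    [∀ n, StarOrderedRing (N n)] {f : ∀ n, Matrix (Fin n) (Fin n) B ≃⋆ₐ[ℂ] N n}
    (h : ∀ φ : E →ₗ[ℂ] B, IsCCP E M e N f φ → ∃ ψ : F →ₗ[ℂ] B, IsCCP F M e N f ψ ∧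
      ∀ (x : A) (hxE : x ∈ E) (hxF : x ∈ F), ψ ⟨x, hxF⟩ = φ ⟨x, hxE⟩)
    {φ : E →ₗ[ℂ] (K →L[ℂ] K)} (hφ : IsVectorCCP E φ) :
    ∃ ψ : F →ₗ[ℂ] (K →L[ℂ] K), IsVectorCCP F ψ ∧
      ∀ x : E, ψ (Submodule.inclusion hEF x) = φ x := by
  obtain ⟨ψ, hψ, hψφ⟩ := h (σ.toLinearEquivComplex.symm ∘ₗ φ)
    (hφ.isCCP hE σ fun x => (σ.apply_symm_apply _).symm)
  refine ⟨σ.toLinearEquivComplex ∘ₗ ψ, hψ.isVectorCCP hF σ fun x => rfl, fun x => ?_⟩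
  exact (congrArg σ (hψφ x x.2 (hEF x.2))).trans (σ.apply_symm_apply _)

/-- Gauge maximality is equivalent to the extension property for CCP maps into matrix algebras. -/
theorem isGaugeMaximal_iff_exists_extension_matrix (hE : ∀ x ∈ E, star x ∈ E)
    (hF : ∀ x ∈ F, star x ∈ F) : IsGaugeMaximal hEF ↔
      ∀ (k : ℕ) (N : ℕ → Type v) [∀ n, NonUnitalCStarAlgebra (N n)] [∀ n, PartialOrder (N n)]
        [∀ n, StarOrderedRing (N n)]
        (f : ∀ n, Matrix (Fin n) (Fin n) (Matrix (Fin k) (Fin k) ℂ) ≃⋆ₐ[ℂ] N n)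
        (φ : E →ₗ[ℂ] Matrix (Fin k) (Fin k) ℂ), IsCCP E M e N f φ →
        ∃ ψ : F →ₗ[ℂ] Matrix (Fin k) (Fin k) ℂ, IsCCP F M e N f ψ ∧
          ∀ (x : A) (hxE : x ∈ E) (hxF : x ∈ F), ψ ⟨x, hxF⟩ = φ ⟨x, hxE⟩ := by
  constructor
  · intro hG k N _ _ _ f φ hφ
    obtain ⟨ψ, hψ, hψφ⟩ := hφ.exists_extension hG hE hF
      (Matrix.toEuclideanCLM (n := Fin k) (𝕜 := ℂ))
    exact ⟨ψ, hψ, fun x hxE _ => hψφ ⟨x, hxE⟩⟩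
  · intro h
    refine isGaugeMaximal_of_forall_isVectorCCP fun n => ⟨EuclideanSpace ℂ (Fin n), inferInstance,
      inferInstance, ⟨_, (EuclideanSpace.basisFun (Fin n) ℂ).orthonormal⟩, fun φ hφ => ?_⟩
    exact hφ.exists_extension_of_isCCP hE hF (Matrix.toEuclideanCLM (n := Fin n) (𝕜 := ℂ))
      (h n _ (modelEquiv.{v} (.refl _ _)))

/-- Gauge maximality is equivalent to the extension property for CCP maps into `B(K)`. -/
theorem isGaugeMaximal_iff_exists_extension_operator (hE : ∀ x ∈ E, star x ∈ E)
    (hF : ∀ x ∈ F, star x ∈ F) : IsGaugeMaximal hEF ↔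
      ∀ (K : Type u) [NormedAddCommGroup K] [InnerProductSpace ℂ K] [CompleteSpace K]
        (N : ℕ → Type v) [∀ n, NonUnitalCStarAlgebra (N n)] [∀ n, PartialOrder (N n)]
        [∀ n, StarOrderedRing (N n)]
        (f : ∀ n, Matrix (Fin n) (Fin n) (K →L[ℂ] K) ≃⋆ₐ[ℂ] N n)
        (φ : E →ₗ[ℂ] (K →L[ℂ] K)), IsCCP E M e N f φ →
        ∃ ψ : F →ₗ[ℂ] (K →L[ℂ] K), IsCCP F M e N f ψ ∧
          ∀ (x : A) (hxE : x ∈ E) (hxF : x ∈ F), ψ ⟨x, hxF⟩ = φ ⟨x, hxE⟩ := by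
  constructor
  · intro hG K _ _ _ N _ _ _ f φ hφ
    obtain ⟨ψ, hψ, hψφ⟩ := hφ.exists_extension hG hE hF (.refl _ _)
    exact ⟨ψ, hψ, fun x hxE _ => hψφ ⟨x, hxE⟩⟩
  · intro h
    refine isGaugeMaximal_of_forall_isVectorCCP fun n =>
      ⟨EuclideanSpace ℂ (ULift.{u} (Fin n)), inferInstance, inferInstance,
      ⟨_, ((EuclideanSpace.basisFun (ULift.{u} (Fin n)) ℂ).reindex Equiv.ulift).orthonormal⟩,
      fun φ hφ => ?_⟩
    have β : (EuclideanSpace ℂ (ULift.{u} (Fin n)) →L[ℂ] EuclideanSpace ℂ (ULift.{u} (Fin n)))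
        ≃⋆ₐ[ℂ]
        Matrix (Fin n) (Fin n) ℂ :=
      (LinearIsometryEquiv.conjStarAlgEquiv
        (LinearIsometryEquiv.piLpCongrLeft 2 ℂ ℂ Equiv.ulift)).trans
        (Matrix.toEuclideanCLM (n := Fin n) (𝕜 := ℂ)).symm
    exact hφ.exists_extension_of_isCCP hE hF (.refl _ _) (h _ _ (modelEquiv.{v} β))

end Extension

section Functional

variable {B : Type*} [NonUnitalCStarAlgebra B] [PartialOrder B] [StarOrderedRing B]
  {S E F : Submodule ℂ B}

/-- The pairs `(X, t)` such that the selfadjoint part of `X` has distance at most `t` to a positive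
element of `S`. -/
def gaugeCone (S : Submodule ℂ B) : PointedCone ℝ (S × ℝ) where
  carrier := {Y | ∃ P ∈ S, 0 ≤ P ∧ ‖(Y.1 : B) + star (Y.1 : B) - P‖ ≤ 2 * Y.2}
  add_mem' := by
    rintro Y Z ⟨P, hP, hP0, hPY⟩ ⟨Q, hQ, hQ0, hQZ⟩
    refine ⟨P + Q, S.add_mem hP hQ, add_nonneg hP0 hQ0, ?_⟩
    have h : ((Y + Z).1 : B) + star ((Y + Z).1 : B) - (P + Q) =
        ((Y.1 : B) + star (Y.1 : B) - P) + ((Z.1 : B) + star (Z.1 : B) - Q) := by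
      simp only [Prod.fst_add, Submodule.coe_add, star_add]
      abel
    rw [h, Prod.snd_add, mul_add]
    exact norm_add_le_of_le hPY hQZ
  zero_mem' := ⟨0, S.zero_mem, le_rfl, by simp⟩
  smul_mem' := by
    rintro ⟨c, hc⟩ Y ⟨P, hP, hP0, hPY⟩
    refine ⟨c • P, ?_, smul_nonneg hc hP0, ?_⟩
    · exact S.smul_of_tower_mem c hP
    · change ‖c • (Y.1 : B) + star (c • (Y.1 : B)) - c • P‖ ≤ 2 * (c • Y.2)
      rw [star_smul, star_trivial, ← smul_add, ← smul_sub, norm_smul, Real.norm_of_nonneg hc,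
        smul_eq_mul, mul_left_comm]
      gcongr

theorem mk_mem_gaugeCone_of_norm_le {X : S} {t : ℝ} (h : ‖X‖ ≤ t) : (X, t) ∈ gaugeCone S := by
  refine ⟨0, S.zero_mem, le_rfl, ?_⟩
  rw [sub_zero, two_mul]
  exact norm_add_le_of_le h (by rwa [norm_star])

theorem mk_zero_mem_gaugeCone {X : S} (h : (X : B) + star (X : B) ∈ S)
    (h0 : 0 ≤ (X : B) + star (X : B)) : (X, (0 : ℝ)) ∈ gaugeCone S :=
  ⟨_, h, h0, by simp⟩

theorem infDist_le_of_mem_gaugeCone {X H : S} (hH : (X : B) + star (X : B) = (2 : ℝ) • (H : B))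
    {t : ℝ} (h : (X, t) ∈ gaugeCone S) :
    Metric.infDist (H : B) {Y : B | Y ∈ S ∧ 0 ≤ Y} ≤ t := by
  obtain ⟨P, hP, hP0, hd⟩ := h
  have hmem : (2⁻¹ : ℝ) • P ∈ {Y : B | Y ∈ S ∧ 0 ≤ Y} :=
    ⟨S.smul_of_tower_mem _ hP, smul_nonneg (by norm_num) hP0⟩
  refine (Metric.infDist_le_dist_of_mem hmem).trans ?_
  have h2 : (X : B) + star (X : B) - P = (2 : ℝ) • ((H : B) - (2⁻¹ : ℝ) • P) := by
    rw [smul_sub, smul_smul, hH]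
    norm_num
  rw [dist_eq_norm]
  simp only [h2, norm_smul, Real.norm_ofNat] at hd
  linarith

theorem mul_infDist_le_of_smul_mem_gaugeCone {H : S}
    (hH : (H : B) + star (H : B) = (2 : ℝ) • (H : B)) {s t : ℝ} (h : (s • H, t) ∈ gaugeCone S) :
    s * Metric.infDist (H : B) {Y : B | Y ∈ S ∧ 0 ≤ Y} ≤ t := by
  have ht : 0 ≤ t := by
    obtain ⟨P, -, -, hP⟩ := h
    simpa using (norm_nonneg _).trans hP
  rcases le_or_gt s 0 with hs | hs
  · exact (mul_nonpos_of_nonpos_of_nonneg hs Metric.infDist_nonneg).trans ht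
  · have h1 := (gaugeCone S).smul_mem (inv_nonneg.2 hs.le) h
    have h2 : s⁻¹ • (s • H, t) = (H, s⁻¹ * t) := Prod.ext (inv_smul_smul₀ hs.ne' _) rfl
    rw [h2] at h1
    have h3 := infDist_le_of_mem_gaugeCone hH h1
    rwa [inv_mul_eq_div, le_div_iff₀' hs] at h3

theorem mem_gaugeCone_of_infDist_lt {X H : S} (hH : (X : B) + star (X : B) = (2 : ℝ) • (H : B))
    {t : ℝ} (h : Metric.infDist (H : B) {Y : B | Y ∈ S ∧ 0 ≤ Y} < t) : (X, t) ∈ gaugeCone S := by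
  obtain ⟨P, ⟨hP, hP0⟩, hd⟩ := (Metric.infDist_lt_iff
    (⟨0, S.zero_mem, le_rfl⟩ : {Y : B | Y ∈ S ∧ 0 ≤ Y}.Nonempty)).1 h
  refine ⟨(2 : ℝ) • P, S.smul_of_tower_mem _ hP, smul_nonneg (by norm_num) hP0, ?_⟩
  rw [dist_eq_norm] at hd
  simp only [hH, ← smul_sub, norm_smul, Real.norm_ofNat]
  linarith

theorem IsPositiveFunctional.nonneg_of_mem_gaugeCone (hS : ∀ x ∈ S, star x ∈ S) {φ : S →L[ℂ] ℂ}
    (hφ : IsPositiveFunctional S φ) (hφ1 : ‖φ‖ ≤ 1) {X : S} {t : ℝ} (h : (X, t) ∈ gaugeCone S) :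
    0 ≤ (φ X).re + t := by
  obtain ⟨P, hP, hP0, hd⟩ := h
  set R : S := X + ⟨star (X : B), hS _ X.2⟩ - ⟨P, hP⟩ with hR
  have h1 : φ R = φ X + starRingEnd ℂ (φ X) - φ ⟨P, hP⟩ := by
    rw [hR, map_sub, map_add, hφ.1 X X.2]
  have h2 : ‖φ R‖ ≤ 2 * t := (φ.le_of_opNorm_le hφ1 R).trans (by rw [one_mul]; exact hd)
  have h3 := (Complex.le_def.1 (hφ.2 P hP hP0)).1
  have h4 := (abs_le.1 ((Complex.abs_re_le_norm _).trans h2)).1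
  rw [h1] at h4
  simp only [Complex.sub_re, Complex.add_re, Complex.conj_re, Complex.zero_re] at h3 h4
  linarith

theorem exists_isPositiveFunctional_of_gaugeCone (hS : ∀ x ∈ S, star x ∈ S) (g : S →ₗ[ℂ] ℂ)
    (hg : ∀ (X : S) (t : ℝ), (X, t) ∈ gaugeCone S → 0 ≤ (g X).re + t) :
    ∃ φ : S →L[ℂ] ℂ, IsPositiveFunctional S φ ∧ ‖φ‖ ≤ 1 ∧ ∀ X, φ X = g X := by
  have hbound (X : S) : ‖g X‖ ≤ 1 * ‖X‖ := by
    obtain ⟨c, hc, hcX⟩ := RCLike.exists_norm_eq_mul_self (g X)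
    have h1 := hg (-(c • X)) ‖X‖
      (mk_mem_gaugeCone_of_norm_le (by rw [norm_neg, norm_smul, hc, one_mul]))
    rw [map_neg, map_smul, smul_eq_mul, ← hcX] at h1
    simpa using h1
  have hskew (Y : S) (hY : (Y : B) + star (Y : B) = 0) : 0 ≤ (g Y).re := by
    simpa using hg Y 0 (mk_zero_mem_gaugeCone (by rw [hY]; exact S.zero_mem) hY.ge)
  have hstar (x : B) (hx : x ∈ S) (hsx : star x ∈ S) :
      g ⟨star x, hsx⟩ = starRingEnd ℂ (g ⟨x, hx⟩) := by
    have key (c : ℂ) : 0 ≤ (c * g ⟨star x, hsx⟩ - starRingEnd ℂ c * g ⟨x, hx⟩).re := by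
      rw [← smul_eq_mul, ← smul_eq_mul, ← map_smul, ← map_smul, ← map_sub]
      apply hskew
      simp [star_smul]
    have h1 := key 1
    have h2 := key (-1)
    have h3 := key Complex.I
    have h4 := key (-Complex.I)
    simp at h1 h2 h3 h4
    apply Complex.ext
    · rw [Complex.conj_re]
      linarith
    · rw [Complex.conj_im]
      linarith
  refine ⟨g.mkContinuous 1 hbound, ⟨hstar, fun x hx h0 => ?_⟩,
    LinearMap.mkContinuous_norm_le _ zero_le_one _, fun X => rfl⟩
  change 0 ≤ g ⟨x, hx⟩
  have hsa : star x = x := (IsSelfAdjoint.of_nonneg h0).star_eq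
  have hre : 0 ≤ (g ⟨x, hx⟩).re := by
    simpa using hg ⟨x, hx⟩ 0 (mk_zero_mem_gaugeCone (S.add_mem hx (hS x hx))
      (by rw [hsa]; exact add_nonneg h0 h0))
  have him := hstar x hx (hS x hx)
  simp only [hsa] at him
  exact Complex.le_def.2 ⟨hre, (Complex.conj_eq_iff_im.1 him.symm).symm⟩

theorem exists_isPositiveFunctional_re_eq (hS : ∀ x ∈ S, star x ∈ S) {V : Type*} [AddCommGroup V]
    [Module ℝ V] (j : V →ₗ[ℝ] S) (f : V →ₗ[ℝ] ℝ)
    (hf : ∀ v t, (j v, t) ∈ gaugeCone S → 0 ≤ f v + t) :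
    ∃ φ : S →L[ℂ] ℂ, IsPositiveFunctional S φ ∧ ‖φ‖ ≤ 1 ∧ ∀ v, (φ (j v)).re = f v := by
  obtain ⟨g, hgf, hg⟩ := exists_extension_nonneg_of_pointedCone (gaugeCone S)
    (j.prodMap (LinearMap.id : ℝ →ₗ[ℝ] ℝ)) (f.coprod LinearMap.id)
    (fun v hv => hf v.1 v.2 hv) (fun Y => ⟨(0, ‖Y.1‖ - Y.2), by
      have h : (j.prodMap (LinearMap.id : ℝ →ₗ[ℝ] ℝ)) (0, ‖Y.1‖ - Y.2) + Y = (Y.1, ‖Y.1‖) := by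
        ext <;> simp
      rw [h]
      exact mk_mem_gaugeCone_of_norm_le le_rfl⟩)
  have hre (X : S) : (Module.Dual.extendRCLike (𝕜 := ℂ) (g ∘ₗ LinearMap.inl ℝ S ℝ) X).re =
      g (X, 0) := Module.Dual.re_extendRCLike_apply (𝕜 := ℂ) _ X
  have hgt (t : ℝ) : g (0, t) = t := by
    simpa using hgf (0, t)
  obtain ⟨φ, hφ, hφ1, hφg⟩ := exists_isPositiveFunctional_of_gaugeCone hS
    (Module.Dual.extendRCLike (𝕜 := ℂ) (g ∘ₗ LinearMap.inl ℝ S ℝ)) (fun X t h => by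
      rw [hre, ← hgt t, ← map_add]
      simpa using hg _ h)
  refine ⟨φ, hφ, hφ1, fun v => ?_⟩
  rw [hφg, hre]
  simpa using hgf (v, 0)

/-- Contractive positive functionals extend from `E` to `F` if and only if the distances of
selfadjoint elements of `E` to the positive cones of `E` and `F` agree. -/
theorem forall_exists_extension_isPositiveFunctional_iff (hEF : E ≤ F)
    (hE : ∀ x ∈ E, star x ∈ E) (hF : ∀ x ∈ F, star x ∈ F) :
    (∀ φ : E →L[ℂ] ℂ, IsPositiveFunctional E φ → ‖φ‖ ≤ 1 →
      ∃ ψ : F →L[ℂ] ℂ, IsPositiveFunctional F ψ ∧ ‖ψ‖ ≤ 1 ∧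
        ∀ (x : B) (hxE : x ∈ E) (hxF : x ∈ F), ψ ⟨x, hxF⟩ = φ ⟨x, hxE⟩) ↔
      ∀ X : B, X ∈ E → IsSelfAdjoint X →
        Metric.infDist X {Y : B | Y ∈ E ∧ 0 ≤ Y} = Metric.infDist X {Y : B | Y ∈ F ∧ 0 ≤ Y} := by
  constructor
  · intro h X hX hsa
    have h2 : X + star X = (2 : ℝ) • X := by rw [hsa.star_eq, two_smul]
    refine le_antisymm (le_of_forall_gt_imp_ge_of_dense fun t ht => ?_)
      (Metric.infDist_le_infDist_of_subset (fun Y hY => ⟨hEF hY.1, hY.2⟩)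
        ⟨0, E.zero_mem, le_rfl⟩)
    set d := Metric.infDist X {Y : B | Y ∈ E ∧ 0 ≤ Y} with hd
    have hd0 : 0 ≤ d := Metric.infDist_nonneg
    obtain ⟨φ, hφ, hφ1, hφX⟩ := exists_isPositiveFunctional_re_eq hE
      (LinearMap.toSpanSingleton ℝ E ⟨X, hX⟩) (-d • LinearMap.id) (fun s r hs => by
        have h3 : s * d ≤ r := mul_infDist_le_of_smul_mem_gaugeCone (H := ⟨X, hX⟩) h2 hs
        change 0 ≤ -d * s + r
        linarith)
    obtain ⟨ψ, hψ, hψ1, hψφ⟩ := h φ hφ hφ1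
    have h3 := hψ.nonneg_of_mem_gaugeCone hF hψ1
      (mem_gaugeCone_of_infDist_lt (X := ⟨X, hEF hX⟩) (H := ⟨X, hEF hX⟩) h2 ht)
    have h4 := hφX 1
    rw [LinearMap.toSpanSingleton_apply, one_smul] at h4
    rw [hψφ X hX, h4] at h3
    simp at h3
    exact h3
  · intro h φ hφ hφ1
    obtain ⟨ψ, hψ, hψ1, hψφ⟩ := exists_isPositiveFunctional_re_eq hF
      ((Submodule.inclusion hEF).restrictScalars ℝ)
      (Complex.reLm ∘ₗ (φ : E →ₗ[ℂ] ℂ).restrictScalars ℝ) (fun X t hX => by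
        have hH : (X : B) + star (X : B) = (2 : ℝ) • ((2⁻¹ : ℝ) • ((X : B) + star (X : B))) := by
          rw [smul_smul]
          norm_num
        have hmem : (2⁻¹ : ℝ) • ((X : B) + star (X : B)) ∈ E :=
          E.smul_of_tower_mem _ (E.add_mem X.2 (hE _ X.2))
        have h1 := infDist_le_of_mem_gaugeCone (H := ⟨_, hEF hmem⟩) hH hX
        rw [← h _ hmem (by simp [isSelfAdjoint_iff, add_comm])] at h1
        refine le_of_forall_pos_le_add fun δ hδ => ?_
        rw [add_assoc]
        exact hφ.nonneg_of_mem_gaugeCone hE hφ1 (mem_gaugeCone_of_infDist_lt (H := ⟨_, hmem⟩) hH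
          (lt_of_le_of_lt h1 (lt_add_of_pos_right t hδ))))
    refine ⟨ψ, hψ, hψ1, fun x hxE hxF => ?_⟩
    have h1 := LinearMap.eq_of_re_eq (f := (ψ : F →ₗ[ℂ] ℂ) ∘ₗ Submodule.inclusion hEF)
      (g := (φ : E →ₗ[ℂ] ℂ)) hψφ
    exact LinearMap.congr_fun h1 ⟨x, hxE⟩

theorem star_mem_matrixLevel {A M : Type*} [NonUnitalCStarAlgebra A] [NonUnitalCStarAlgebra M]
    {n : ℕ} {E : Submodule ℂ A} (hE : ∀ x ∈ E, star x ∈ E)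
    (e : Matrix (Fin n) (Fin n) A ≃⋆ₐ[ℂ] M) : ∀ X ∈ matrixLevel E e, star X ∈ matrixLevel E e := by
  intro X hX i j
  rw [StarHomClass.map_star, Matrix.star_apply]
  exact hE _ (hX j i)

end Functional

/-- **Theorems A / 3.2 / 3.8.**  For an inclusion `E ⊆ F` of selfadjoint
subspaces of a C*-algebra, the following are equivalent: (1) contractive positive functionals
extend from `Mₙ(E)` to `Mₙ(F)` at every matrix level; (2) CCP maps into `Mₖ(ℂ)` extend from
`E` to `F`; (3) CCP maps into `B(K)` extend from `E` to `F` for every Hilbert space `K`;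
(4) the inclusion `E ⊆ F` is a gauge maximal isometry. -/
theorem stmt_3 {A : Type*} [NonUnitalCStarAlgebra A] [PartialOrder A] [StarOrderedRing A]
    (E F : Submodule ℂ A) (hEF : E ≤ F)
    (hEclosed : IsClosed (E : Set A)) (hFclosed : IsClosed (F : Set A))
    (hEstar : ∀ x ∈ E, star x ∈ E) (hFstar : ∀ x ∈ F, star x ∈ F)
    (M : ℕ → Type*) [∀ n, NonUnitalCStarAlgebra (M n)] [∀ n, PartialOrder (M n)]
    [∀ n, StarOrderedRing (M n)]
    (e : ∀ n, Matrix (Fin n) (Fin n) A ≃⋆ₐ[ℂ] M n) :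
    -- the four conditions
    ((∀ (n : ℕ) (φ : matrixLevel E (e n) →L[ℂ] ℂ),
        IsPositiveFunctional (matrixLevel E (e n)) φ → ‖φ‖ ≤ 1 →
        ∃ ψ : matrixLevel F (e n) →L[ℂ] ℂ,
          IsPositiveFunctional (matrixLevel F (e n)) ψ ∧ ‖ψ‖ ≤ 1 ∧
          ∀ (x : M n) (hxE : x ∈ matrixLevel E (e n)) (hxF : x ∈ matrixLevel F (e n)),
            ψ ⟨x, hxF⟩ = φ ⟨x, hxE⟩) ↔
      (∀ (n : ℕ) (X : M n), X ∈ matrixLevel E (e n) → IsSelfAdjoint X →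
        Metric.infDist X {Y : M n | Y ∈ matrixLevel E (e n) ∧ 0 ≤ Y} =
          Metric.infDist X {Y : M n | Y ∈ matrixLevel F (e n) ∧ 0 ≤ Y})) ∧
    ((∀ (k : ℕ) (N : ℕ → Type v) [∀ n, NonUnitalCStarAlgebra (N n)] [∀ n, PartialOrder (N n)]
        [∀ n, StarOrderedRing (N n)]
        (f : ∀ n, Matrix (Fin n) (Fin n) (Matrix (Fin k) (Fin k) ℂ) ≃⋆ₐ[ℂ] N n)
        (φ : E →ₗ[ℂ] Matrix (Fin k) (Fin k) ℂ), IsCCP E M e N f φ →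
        ∃ ψ : F →ₗ[ℂ] Matrix (Fin k) (Fin k) ℂ, IsCCP F M e N f ψ ∧
          ∀ (x : A) (hxE : x ∈ E) (hxF : x ∈ F), ψ ⟨x, hxF⟩ = φ ⟨x, hxE⟩) ↔
      (∀ (n : ℕ) (X : M n), X ∈ matrixLevel E (e n) → IsSelfAdjoint X →
        Metric.infDist X {Y : M n | Y ∈ matrixLevel E (e n) ∧ 0 ≤ Y} =
          Metric.infDist X {Y : M n | Y ∈ matrixLevel F (e n) ∧ 0 ≤ Y})) ∧
    ((∀ (K : Type u) [NormedAddCommGroup K] [InnerProductSpace ℂ K] [CompleteSpace K]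
        (N : ℕ → Type v) [∀ n, NonUnitalCStarAlgebra (N n)] [∀ n, PartialOrder (N n)]
        [∀ n, StarOrderedRing (N n)]
        (f : ∀ n, Matrix (Fin n) (Fin n) (K →L[ℂ] K) ≃⋆ₐ[ℂ] N n)
        (φ : E →ₗ[ℂ] (K →L[ℂ] K)), IsCCP E M e N f φ →
        ∃ ψ : F →ₗ[ℂ] (K →L[ℂ] K), IsCCP F M e N f ψ ∧
          ∀ (x : A) (hxE : x ∈ E) (hxF : x ∈ F), ψ ⟨x, hxF⟩ = φ ⟨x, hxE⟩) ↔
      (∀ (n : ℕ) (X : M n), X ∈ matrixLevel E (e n) → IsSelfAdjoint X →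
        Metric.infDist X {Y : M n | Y ∈ matrixLevel E (e n) ∧ 0 ≤ Y} =
          Metric.infDist X {Y : M n | Y ∈ matrixLevel F (e n) ∧ 0 ≤ Y})) := by
  refine ⟨?_, ?_, ?_⟩
  · exact forall_congr' fun n => forall_exists_extension_isPositiveFunctional_iff
      (fun X hX i j => hEF (hX i j)) (star_mem_matrixLevel hEstar (e n))
      (star_mem_matrixLevel hFstar (e n))
  · rw [← isGaugeMaximal_iff hEF hEstar M e]
    exact (isGaugeMaximal_iff_exists_extension_matrix hEstar hFstar).symm
  · rw [← isGaugeMaximal_iff hEF hEstar M e]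
    exact (isGaugeMaximal_iff_exists_extension_operator hEstar hFstar).symm
end
end

section
/- Let A be a unital C*-algebra and let E ⊆ A be a selfadjoint subspace that generates A and is approximately positively generated (the closure of {p − q : p, q ∈ E₊} equals E_sa). Then every positive functional φ on E extends to a positive functional on A; that is, there exists a positive functional ψ on A with ψ(x) = φ(x) for all x ∈ E. (The extension need not have the same norm as φ.) -/
open scoped ComplexOrder

noncomputable section

theorem complex_smul_mem_ideal {A : Type*} [Ring A] [Algebra ℂ A] (I : Ideal A) (c : ℂ) {x : A}
    (hx : x ∈ I) : c • x ∈ I := by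
  simpa using I.mul_mem_left (c • (1 : A)) hx

section OrderUnit

variable {A : Type*} [CStarAlgebra A] [PartialOrder A] [StarOrderedRing A]

theorem mul_self_le_norm_smul_self {p : A} (hp : 0 ≤ p) : p * p ≤ ‖p‖ • p := by
  have h := CStarAlgebra.star_left_conjugate_le_norm_smul (a := CFC.sqrt p)
    (IsSelfAdjoint.of_nonneg hp)
  have hs : star (CFC.sqrt p) = CFC.sqrt p := (IsSelfAdjoint.of_nonneg (CFC.sqrt_nonneg p)).star_eq
  have hpp : CFC.sqrt p * CFC.sqrt p = p := CFC.sqrt_mul_sqrt_self p hp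
  have hc : CFC.sqrt p * p * CFC.sqrt p = p * p := by
    calc CFC.sqrt p * p * CFC.sqrt p
        = CFC.sqrt p * (CFC.sqrt p * CFC.sqrt p) * CFC.sqrt p := by rw [hpp]
      _ = (CFC.sqrt p * CFC.sqrt p) * (CFC.sqrt p * CFC.sqrt p) := by simp only [mul_assoc]
      _ = p * p := by rw [hpp]
  rwa [hs, hpp, hc] at h

/-- The left ideal of all `x` such that `star x * x` is dominated by a positive element
of the subspace `E`. -/
def dominatedLeftIdeal (E : Submodule ℂ A) : Ideal A where
  carrier := {x | ∃ p ∈ E, 0 ≤ p ∧ star x * x ≤ p}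
  zero_mem' := ⟨0, E.zero_mem, le_rfl, by simp⟩
  add_mem' := by
    rintro x y ⟨p, hpE, hp, hxp⟩ ⟨q, hqE, hq, hyq⟩
    refine ⟨(p + q) + (p + q), E.add_mem (E.add_mem hpE hqE) (E.add_mem hpE hqE),
      add_nonneg (add_nonneg hp hq) (add_nonneg hp hq), ?_⟩
    have key : star (x + y) * (x + y) + star (x - y) * (x - y)
        = (star x * x + star y * y) + (star x * x + star y * y) := by
      simp only [star_add, star_sub]
      noncomm_ring
    calc star (x + y) * (x + y)
        ≤ star (x + y) * (x + y) + star (x - y) * (x - y) :=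
          le_add_of_nonneg_right (star_mul_self_nonneg _)
      _ = _ := key
      _ ≤ _ := add_le_add (add_le_add hxp hyq) (add_le_add hxp hyq)
  smul_mem' := by
    rintro a x ⟨p, hpE, hp, hxp⟩
    refine ⟨‖star a * a‖ • p, ?_, smul_nonneg (norm_nonneg _) hp, ?_⟩
    · rw [← Complex.coe_smul]
      exact E.smul_mem _ hpE
    · have h := CStarAlgebra.star_left_conjugate_le_norm_smul (a := x)
        (IsSelfAdjoint.star_mul_self a)
      calc star (a • x) * (a • x) = star x * (star a * a) * x := by
            simp only [smul_eq_mul, star_mul, mul_assoc]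
        _ ≤ _ := h
        _ ≤ _ := smul_le_smul_of_nonneg_left hxp (norm_nonneg _)

theorem mem_dominatedLeftIdeal_of_nonneg {E : Submodule ℂ A} {p : A} (hpE : p ∈ E) (hp : 0 ≤ p) :
    p ∈ dominatedLeftIdeal E := by
  refine ⟨‖p‖ • p, ?_, smul_nonneg (norm_nonneg _) hp, ?_⟩
  · rw [← Complex.coe_smul]
    exact E.smul_mem _ hpE
  · rw [(IsSelfAdjoint.of_nonneg hp).star_eq]
    exact mul_self_le_norm_smul_self hp

theorem mem_closure_dominatedLeftIdeal {E : Submodule ℂ A} (hEstar : ∀ x ∈ E, star x ∈ E)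
    (hapg : {x : A | x ∈ E ∧ star x = x} ⊆
      closure {y : A | ∃ p q : A, p ∈ E ∧ 0 ≤ p ∧ q ∈ E ∧ 0 ≤ q ∧ y = p - q})
    {x : A} (hx : x ∈ E) : x ∈ (dominatedLeftIdeal E).closure := by
  have hsa : ∀ y ∈ E, star y = y → y ∈ (dominatedLeftIdeal E).closure := by
    intro y hy hys
    refine closure_mono ?_ (hapg ⟨hy, hys⟩)
    rintro _ ⟨p, q, hpE, hp, hqE, hq, rfl⟩
    exact (dominatedLeftIdeal E).sub_mem (mem_dominatedLeftIdeal_of_nonneg hpE hp)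
      (mem_dominatedLeftIdeal_of_nonneg hqE hq)
  have hre : (realPart x : A) ∈ E := by
    rw [realPart_apply_coe, ← Complex.coe_smul]
    exact E.smul_mem _ (E.add_mem hx (hEstar x hx))
  have him : (imaginaryPart x : A) ∈ E := by
    rw [imaginaryPart_apply_coe, ← Complex.coe_smul (2⁻¹ : ℝ)]
    exact E.smul_mem _ (E.smul_mem _ (E.sub_mem hx (hEstar x hx)))
  rw [← realPart_add_I_smul_imaginaryPart x]
  exact Ideal.add_mem _ (hsa _ hre (realPart x).2.star_eq)
    (complex_smul_mem_ideal _ _ (hsa _ him (imaginaryPart x).2.star_eq))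

/-- An approximately positively generated selfadjoint subspace which generates a unital
C⋆-algebra contains an element dominating the unit. -/
theorem exists_one_le_of_generates {E : Submodule ℂ A} (hEstar : ∀ x ∈ E, star x ∈ E)
    (hgen : (NonUnitalStarAlgebra.adjoin ℂ (E : Set A)).topologicalClosure = ⊤)
    (hapg : {x : A | x ∈ E ∧ star x = x} ⊆
      closure {y : A | ∃ p q : A, p ∈ E ∧ 0 ≤ p ∧ q ∈ E ∧ 0 ≤ q ∧ y = p - q}) :
    ∃ e ∈ E, 1 ≤ e := by
  have hadj : ∀ x ∈ NonUnitalStarAlgebra.adjoin ℂ (E : Set A),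
      x ∈ (dominatedLeftIdeal E).closure ∧ star x ∈ (dominatedLeftIdeal E).closure := by
    intro x hx
    induction hx using NonUnitalStarAlgebra.adjoin_induction with
    | mem x hx =>
      exact ⟨mem_closure_dominatedLeftIdeal hEstar hapg hx,
        mem_closure_dominatedLeftIdeal hEstar hapg (hEstar x hx)⟩
    | add x y _ _ hx hy =>
      rw [star_add]
      exact ⟨Ideal.add_mem _ hx.1 hy.1, Ideal.add_mem _ hx.2 hy.2⟩
    | zero => simp
    | mul x y _ _ hx hy =>
      rw [star_mul]
      exact ⟨Ideal.mul_mem_left _ _ hy.1, Ideal.mul_mem_left _ _ hx.2⟩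
    | smul r x _ hx =>
      rw [star_smul]
      exact ⟨complex_smul_mem_ideal _ _ hx.1, complex_smul_mem_ideal _ _ hx.2⟩
    | star x _ hx => exact ⟨hx.2, by simpa using hx.1⟩
  have hone : (1 : A) ∈ (dominatedLeftIdeal E).closure := by
    have h1 : (1 : A) ∈ closure (NonUnitalStarAlgebra.adjoin ℂ (E : Set A) : Set A) := by
      change (1 : A) ∈ (NonUnitalStarAlgebra.adjoin ℂ (E : Set A)).topologicalClosure
      rw [hgen]
      trivial
    exact closure_minimal (fun x hx => (hadj x hx).1) isClosed_closure h1
  have htop : dominatedLeftIdeal E = ⊤ := by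
    by_contra h
    exact (dominatedLeftIdeal E).closure_ne_top h ((Ideal.eq_top_iff_one _).2 hone)
  obtain ⟨e, heE, -, he⟩ := (Ideal.eq_top_iff_one _).1 htop
  exact ⟨e, heE, by simpa using he⟩

end OrderUnit

section Extension

variable {A : Type*} [CStarAlgebra A] [PartialOrder A] [StarOrderedRing A]

/-- The real cone of elements with nonnegative real part. -/
def nonnegRealPartCone (A : Type*) [CStarAlgebra A] [PartialOrder A] [StarOrderedRing A] :
    PointedCone ℝ A where
  carrier := {x | 0 ≤ x + star x}
  zero_mem' := by simp
  add_mem' := by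
    intro x y hx hy
    have h : x + y + star (x + y) = (x + star x) + (y + star y) := by
      rw [star_add]; abel
    change 0 ≤ x + y + star (x + y)
    rw [h]
    exact add_nonneg hx hy
  smul_mem' := by
    rintro ⟨c, hc⟩ x hx
    have h : c • x + star (c • x) = c • (x + star x) := by
      rw [star_smul, smul_add, star_trivial]
    change 0 ≤ c • x + star (c • x)
    rw [h]
    exact smul_nonneg hc hx

theorem mem_nonnegRealPartCone {x : A} : x ∈ nonnegRealPartCone A ↔ 0 ≤ x + star x := Iff.rfl

/-- A positive functional on a selfadjoint subspace containing an element which dominates the unit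
extends to a positive functional on the whole C⋆-algebra. -/
theorem exists_positive_extension_of_one_le (E : Submodule ℂ A) (hEstar : ∀ x ∈ E, star x ∈ E)
    {e : A} (heE : e ∈ E) (he : 1 ≤ e) (φ : E →ₗ[ℂ] ℂ)
    (hstar : ∀ (x : A) (hx : x ∈ E) (hsx : star x ∈ E),
      φ ⟨star x, hsx⟩ = starRingEnd ℂ (φ ⟨x, hx⟩))
    (hpos : ∀ (x : A) (hx : x ∈ E), 0 ≤ x → 0 ≤ φ ⟨x, hx⟩) :
    ∃ ψ : A →L[ℂ] ℂ, (∀ a : A, 0 ≤ a → 0 ≤ ψ a) ∧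
      ∀ (x : A) (hx : x ∈ E), ψ x = φ ⟨x, hx⟩ := by
  let f : A →ₗ.[ℝ] ℝ :=
    ⟨E.restrictScalars ℝ, Complex.reLm ∘ₗ (φ.restrictScalars ℝ)⟩
  have hf : ∀ x : f.domain, f x = (φ ⟨x, x.2⟩).re := fun _ => rfl
  obtain ⟨g, hgf, hg⟩ := riesz_extension (nonnegRealPartCone A) f
    (by
      rintro ⟨x, hx⟩ hxs
      rw [hf]
      have hx' : x ∈ E := hx
      have h := hpos _ (E.add_mem hx' (hEstar x hx')) hxs
      have h2 : φ ⟨x + star x, E.add_mem hx' (hEstar x hx')⟩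
          = φ ⟨x, hx'⟩ + starRingEnd ℂ (φ ⟨x, hx'⟩) := by
        rw [← hstar x hx' (hEstar x hx'), ← map_add]
        rfl
      rw [h2] at h
      have h3 := (Complex.le_def.1 h).1
      simp only [Complex.zero_re, Complex.add_re, Complex.conj_re] at h3
      change 0 ≤ (φ ⟨x, hx'⟩).re
      linarith)
    (by
      intro y
      refine ⟨⟨‖y + star y‖ • e, ?_⟩, ?_⟩
      · exact (E.restrictScalars ℝ).smul_mem _ heE
      · have hsa : IsSelfAdjoint (y + star y) := IsSelfAdjoint.add_star_self y
        have hese : star e = e := (IsSelfAdjoint.of_nonneg (zero_le_one.trans he)).star_eq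
        have h1 := hsa.neg_algebraMap_norm_le_self
        rw [Algebra.algebraMap_eq_smul_one] at h1
        have h2 : ‖y + star y‖ • (1 : A) ≤ ‖y + star y‖ • e :=
          smul_le_smul_of_nonneg_left he (norm_nonneg _)
        have h3 : 0 ≤ ‖y + star y‖ • e := smul_nonneg (norm_nonneg _) (zero_le_one.trans he)
        rw [mem_nonnegRealPartCone]
        have h4 : ‖y + star y‖ • e + y + star (‖y + star y‖ • e + y)
            = ‖y + star y‖ • e + (‖y + star y‖ • e + (y + star y)) := by
          rw [star_add, star_smul, hese, star_trivial ‖y + star y‖]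
          abel
        change 0 ≤ ‖y + star y‖ • e + y + star (‖y + star y‖ • e + y)
        rw [h4]
        exact add_nonneg h3 (neg_le_iff_add_nonneg'.1 ((neg_le_neg h2).trans h1)))
  have hskew : ∀ x : A, star x = -x → g x = 0 := by
    intro x hx
    refine le_antisymm ?_ (hg x (by simp [mem_nonnegRealPartCone, hx]))
    simpa using hg (-x) (by simp [mem_nonnegRealPartCone, hx])
  have hψpos : ∀ a : A, 0 ≤ a → 0 ≤ Module.Dual.extendRCLike (𝕜 := ℂ) g a := by
    intro a ha
    have has : star a = a := (IsSelfAdjoint.of_nonneg ha).star_eq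
    have h0 : g (Complex.I • a) = 0 := hskew _ (by simp [star_smul, has])
    rw [Module.Dual.extendRCLike_apply]
    have h1 : 0 ≤ g a := hg a (by
      rw [mem_nonnegRealPartCone, has]
      exact add_nonneg ha ha)
    simpa [h0] using h1
  let ψ : A →ₚ[ℂ] ℂ := PositiveLinearMap.mk₀ (Module.Dual.extendRCLike (𝕜 := ℂ) g) hψpos
  refine ⟨⟨Module.Dual.extendRCLike (𝕜 := ℂ) g, map_continuous ψ⟩, hψpos, ?_⟩
  intro x hx
  change Module.Dual.extendRCLike (𝕜 := ℂ) g x = _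
  have h1 : g x = (φ ⟨x, hx⟩).re := hgf ⟨x, hx⟩
  have h2 : g (Complex.I • x) = (φ (Complex.I • ⟨x, hx⟩)).re :=
    hgf ⟨Complex.I • x, E.smul_mem _ hx⟩
  rw [map_smul φ] at h2
  rw [Module.Dual.extendRCLike_apply]
  apply Complex.ext <;> simp [h1, h2]

end Extension

/-- **Theorem 4.4, scalar case.** Let `A` be a unital C*-algebra and let
`E ⊆ A` be a selfadjoint subspace which generates `A` and is approximately positively
generated.  Then every positive functional on `E` extends to a positive functional
on `A` (not necessarily of the same norm). -/
theorem stmt_9 {A : Type*} [CStarAlgebra A] [PartialOrder A] [StarOrderedRing A]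
    (E : Submodule ℂ A) (hEclosed : IsClosed (E : Set A)) (hEstar : ∀ x ∈ E, star x ∈ E)
    (hgen : (NonUnitalStarAlgebra.adjoin ℂ (E : Set A)).topologicalClosure = ⊤)
    (hapg : closure {y : A | ∃ p q : A, p ∈ E ∧ 0 ≤ p ∧ q ∈ E ∧ 0 ≤ q ∧ y = p - q} =
      {x : A | x ∈ E ∧ star x = x})
    (φ : E →L[ℂ] ℂ)
    (hstar : ∀ (x : A) (hx : x ∈ E) (hsx : star x ∈ E),
      φ ⟨star x, hsx⟩ = starRingEnd ℂ (φ ⟨x, hx⟩))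
    (hpos : ∀ (x : A) (hx : x ∈ E), 0 ≤ x → 0 ≤ φ ⟨x, hx⟩) :
    ∃ ψ : A →L[ℂ] ℂ, (∀ a : A, 0 ≤ a → 0 ≤ ψ a) ∧
      ∀ (x : A) (hx : x ∈ E), ψ x = φ ⟨x, hx⟩ := by
  obtain ⟨e, heE, he⟩ := exists_one_le_of_generates hEstar hgen hapg.ge
  exact exists_positive_extension_of_one_le E hEstar heE he φ.toLinearMap hstar hpos
end
end

section
/- Let A be a unital C*-algebra and let E ⊆ A be a selfadjoint subspace that generates A and is approximately positively generated (the closure of {p − q : p, q ∈ E₊} equals E_sa). Let K be a complex Hilbert space and let φ : E → B(K) be a completely bounded completely positive linear map. Then φ extends to a completely positive linear map Φ : A → B(K), i.e., Φ is continuous, Φ⁽ⁿ⁾ maps the positive cone of Mₙ(A) into the positive cone of Mₙ(B(K)) for every n, and Φ(x) = φ(x) for all x ∈ E. (The extension need not have the same cb-norm.) -/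
noncomputable section

/-- A selfadjoint, approximately positively generated subspace generating a unital C⋆-algebra
contains an element `p ≥ 1`: the left ideal of all `a` with `a⋆ * a` dominated by an element of `E`
is dense. -/
theorem exists_orderUnit_of_generates {A : Type*} [CStarAlgebra A] [PartialOrder A]
    [StarOrderedRing A] (E : Submodule ℂ A) (hEstar : ∀ x ∈ E, star x ∈ E)
    (hgen : (NonUnitalStarAlgebra.adjoin ℂ (E : Set A)).topologicalClosure = ⊤)
    (hapg : {x : A | x ∈ E ∧ star x = x} ⊆
      closure {y : A | ∃ p q : A, p ∈ E ∧ 0 ≤ p ∧ q ∈ E ∧ 0 ≤ q ∧ y = p - q}) :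
    ∃ p ∈ E, 1 ≤ p := by
  let I : Ideal A :=
    { carrier := {a | ∃ p ∈ E, star a * a ≤ p}
      zero_mem' := ⟨0, E.zero_mem, by simp⟩
      add_mem' := by
        rintro a b ⟨p, hp, hap⟩ ⟨q, hq, hbq⟩
        refine ⟨(2 : ℂ) • (p + q), E.smul_mem _ (E.add_mem hp hq), ?_⟩
        have h : 0 ≤ star (a - b) * (a - b) := star_mul_self_nonneg _
        have h' : star (a + b) * (a + b) =
            (2 : ℂ) • (star a * a + star b * b) - star (a - b) * (a - b) := by
          simp only [two_smul, star_add, star_sub]; noncomm_ring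
        rw [h']
        refine (sub_le_self _ h).trans ?_
        rw [two_smul, two_smul]
        exact add_le_add (add_le_add hap hbq) (add_le_add hap hbq)
      smul_mem' := by
        rintro x a ⟨p, hp, hap⟩
        refine ⟨((‖x‖ ^ 2 : ℝ) : ℂ) • p, E.smul_mem _ hp, ?_⟩
        have h := star_left_conjugate_le_conjugate
          (CStarAlgebra.star_mul_le_algebraMap_norm_sq (a := x)) a
        have h' : star a * (algebraMap ℝ A (‖x‖ ^ 2)) * a = (‖x‖ ^ 2) • (star a * a) := by
          rw [Algebra.algebraMap_eq_smul_one]; simp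
        rw [h'] at h
        rw [Complex.coe_smul, smul_eq_mul, star_mul]
        calc _ = star a * (star x * x) * a := by noncomm_ring
          _ ≤ _ := h
          _ ≤ _ := smul_le_smul_of_nonneg_left hap (by positivity) }
  have hpos : ∀ p ∈ E, 0 ≤ p → p ∈ I := by
    intro p hp h0
    have hs : CFC.sqrt p ∈ I := by
      refine ⟨p, hp, ?_⟩
      rw [(CFC.sqrt_nonneg p).isSelfAdjoint.star_eq, CFC.sqrt_mul_sqrt_self p]
    have := I.mul_mem_left (CFC.sqrt p) hs
    rwa [CFC.sqrt_mul_sqrt_self p] at this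
  have hsa : ∀ x ∈ E, star x = x → x ∈ I.closure := by
    intro x hx hsx
    refine closure_mono ?_ (hapg ⟨hx, hsx⟩)
    rintro _ ⟨p, q, hp, hp0, hq, hq0, rfl⟩
    exact I.sub_mem (hpos p hp hp0) (hpos q hq hq0)
  have hsmul : ∀ (c : ℂ) x, x ∈ I.closure → c • x ∈ I.closure := by
    intro c x hx
    rw [Algebra.smul_def]
    exact I.closure.mul_mem_left _ hx
  have hE : ∀ x ∈ E, x ∈ I.closure := by
    intro x hx
    have h1 := hsmul (1 / 2) _ (hsa (x + star x) (E.add_mem hx (hEstar x hx))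
      (by simp [add_comm]))
    have h2 := hsmul (-Complex.I / 2) _ (hsa (Complex.I • (x - star x))
      (E.smul_mem _ (E.sub_mem hx (hEstar x hx))) (by
        simp [smul_sub, neg_add_eq_sub]))
    convert I.closure.add_mem h1 h2 using 1
    rw [smul_smul, show -Complex.I / 2 * Complex.I = 1 / 2 by
      rw [div_mul_eq_mul_div, neg_mul, Complex.I_mul_I, neg_neg], ← smul_add]
    simp [← two_smul ℂ x, smul_smul]
  have hadj : ∀ x ∈ NonUnitalStarAlgebra.adjoin ℂ (E : Set A),
      x ∈ I.closure ∧ star x ∈ I.closure := by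
    intro x hx
    induction hx using NonUnitalStarAlgebra.adjoin_induction with
    | mem x hx => exact ⟨hE x hx, hE _ (hEstar x hx)⟩
    | zero => simp
    | add x y _ _ hx hy =>
      rw [star_add]
      exact ⟨I.closure.add_mem hx.1 hy.1, I.closure.add_mem hx.2 hy.2⟩
    | mul x y _ _ hx hy =>
      rw [star_mul]
      exact ⟨I.closure.mul_mem_left _ hy.1, I.closure.mul_mem_left _ hx.2⟩
    | smul c x _ hx =>
      rw [star_smul]
      exact ⟨hsmul _ _ hx.1, hsmul _ _ hx.2⟩
    | star x _ hx => simpa using hx.symm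
  have htop : I.closure = ⊤ := by
    rw [Ideal.eq_top_iff_one]
    have h1 : (1 : A) ∈ closure (NonUnitalStarAlgebra.adjoin ℂ (E : Set A) : Set A) := by
      change (1 : A) ∈ (NonUnitalStarAlgebra.adjoin ℂ (E : Set A)).topologicalClosure
      rw [hgen]; trivial
    exact closure_minimal (fun x hx => (hadj x hx).1) isClosed_closure h1
  have hI : I = ⊤ := by_contra fun h => I.closure_ne_top h htop
  obtain ⟨p, hp, h⟩ := (I.eq_top_iff_one.mp hI : ∃ p ∈ E, star (1 : A) * 1 ≤ p)
  exact ⟨p, hp, by simpa using h⟩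

/-- A selfadjoint matrix over a C⋆-algebra is positive if its quadratic form is. -/
theorem nonneg_of_matrix_form_nonneg {A : Type*} [CStarAlgebra A] [PartialOrder A]
    [StarOrderedRing A] {n : ℕ} {M : Type*} [NonUnitalCStarAlgebra M] [PartialOrder M]
    [StarOrderedRing M] (e : Matrix (Fin n) (Fin n) A ≃⋆ₐ[ℂ] M) {Z : Matrix (Fin n) (Fin n) A}
    (hZ : star Z = Z)
    (h : ∀ v : Fin n → A, 0 ≤ ∑ i, ∑ j, star (v i) * Z i j * v j) : 0 ≤ e Z := by
  have hsa : IsSelfAdjoint (e Z) := by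
    rw [IsSelfAdjoint, ← map_star, hZ]
  obtain ⟨t, ht⟩ := CStarAlgebra.nonneg_iff_eq_star_mul_self.mp (CFC.negPart_nonneg (e Z))
  set q := (e Z)⁻ with hq
  have hqsa : star q = q := (CFC.negPart_nonneg (e Z)).isSelfAdjoint.star_eq
  have hqZq : star (t * q) * (t * q) = -(q * e Z * q) := by
    have hpq : q * (e Z)⁺ = 0 := CFC.negPart_mul_posPart _
    have : e Z = (e Z)⁺ - q := (CFC.posPart_sub_negPart (e Z)).symm
    rw [this, mul_sub, hpq, star_mul, hqsa, zero_sub, neg_mul, neg_neg]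
    nth_rw 4 [ht]
    simp only [mul_assoc]
  obtain ⟨Q, hQ⟩ : ∃ Q, e Q = q := EquivLike.surjective e q
  obtain ⟨T, hT⟩ : ∃ T, e T = t := EquivLike.surjective e t
  have hQsa : star Q = Q := EquivLike.injective e (by rw [map_star, hQ, hqsa])
  have hmat : star (T * Q) * (T * Q) = -(star Q * Z * Q) := by
    apply EquivLike.injective e
    simp only [map_mul, map_star, map_neg, hT, hQ, hqsa, hqZq]
  have hTQ : T * Q = 0 := by
    ext k j
    have h1 := h fun i => Q i j
    have h2 : ∑ i, ∑ l, star (Q i j) * Z i l * Q l j = (star Q * Z * Q) j j := by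
      simp only [Matrix.mul_apply, Matrix.star_apply, Finset.sum_mul]
      exact Finset.sum_comm
    have h3 : (star (T * Q) * (T * Q)) j j = ∑ k, star ((T * Q) k j) * (T * Q) k j := by
      simp only [Matrix.mul_apply (M := star (T * Q)), Matrix.star_apply]
    rw [h2, ← neg_nonpos, ← Matrix.neg_apply, ← hmat, h3] at h1
    have h4 := (Finset.sum_eq_zero_iff_of_nonneg
      (fun k _ => star_mul_self_nonneg ((T * Q) k j))).mp
      (le_antisymm h1 (Finset.sum_nonneg fun k _ => star_mul_self_nonneg _)) k (Finset.mem_univ _)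
    simpa using CStarRing.star_mul_self_eq_zero_iff _ |>.mp h4
  have hq0 : q = 0 := by
    have htq : t * q = 0 := by rw [← hT, ← hQ, ← map_mul, hTQ, map_zero]
    have : q * star q = 0 := by
      rw [hqsa]; nth_rw 1 [ht]; rw [mul_assoc, htq, mul_zero]
    exact (CStarRing.mul_star_self_eq_zero_iff q).mp this
  have := CFC.posPart_sub_negPart (e Z)
  rw [← hq, hq0, sub_zero] at this
  rw [← this]
  exact CFC.posPart_nonneg _

theorem exists_eq_star_mul_self_of_nonneg {A : Type*} [Ring A] [StarRing A] [Algebra ℂ A]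
    {n : ℕ} {M : Type*} [NonUnitalCStarAlgebra M] [PartialOrder M]
    [StarOrderedRing M] (e : Matrix (Fin n) (Fin n) A ≃⋆ₐ[ℂ] M) {X : M} (hX : 0 ≤ X) :
    ∃ Y, e.symm X = star Y * Y := by
  obtain ⟨y, rfl⟩ := CStarAlgebra.nonneg_iff_eq_star_mul_self.mp hX
  exact ⟨e.symm y, by rw [map_mul, map_star]⟩
open scoped InnerProductSpace ComplexConjugate

/-- The `A`-valued quadratic form `X ↦ ∑ i j, (v i)⋆ * X i j * v j` of a finitely supported
matrix `X` over `A`, as a linear map in `X`. -/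
def finsuppForm {A ι : Type*} [Ring A] [Algebra ℂ A] [StarRing A] (v : ι → A) :
    (ι × ι →₀ A) →ₗ[ℂ] A :=
  Finsupp.lsum ℂ fun ij =>
    LinearMap.mulRight ℂ (v ij.2) ∘ₗ LinearMap.mulLeft ℂ (star (v ij.1))

theorem finsuppForm_single {A ι : Type*} [Ring A] [Algebra ℂ A] [StarRing A]
    (v : ι → A) (i j : ι) (a : A) :
    finsuppForm v (Finsupp.single (i, j) a) = star (v i) * a * v j := by
  simp [finsuppForm]

section

variable {A ι : Type*} [CStarAlgebra A] [PartialOrder A] [StarOrderedRing A]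

/-- The cone of finitely supported matrices whose real part is positive. -/
def accretiveCone (A ι : Type*) [CStarAlgebra A] [PartialOrder A] [StarOrderedRing A] :
    PointedCone ℝ (ι × ι →₀ A) where
  carrier := {X | ∀ v : ι → A, 0 ≤ finsuppForm v X + star (finsuppForm v X)}
  zero_mem' v := by simp
  add_mem' {X Y} hX hY v := by
    rw [map_add, star_add, add_add_add_comm]
    exact add_nonneg (hX v) (hY v)
  smul_mem' c X hX v := by
    have h : finsuppForm v (c • X) = (c : ℝ) • finsuppForm v X :=
      ((finsuppForm v).restrictScalars ℝ).map_smul (c : ℝ) X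
    rw [h, star_smul, star_trivial, ← smul_add]
    exact smul_nonneg c.2 (hX v)

theorem cross_term_nonneg (a x y : A) :
    0 ≤ star x * x + (‖a‖ ^ 2) • (star y * y) + (star x * a * y + star y * star a * x) := by
  have h := star_left_conjugate_le_conjugate
    (CStarAlgebra.star_mul_le_algebraMap_norm_sq (a := a)) y
  have h' : star y * (algebraMap ℝ A (‖a‖ ^ 2)) * y = (‖a‖ ^ 2) • (star y * y) := by
    rw [Algebra.algebraMap_eq_smul_one]; simp
  rw [h'] at h
  calc 0 ≤ star (x + a * y) * (x + a * y) := star_mul_self_nonneg _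
    _ = star x * x + star y * (star a * a) * y + (star x * a * y + star y * star a * x) := by
      simp only [star_add, star_mul]; noncomm_ring
    _ ≤ _ := by gcongr

theorem star_mul_self_le_conjugate {p : A} (hp : 1 ≤ p) (x : A) :
    star x * x ≤ star x * p * x := by
  simpa using star_left_conjugate_le_conjugate hp x

theorem exists_add_mem_accretiveCone (E : Submodule ℂ A) {p : A} (hpE : p ∈ E) (hp : 1 ≤ p)
    (X : ι × ι →₀ A) : ∃ Y : ι × ι →₀ A, (∀ ij, Y ij ∈ E) ∧ Y + X ∈ accretiveCone A ι := by
  induction X using Finsupp.induction_linear with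
  | zero => exact ⟨0, by simp, by simp⟩
  | add X₁ X₂ h₁ h₂ =>
    obtain ⟨Y₁, hY₁, h₁⟩ := h₁
    obtain ⟨Y₂, hY₂, h₂⟩ := h₂
    refine ⟨Y₁ + Y₂, fun ij => E.add_mem (hY₁ ij) (hY₂ ij), ?_⟩
    rw [add_add_add_comm]
    exact add_mem h₁ h₂
  | single ij a =>
    obtain ⟨i, j⟩ := ij
    have hsingle : ∀ (k : ι × ι) (x : A), x ∈ E → ∀ l, Finsupp.single k x l ∈ E := by
      classical
      intro k x hx l
      rw [Finsupp.single_apply]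
      split_ifs
      exacts [hx, E.zero_mem]
    have hcE : ((‖a‖ ^ 2 : ℝ) : ℂ) • p ∈ E := E.smul_mem _ hpE
    refine ⟨Finsupp.single (i, i) p + Finsupp.single (j, j) (((‖a‖ ^ 2 : ℝ) : ℂ) • p),
      fun l => E.add_mem (hsingle _ _ hpE l) (hsingle _ _ hcE l), fun v => ?_⟩
    have hp0 : star p = p := (zero_le_one.trans hp).isSelfAdjoint.star_eq
    have hi := star_mul_self_le_conjugate hp (v i)
    have hj := smul_le_smul_of_nonneg_left (star_mul_self_le_conjugate hp (v j))
      (sq_nonneg ‖a‖)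
    have hi0 := (star_mul_self_nonneg (v i)).trans hi
    have hj0 : 0 ≤ (‖a‖ ^ 2) • (star (v j) * p * v j) :=
      (smul_nonneg (sq_nonneg ‖a‖) (star_mul_self_nonneg (v j))).trans hj
    simp only [map_add, finsuppForm_single, Complex.coe_smul, mul_smul_comm, smul_mul_assoc,
      star_add, star_mul, star_smul, star_star, star_trivial, hp0]
    calc 0 ≤ (star (v i) * v i + (‖a‖ ^ 2) • (star (v j) * v j) +
          (star (v i) * a * v j + star (v j) * star a * v i)) +
          (star (v i) * p * v i + (‖a‖ ^ 2) • (star (v j) * p * v j)) :=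
        add_nonneg (cross_term_nonneg a (v i) (v j)) (add_nonneg hi0 hj0)
      _ ≤ (star (v i) * p * v i + (‖a‖ ^ 2) • (star (v j) * p * v j) +
          (star (v i) * a * v j + star (v j) * star a * v i)) +
          (star (v i) * p * v i + (‖a‖ ^ 2) • (star (v j) * p * v j)) := by gcongr
      _ = _ := by simp only [mul_assoc]; abel

theorem exists_extension_of_nonneg_accretiveCone (E : Submodule ℂ A) {p : A} (hpE : p ∈ E)
    (hp : 1 ≤ p) (s : (ι × ι →₀ A) →ₗ[ℂ] ℂ)
    (hs : ∀ X ∈ accretiveCone A ι, (∀ ij, X ij ∈ E) → 0 ≤ (s X).re) :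
    ∃ G : (ι × ι →₀ A) →ₗ[ℂ] ℂ, (∀ X, (∀ ij, X ij ∈ E) → G X = s X) ∧
      ∀ X ∈ accretiveCone A ι, 0 ≤ (G X).re := by
  let W : Submodule ℝ (ι × ι →₀ A) :=
    { carrier := {X | ∀ ij, X ij ∈ E}
      zero_mem' := fun _ => E.zero_mem
      add_mem' := fun hX hY ij => E.add_mem (hX ij) (hY ij)
      smul_mem' := fun c X hX ij => E.smul_mem (c : ℂ) (hX ij) }
  let σ : (ι × ι →₀ A) →ₗ[ℝ] ℝ := Complex.reLm ∘ₗ s.restrictScalars ℝ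
  obtain ⟨g, hg, hgpos⟩ := riesz_extension (accretiveCone A ι) ⟨W, σ.domRestrict W⟩
    (fun X hX => hs X hX X.2) (fun X => by
      obtain ⟨Y, hY, h⟩ := exists_add_mem_accretiveCone E hpE hp X
      exact ⟨⟨Y, hY⟩, h⟩)
  have hgs : ∀ X, (∀ ij, X ij ∈ E) → g X = (s X).re := fun X hX => hg ⟨X, hX⟩
  refine ⟨Module.Dual.extendRCLike (𝕜 := ℂ) g, fun X hX => ?_, fun X hX => ?_⟩
  · rw [Module.Dual.extendRCLike_apply, hgs X hX, hgs _ fun ij => E.smul_mem _ (hX ij)]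
    apply Complex.ext <;> simp
  · exact (hgpos X hX).trans_eq (Module.Dual.re_extendRCLike_apply (𝕜 := ℂ) g X).symm

theorem map_eq_conj_of_finsuppForm_eq_star {G : (ι × ι →₀ A) →ₗ[ℂ] ℂ}
    (hG : ∀ X ∈ accretiveCone A ι, 0 ≤ (G X).re) {X Y : ι × ι →₀ A}
    (h : ∀ v, finsuppForm v X = star (finsuppForm v Y)) : G X = conj (G Y) := by
  have key : ∀ X Y : ι × ι →₀ A, (∀ v, finsuppForm v X = star (finsuppForm v Y)) →
      (G X).re = (G Y).re := by
    intro X Y h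
    have h1 := hG (X - Y) fun v => by simp [h]
    have h2 := hG (Y - X) fun v => by simp [h]
    simp only [map_sub, Complex.sub_re] at h1 h2
    linarith
  have h1 := key X Y h
  have h2 := key (Complex.I • X) (-(Complex.I • Y)) fun v => by simp [h]
  simp only [map_smul, map_neg, smul_eq_mul, Complex.neg_re, Complex.I_mul_re, neg_neg] at h2
  apply Complex.ext
  · simpa using h1
  · simp [← h2]

end

/-- The finitely supported matrix with entries `conj (ξ i) * η j • a`, where `ξ i` and `η j` are
the coordinates in the basis `b`. -/
def outerMatrix {A ι K : Type*} [AddCommGroup A] [Module ℂ A] [AddCommGroup K] [Module ℂ K]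
    (b : Module.Basis ι ℂ K) (a : A) (ξ η : K) : ι × ι →₀ A :=
  Finsupp.onFinset ((b.repr ξ).support ×ˢ (b.repr η).support)
    (fun ij => (conj (b.repr ξ ij.1) * b.repr η ij.2) • a) fun ij h => by
      rw [Finset.mem_product, Finsupp.mem_support_iff, Finsupp.mem_support_iff]
      constructor <;> intro h0 <;> simp [h0] at h

section

variable {A ι K : Type*} [AddCommGroup A] [Module ℂ A] [AddCommGroup K] [Module ℂ K]
  (b : Module.Basis ι ℂ K)

@[simp]
theorem outerMatrix_apply (a : A) (ξ η : K) (ij : ι × ι) :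
    outerMatrix b a ξ η ij = (conj (b.repr ξ ij.1) * b.repr η ij.2) • a := rfl

theorem outerMatrix_add_coeff (a a' : A) (ξ η : K) :
    outerMatrix b (a + a') ξ η = outerMatrix b a ξ η + outerMatrix b a' ξ η := by
  ext ij; simp

theorem outerMatrix_smul_coeff (c : ℂ) (a : A) (ξ η : K) :
    outerMatrix b (c • a) ξ η = c • outerMatrix b a ξ η := by
  ext ij; simp only [outerMatrix_apply, Finsupp.smul_apply, smul_smul]; ring_nf

theorem outerMatrix_add_left (a : A) (ξ ξ' η : K) :
    outerMatrix b a (ξ + ξ') η = outerMatrix b a ξ η + outerMatrix b a ξ' η := by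
  ext ij; simp [add_mul, add_smul]

theorem outerMatrix_smul_left (c : ℂ) (a : A) (ξ η : K) :
    outerMatrix b a (c • ξ) η = conj c • outerMatrix b a ξ η := by
  ext ij; simp [smul_smul, mul_assoc]

theorem outerMatrix_add_right (a : A) (ξ η η' : K) :
    outerMatrix b a ξ (η + η') = outerMatrix b a ξ η + outerMatrix b a ξ η' := by
  ext ij; simp [mul_add, add_smul]

theorem outerMatrix_smul_right (c : ℂ) (a : A) (ξ η : K) :
    outerMatrix b a ξ (c • η) = c • outerMatrix b a ξ η := by
  ext ij; simp only [outerMatrix_apply, map_smul, Finsupp.smul_apply, smul_eq_mul, smul_smul]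
  ring_nf

theorem lsum_outerMatrix {R : Type*} [AddCommGroup R] [Module ℂ R] (h : ι × ι → A →ₗ[ℂ] R)
    (a : A) (ξ η : K) :
    Finsupp.lsum ℂ h (outerMatrix b a ξ η) = ∑ i ∈ (b.repr ξ).support, ∑ j ∈ (b.repr η).support,
      (conj (b.repr ξ i) * b.repr η j) • h (i, j) a := by
  rw [Finsupp.lsum_apply, outerMatrix, Finsupp.onFinset_sum _ (by simp), Finset.sum_product]
  simp

end

theorem finsuppForm_outerMatrix {A ι K : Type*} [Ring A] [Algebra ℂ A] [StarRing A]
    [StarModule ℂ A] [AddCommGroup K] [Module ℂ K] (b : Module.Basis ι ℂ K) (v : ι → A) (a : A)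
    (ξ η : K) :
    finsuppForm v (outerMatrix b a ξ η) = star (b.constr ℂ v ξ) * a * b.constr ℂ v η := by
  rw [finsuppForm, lsum_outerMatrix, b.constr_apply, b.constr_apply, Finsupp.sum, Finsupp.sum,
    star_sum, Finset.sum_mul, Finset.sum_mul]
  refine Finset.sum_congr rfl fun i _ => ?_
  rw [Finset.mul_sum]
  refine Finset.sum_congr rfl fun j _ => ?_
  simp [smul_smul, mul_comm]

theorem lsum_inner_outerMatrix {A ι K : Type*} [AddCommGroup A] [Module ℂ A]
    [NormedAddCommGroup K] [InnerProductSpace ℂ K] (b : Module.Basis ι ℂ K)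
    (φ : A →ₗ[ℂ] K →L[ℂ] K) (a : A) (ξ η : K) :
    Finsupp.lsum ℂ (fun ij : ι × ι => (innerₛₗ ℂ (b ij.1)) ∘ₗ
      ((ContinuousLinearMap.apply ℂ K (b ij.2)).toLinearMap) ∘ₗ φ) (outerMatrix b a ξ η) =
      ⟪ξ, φ a η⟫_ℂ := by
  rw [lsum_outerMatrix]
  conv_rhs => rw [← b.linearCombination_repr ξ, ← b.linearCombination_repr η,
    Finsupp.linearCombination_apply, Finsupp.linearCombination_apply, Finsupp.sum, Finsupp.sum]
  simp only [map_sum, sum_inner, inner_sum, map_smul, inner_smul_left, inner_smul_right,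
    Finset.mul_sum]
  rw [Finset.sum_comm]
  refine Finset.sum_congr rfl fun j _ => Finset.sum_congr rfl fun i _ => ?_
  simp [mul_assoc, mul_left_comm]

theorem norm_sq_le_of_forall_re_nonneg {z : ℂ} {P Q : ℝ}
    (h : ∀ w : ℂ, 0 ≤ P + ‖w‖ ^ 2 * Q + 2 * (w * z).re) : ‖z‖ ^ 2 ≤ P * Q := by
  have h1 : ∀ t : ℝ, 0 ≤ (‖z‖ ^ 2 * Q) * (t * t) + (2 * ‖z‖ ^ 2) * t + P := by
    intro t
    have := h (t * conj z)
    rw [mul_assoc, Complex.conj_mul', norm_mul, Complex.norm_real, RCLike.norm_conj, mul_pow,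
      Real.norm_eq_abs, sq_abs, ← Complex.ofReal_pow, ← Complex.ofReal_mul,
      Complex.ofReal_re] at this
    linarith
  have h2 := discrim_le_zero h1
  rw [discrim] at h2
  rcases eq_or_ne z 0 with rfl | hz
  · have hP := h 0
    simp only [norm_zero, mul_zero, Complex.zero_re] at hP
    have hQ : ∀ t : ℝ, 0 ≤ P + t ^ 2 * Q := fun t => by simpa using h t
    have := discrim_le_zero (a := Q) (b := 0) (c := P) fun t => by nlinarith [hQ t]
    rw [discrim] at this
    simp; linarith
  · have : 0 < ‖z‖ ^ 2 := by positivity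
    nlinarith

theorem exists_embedding_support_subset {ι A : Type*} [AddCommMonoid A] (X : ι × ι →₀ A) :
    ∃ (n : ℕ) (r : Fin n ↪ ι), X.support ⊆ Finset.univ.map (r.prodMap r) := by
  classical
  let F : Finset ι := X.support.image Prod.fst ∪ X.support.image Prod.snd
  have hF : ∀ i ∈ F, ∃ k, (F.equivFin.symm k : ι) = i := fun i hi =>
    ⟨F.equivFin ⟨i, hi⟩, by simp⟩
  refine ⟨F.card, F.equivFin.symm.toEmbedding.trans (Function.Embedding.subtype _), ?_⟩
  rintro ⟨i, j⟩ hij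
  obtain ⟨k, hk⟩ := hF i (Finset.mem_union_left _ (Finset.mem_image_of_mem Prod.fst hij))
  obtain ⟨l, hl⟩ := hF j (Finset.mem_union_right _ (Finset.mem_image_of_mem Prod.snd hij))
  exact Finset.mem_map.mpr ⟨(k, l), Finset.mem_univ _, Prod.ext hk hl⟩

theorem lsum_eq_sum_of_support_subset {ι A R : Type*} [AddCommMonoid A] [Module ℂ A]
    [AddCommMonoid R] [Module ℂ R] {X : ι × ι →₀ A} {n : ℕ} {r : Fin n ↪ ι}
    (hr : X.support ⊆ Finset.univ.map (r.prodMap r)) (h : ι × ι → A →ₗ[ℂ] R) :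
    Finsupp.lsum ℂ h X = ∑ k, ∑ l, h (r k, r l) (X (r k, r l)) := by
  rw [Finsupp.lsum_apply, Finsupp.sum_of_support_subset _ hr _ (by simp), Finset.sum_map,
    Fintype.sum_prod_type]
  rfl

theorem exists_continuousLinearMap_of_sesquilinear {A K : Type*} [NormedAddCommGroup A]
    [NormedSpace ℂ A] [NormedAddCommGroup K] [InnerProductSpace ℂ K] [CompleteSpace K]
    (B : A → K → K → ℂ)
    (hadd : ∀ a a' ξ η, B (a + a') ξ η = B a ξ η + B a' ξ η)
    (hsmul : ∀ (c : ℂ) a ξ η, B (c • a) ξ η = c * B a ξ η)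
    (hadd_left : ∀ a ξ ξ' η, B a (ξ + ξ') η = B a ξ η + B a ξ' η)
    (hsmul_left : ∀ (c : ℂ) a ξ η, B a (c • ξ) η = conj c * B a ξ η)
    (hadd_right : ∀ a ξ η η', B a ξ (η + η') = B a ξ η + B a ξ η')
    (hsmul_right : ∀ (c : ℂ) a ξ η, B a ξ (c • η) = c * B a ξ η)
    {C : ℝ} (hC : 0 ≤ C) (hB : ∀ a ξ η, ‖B a ξ η‖ ≤ C * ‖a‖ * ‖ξ‖ * ‖η‖) :
    ∃ Φ : A →L[ℂ] K →L[ℂ] K, ∀ a ξ η, ⟪ξ, Φ a η⟫_ℂ = B a ξ η := by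
  let S : A → K →L⋆[ℂ] K →L[ℂ] ℂ := fun a =>
    LinearMap.mkContinuous₂ (LinearMap.mk₂'ₛₗ (starRingEnd ℂ) (RingHom.id ℂ) (B a)
      (hadd_left a) (fun c => hsmul_left c a) (hadd_right a) fun c => hsmul_right c a)
      (C * ‖a‖) (hB a)
  let T : A → K →L[ℂ] K := fun a =>
    ContinuousLinearMap.adjoint (InnerProductSpace.continuousLinearMapOfBilin (S a))
  have hT : ∀ a ξ η, ⟪ξ, T a η⟫_ℂ = B a ξ η := fun a ξ η => by
    rw [ContinuousLinearMap.adjoint_inner_right,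
      InnerProductSpace.continuousLinearMapOfBilin_apply]
    rfl
  let L : A →ₗ[ℂ] K →L[ℂ] K :=
    { toFun := T
      map_add' := fun a a' => by
        ext η
        refine ext_inner_left ℂ fun ξ => ?_
        rw [hT, add_apply, inner_add_right, hT, hT, hadd]
      map_smul' := fun c a => by
        ext η
        refine ext_inner_left ℂ fun ξ => ?_
        rw [hT, RingHom.id_apply, smul_apply, inner_smul_right, hT, hsmul] }
  refine ⟨L.mkContinuous C fun a => ?_, hT⟩
  refine ContinuousLinearMap.opNorm_le_of_re_inner_le (𝕜 := ℂ) (by positivity)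
    fun η ξ hη hξ => ?_
  rw [← inner_conj_symm]
  calc RCLike.re (conj ⟪ξ, L a η⟫_ℂ) ≤ ‖conj ⟪ξ, L a η⟫_ℂ‖ := RCLike.re_le_norm _
    _ = ‖B a ξ η‖ := by rw [RCLike.norm_conj]; exact congrArg _ (hT a ξ η)
    _ ≤ C * ‖a‖ := by simpa [hη, hξ] using hB a ξ η

section

variable {A K : Type*} [CStarAlgebra A] [PartialOrder A] [StarOrderedRing A]
  [NormedAddCommGroup K] [InnerProductSpace ℂ K] [CompleteSpace K]

theorem re_lsum_inner_nonneg {ι : Type*} (b : ι → K) (E : Submodule ℂ A)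
    (hEstar : ∀ x ∈ E, star x ∈ E) (φ : A →ₗ[ℂ] K →L[ℂ] K)
    (hφstar : ∀ x ∈ E, φ (star x) = star (φ x))
    (hφ : ∀ (n : ℕ) (Z : Matrix (Fin n) (Fin n) A), (∀ k l, Z k l ∈ E) → star Z = Z →
      (∀ w : Fin n → A, 0 ≤ ∑ k, ∑ l, star (w k) * Z k l * w l) →
      ∀ ξ : Fin n → K, 0 ≤ (∑ k, ∑ l, ⟪ξ k, φ (Z k l) (ξ l)⟫_ℂ).re)
    {X : ι × ι →₀ A} (hX : X ∈ accretiveCone A ι) (hXE : ∀ ij, X ij ∈ E) :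
    0 ≤ (Finsupp.lsum ℂ (fun ij : ι × ι => (innerₛₗ ℂ (b ij.1)) ∘ₗ
      ((ContinuousLinearMap.apply ℂ K (b ij.2)).toLinearMap) ∘ₗ φ) X).re := by
  obtain ⟨n, r, hr⟩ := exists_embedding_support_subset X
  rw [lsum_eq_sum_of_support_subset hr]
  have h := hφ n (Matrix.of fun k l => X (r k, r l) + star (X (r l, r k)))
    (fun k l => E.add_mem (hXE _) (hEstar _ (hXE _)))
    (by ext k l; simp [Matrix.star_apply, add_comm])
    (fun w => by
      have h := hX (Function.extend r w 0)
      rw [finsuppForm, lsum_eq_sum_of_support_subset hr] at h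
      simp only [star_sum, LinearMap.comp_apply, LinearMap.mulLeft_apply,
        LinearMap.mulRight_apply, r.injective.extend_apply] at h
      nth_rw 2 [Finset.sum_comm] at h
      simpa only [← Finset.sum_add_distrib, Matrix.of_apply, mul_add, add_mul, star_mul,
        star_star, mul_assoc] using h)
    (fun k => b (r k))
  have h2 : ∑ k, ∑ l, ⟪b (r k), φ (star (X (r l, r k))) (b (r l))⟫_ℂ =
      conj (∑ k, ∑ l, ⟪b (r k), φ (X (r k, r l)) (b (r l))⟫_ℂ) := by
    simp only [map_sum]
    rw [Finset.sum_comm]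
    refine Finset.sum_congr rfl fun k _ => Finset.sum_congr rfl fun l _ => ?_
    rw [hφstar _ (hXE _), ContinuousLinearMap.star_eq_adjoint,
      ContinuousLinearMap.adjoint_inner_right, inner_conj_symm]
  simp only [Matrix.of_apply, map_add, add_apply, inner_add_right,
    Finset.sum_add_distrib, h2, Complex.add_re, Complex.conj_re] at h
  simp only [LinearMap.comp_apply, innerₛₗ_apply_apply, ContinuousLinearMap.coe_coe,
    ContinuousLinearMap.apply_apply]
  linarith

/-- **Arveson's extension theorem**, for a selfadjoint subspace containing an element `p ≥ 1`, with
complete positivity expressed through quadratic forms. -/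
theorem exists_completelyPositive_extension (E : Submodule ℂ A)
    (hEstar : ∀ x ∈ E, star x ∈ E) {p : A} (hpE : p ∈ E) (hp : 1 ≤ p) (φ : A →ₗ[ℂ] K →L[ℂ] K)
    (hφstar : ∀ x ∈ E, φ (star x) = star (φ x))
    (hφ : ∀ (n : ℕ) (Z : Matrix (Fin n) (Fin n) A), (∀ k l, Z k l ∈ E) → star Z = Z →
      (∀ w : Fin n → A, 0 ≤ ∑ k, ∑ l, star (w k) * Z k l * w l) →
      ∀ ξ : Fin n → K, 0 ≤ (∑ k, ∑ l, ⟪ξ k, φ (Z k l) (ξ l)⟫_ℂ).re) :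
    ∃ Φ : A →L[ℂ] K →L[ℂ] K, (∀ x ∈ E, Φ x = φ x) ∧ (∀ a, Φ (star a) = star (Φ a)) ∧
      ∀ (n : ℕ) (Z : Matrix (Fin n) (Fin n) A),
      (∀ w : Fin n → A, 0 ≤ ∑ k, ∑ l, star (w k) * Z k l * w l) →
      ∀ ξ : Fin n → K, 0 ≤ (∑ k, ∑ l, ⟪ξ k, Φ (Z k l) (ξ l)⟫_ℂ).re := by
  let b := Module.Basis.ofVectorSpace ℂ K
  obtain ⟨G, hGE, hG⟩ := exists_extension_of_nonneg_accretiveCone E hpE hp _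
    fun X hX hXE => re_lsum_inner_nonneg b E hEstar φ hφstar hφ hX hXE
  have hB : ∀ a ξ η, ‖G (outerMatrix b a ξ η)‖ ≤ ‖φ p‖ * ‖a‖ * ‖ξ‖ * ‖η‖ := by
    intro a ξ η
    have hpp : ∀ ζ, (G (outerMatrix b p ζ ζ)).re ≤ ‖φ p‖ * ‖ζ‖ ^ 2 := by
      intro ζ
      rw [hGE _ fun ij => E.smul_mem _ hpE, lsum_inner_outerMatrix]
      calc _ ≤ ‖⟪ζ, φ p ζ⟫_ℂ‖ := Complex.re_le_norm _
        _ ≤ ‖ζ‖ * ‖φ p ζ‖ := norm_inner_le_norm _ _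
        _ ≤ ‖ζ‖ * (‖φ p‖ * ‖ζ‖) := by gcongr; exact (φ p).le_opNorm ζ
        _ = _ := by ring
    refine abs_le_of_sq_le_sq' ?_ (by positivity) |>.2
    have hp0 : star p = p := (zero_le_one.trans hp).isSelfAdjoint.star_eq
    refine (norm_sq_le_of_forall_re_nonneg (P := ‖φ p‖ * ‖ξ‖ ^ 2)
      (Q := ‖a‖ ^ 2 * (‖φ p‖ * ‖η‖ ^ 2)) fun w => ?_).trans_eq (by ring)
    have h := hG (outerMatrix b p ξ ξ + ((‖a‖ ^ 2 : ℝ) : ℂ) • outerMatrix b p (w • η) (w • η) +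
      (2 : ℂ) • outerMatrix b a ξ (w • η)) fun v => by
        set x := b.constr ℂ v ξ with hx
        set y := b.constr ℂ v (w • η) with hy
        have hi := star_mul_self_le_conjugate hp x
        have hj := smul_le_smul_of_nonneg_left (star_mul_self_le_conjugate hp y)
          (sq_nonneg ‖a‖)
        have h := cross_term_nonneg a x y
        have h2 : 0 ≤ star x * p * x + (‖a‖ ^ 2) • (star y * p * y) +
            (star x * a * y + star y * star a * x) := h.trans (by gcongr)
        refine (add_nonneg h2 h2).trans_eq ?_
        simp only [map_add, map_smul (finsuppForm v), finsuppForm_outerMatrix, ← hx, ← hy]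
        simp only [Complex.coe_smul, star_add, star_mul, star_smul, star_star, star_trivial, hp0,
          two_smul, mul_assoc]
        abel
    simp only [map_add, map_smul, outerMatrix_smul_right, outerMatrix_smul_left b w,
      Complex.add_re, smul_eq_mul] at h
    have h1 := hpp ξ
    have h2 := mul_le_mul_of_nonneg_left (hpp η) (by positivity : 0 ≤ ‖w‖ ^ 2 * ‖a‖ ^ 2)
    have h3 : (((‖a‖ ^ 2 : ℝ) : ℂ) * (conj w * (w * G (outerMatrix b p η η)))).re =
        ‖w‖ ^ 2 * ‖a‖ ^ 2 * (G (outerMatrix b p η η)).re := by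
      rw [← mul_assoc (conj w), Complex.conj_mul', ← Complex.ofReal_pow, ← mul_assoc,
        ← Complex.ofReal_mul, Complex.re_ofReal_mul, mul_comm (‖a‖ ^ 2)]
    have h4 : (2 * (w * G (outerMatrix b a ξ η))).re = 2 * (w * G (outerMatrix b a ξ η)).re := by
      simp
    rw [h3, h4] at h
    linarith
  obtain ⟨Φ, hΦ⟩ := exists_continuousLinearMap_of_sesquilinear
    (fun a ξ η => G (outerMatrix b a ξ η))
    (by simp [outerMatrix_add_coeff]) (by simp [outerMatrix_smul_coeff])
    (by simp [outerMatrix_add_left]) (by simp [outerMatrix_smul_left])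
    (by simp [outerMatrix_add_right]) (by simp [outerMatrix_smul_right]) (norm_nonneg (φ p)) hB
  refine ⟨Φ, fun x hx => ?_, fun a => ?_, fun n Z hZ ξ => ?_⟩
  · ext η
    refine ext_inner_left ℂ fun ξ => ?_
    rw [hΦ, hGE _ fun ij => E.smul_mem _ hx, lsum_inner_outerMatrix]
  · ext η
    refine ext_inner_left ℂ fun ξ => ?_
    rw [ContinuousLinearMap.star_eq_adjoint, ContinuousLinearMap.adjoint_inner_right,
      ← inner_conj_symm (Φ a ξ) η, hΦ, hΦ]
    exact map_eq_conj_of_finsuppForm_eq_star hG fun v => by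
      simp [finsuppForm_outerMatrix, mul_assoc]
  · simp only [hΦ, ← map_sum]
    refine hG _ fun v => ?_
    simp only [map_sum, finsuppForm_outerMatrix]
    have h := hZ fun k => b.constr ℂ v (ξ k)
    exact add_nonneg h (star_nonneg_iff.mpr h)

end

theorem re_sum_inner_nonneg_of_nonneg {K N : Type*} [NormedAddCommGroup K]
    [InnerProductSpace ℂ K] [CompleteSpace K] [NonUnitalCStarAlgebra N] [PartialOrder N]
    [StarOrderedRing N] {n : ℕ} (f : Matrix (Fin n) (Fin n) (K →L[ℂ] K) ≃⋆ₐ[ℂ] N)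
    {Z : Matrix (Fin n) (Fin n) (K →L[ℂ] K)} (hZ : 0 ≤ f Z) (ξ : Fin n → K) :
    0 ≤ (∑ k, ∑ l, ⟪ξ k, Z k l (ξ l)⟫_ℂ).re := by
  obtain ⟨Y, hY⟩ := exists_eq_star_mul_self_of_nonneg f hZ
  rw [StarAlgEquiv.symm_apply_apply] at hY
  have h : ∑ k, ∑ l, ⟪ξ k, Z k l (ξ l)⟫_ℂ =
      ∑ m, ⟪∑ k, Y m k (ξ k), ∑ l, Y m l (ξ l)⟫_ℂ := by
    simp only [hY, Matrix.mul_apply, Matrix.star_apply, sum_apply,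
      mul_apply_eq_comp, ContinuousLinearMap.star_eq_adjoint, inner_sum, sum_inner,
      ContinuousLinearMap.adjoint_inner_right]
    rw [Finset.sum_congr rfl fun k _ => Finset.sum_comm, Finset.sum_comm]
    exact Finset.sum_congr rfl fun m _ => Finset.sum_comm
  rw [h, Complex.re_sum]
  exact Finset.sum_nonneg fun m _ => inner_self_nonneg (𝕜 := ℂ)

theorem nonneg_of_re_sum_inner_nonneg {K N : Type*} [NormedAddCommGroup K]
    [InnerProductSpace ℂ K] [CompleteSpace K] [NonUnitalCStarAlgebra N] [PartialOrder N]
    [StarOrderedRing N] {n : ℕ} (f : Matrix (Fin n) (Fin n) (K →L[ℂ] K) ≃⋆ₐ[ℂ] N)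
    {Z : Matrix (Fin n) (Fin n) (K →L[ℂ] K)} (hZ : star Z = Z)
    (h : ∀ ξ : Fin n → K, 0 ≤ (∑ k, ∑ l, ⟪ξ k, Z k l (ξ l)⟫_ℂ).re) : 0 ≤ f Z := by
  refine nonneg_of_matrix_form_nonneg f hZ fun v => ?_
  have hsa : IsSelfAdjoint (∑ i, ∑ j, star (v i) * Z i j * v j) := by
    have hZ' : ∀ i j, star (Z i j) = Z j i := fun i j => by
      rw [← Matrix.star_apply, hZ]
    simp only [IsSelfAdjoint, star_sum, star_mul, star_star, hZ', mul_assoc]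
    exact Finset.sum_comm
  rw [ContinuousLinearMap.nonneg_iff_isPositive, ContinuousLinearMap.isPositive_def']
  refine ⟨hsa, fun x => ?_⟩
  rw [ContinuousLinearMap.reApplyInnerSelf_apply, ← inner_re_symm]
  convert h fun i => v i x using 2
  simp only [sum_apply, mul_apply_eq_comp, inner_sum,
    ContinuousLinearMap.star_eq_adjoint, ContinuousLinearMap.adjoint_inner_right]
  rfl

/-- **Theorem 4.4.** Let `A` be a unital C*-algebra, `E ⊆ A` a selfadjoint
subspace generating `A` which is approximately positively generated, and `K` a Hilbert space.
Every completely bounded completely positive map `φ : E → B(K)` extends to a completely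
positive continuous map `Φ : A → B(K)` (not necessarily with the same cb-norm).  Matrix
levels `Mₙ(A)` and `Mₙ(B(K))` are realized by families of ⋆-isomorphisms onto C*-algebras
`M n` and `N n`. -/
theorem stmt_10 {A : Type*} [CStarAlgebra A] [PartialOrder A] [StarOrderedRing A]
    (E : Submodule ℂ A) (hEclosed : IsClosed (E : Set A)) (hEstar : ∀ x ∈ E, star x ∈ E)
    (hgen : (NonUnitalStarAlgebra.adjoin ℂ (E : Set A)).topologicalClosure = ⊤)
    (hapg : closure {y : A | ∃ p q : A, p ∈ E ∧ 0 ≤ p ∧ q ∈ E ∧ 0 ≤ q ∧ y = p - q} =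
      {x : A | x ∈ E ∧ star x = x})
    (M : ℕ → Type*) [∀ n, NonUnitalCStarAlgebra (M n)] [∀ n, PartialOrder (M n)]
    [∀ n, StarOrderedRing (M n)]
    (e : ∀ n, Matrix (Fin n) (Fin n) A ≃⋆ₐ[ℂ] M n)
    (K : Type*) [NormedAddCommGroup K] [InnerProductSpace ℂ K] [CompleteSpace K]
    (N : ℕ → Type*) [∀ n, NonUnitalCStarAlgebra (N n)] [∀ n, PartialOrder (N n)]
    [∀ n, StarOrderedRing (N n)]
    (f : ∀ n, Matrix (Fin n) (Fin n) (K →L[ℂ] K) ≃⋆ₐ[ℂ] N n)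
    (φ : E →ₗ[ℂ] (K →L[ℂ] K))
    -- `φ` is star-preserving
    (hstar : ∀ (x : A) (hx : x ∈ E) (hsx : star x ∈ E),
      φ ⟨star x, hsx⟩ = star (φ ⟨x, hx⟩))
    -- `φ` is completely positive
    (hcp : ∀ (n : ℕ) (X : M n) (hX : ∀ i j, (e n).symm X i j ∈ E), 0 ≤ X →
      0 ≤ (f n) (Matrix.of fun i j => φ ⟨(e n).symm X i j, hX i j⟩))
    -- `φ` is completely bounded
    (hcb : ∃ C : ℝ, ∀ (n : ℕ) (X : M n) (hX : ∀ i j, (e n).symm X i j ∈ E),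
      ‖(f n) (Matrix.of fun i j => φ ⟨(e n).symm X i j, hX i j⟩)‖ ≤ C * ‖X‖) :
    ∃ Φ : A →L[ℂ] (K →L[ℂ] K),
      (∀ (n : ℕ) (X : M n), 0 ≤ X →
        0 ≤ (f n) (Matrix.of fun i j => Φ ((e n).symm X i j))) ∧
      ∀ (x : A) (hx : x ∈ E), Φ x = φ ⟨x, hx⟩ := by
  obtain ⟨p, hpE, hp⟩ := exists_orderUnit_of_generates E hEstar hgen hapg.ge
  obtain ⟨ψ, hψ⟩ := LinearMap.exists_extend φ
  have hψφ : ∀ (x : A) (hx : x ∈ E), ψ x = φ ⟨x, hx⟩ := fun x hx =>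
    LinearMap.congr_fun hψ ⟨x, hx⟩
  obtain ⟨Φ, hΦE, hΦstar, hΦ⟩ := exists_completelyPositive_extension E hEstar hpE hp ψ
    (fun x hx => by rw [hψφ x hx, hψφ _ (hEstar x hx), hstar])
    (fun n Z hZE hZ h ξ => by
      have hsymm : ∀ i j, (e n).symm (e n Z) i j ∈ E := fun i j => by
        rw [StarAlgEquiv.symm_apply_apply]; exact hZE i j
      have h1 := re_sum_inner_nonneg_of_nonneg (f n)
        (hcp n (e n Z) hsymm (nonneg_of_matrix_form_nonneg (e n) hZ h)) ξ
      simpa only [Matrix.of_apply, ← hψφ, StarAlgEquiv.symm_apply_apply] using h1)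
  refine ⟨Φ, fun n X hX => ?_, fun x hx => (hΦE x hx).trans (hψφ x hx)⟩
  obtain ⟨Y, hY⟩ := exists_eq_star_mul_self_of_nonneg (e n) hX
  refine nonneg_of_re_sum_inner_nonneg (f n) ?_ fun ξ => hΦ n _ (fun w => ?_) ξ
  · ext1 i j
    rw [Matrix.star_apply, Matrix.of_apply, Matrix.of_apply, ← hΦstar, ← Matrix.star_apply, hY,
      star_mul, star_star]
  · have h : ∑ k, ∑ l, star (w k) * (e n).symm X k l * w l =
        ∑ m, star (∑ k, Y m k * w k) * ∑ l, Y m l * w l := by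
      simp only [hY, Matrix.mul_apply, Matrix.star_apply, star_sum, star_mul, Finset.mul_sum,
        Finset.sum_mul, mul_assoc]
      rw [Finset.sum_congr rfl fun k _ => Finset.sum_comm, Finset.sum_comm]
      exact Finset.sum_congr rfl fun m _ => Finset.sum_comm
    rw [h]
    exact Finset.sum_nonneg fun m _ => star_mul_self_nonneg _
end
end
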